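/- Let k be a field, I an ideal in Q = k[x_1,…,x_t] generated by monomials of degree at least 2 with minimal generating set M, and R = Q/I. Then deg b_R(z) ≤ n + g, where b_R(z) = b_R(1,…,1,z), n = |M| is the number of minimal generators of I, and g is the largest size of a discrete subset of M. -/

import Mathlib

noncomputable section
attribute [local instance] Classical.propDecidable

namespace MonomialRings

/-- Monomials in variables indexed by `σ`, represented by their exponent vectors. -/
abbrev Mon (σ : Type*) := σ → ℕ

/-- Two monomials have a non-trivial common factor. -/
def NCF {σ : Type*} (a b : Mon σ) : Prop := ∃ i, a i ≠ 0 ∧ b i ≠ 0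

/-- Adjacency in the graph associated to a set of monomials: edges go between distinct
monomials having a non-trivial common factor. -/
def mAdj {σ : Type*} (a b : Mon σ) : Prop := a ≠ b ∧ NCF a b

/-- `a` and `b` are joined by a path inside `S`. -/
def ConnIn {σ : Type*} (S : Finset (Mon σ)) (a b : Mon σ) : Prop :=
  a ∈ S ∧ b ∈ S ∧ Relation.ReflTransGen (fun u v => u ∈ S ∧ v ∈ S ∧ mAdj u v) a b

/-- A monomial set is connected (in particular nonempty). -/
def IsConnected {σ : Type*} (S : Finset (Mon σ)) : Prop :=
  S.Nonempty ∧ ∀ a ∈ S, ∀ b ∈ S, ConnIn S a b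

/-- The connected component of `a` in `S`. -/
def compOf {σ : Type*} (S : Finset (Mon σ)) (a : Mon σ) : Finset (Mon σ) :=
  S.filter (fun b => ConnIn S a b)

/-- The set of connected components of a monomial set. -/
def components {σ : Type*} (S : Finset (Mon σ)) : Finset (Finset (Mon σ)) :=
  S.image (compOf S)

/-- The number of connected components of a monomial set. -/
def ncomp {σ : Type*} (S : Finset (Mon σ)) : ℕ := (components S).card

/-- The least common multiple `m_S` of a finite set of monomials (`m_∅ = 1`). -/
def mlcm {σ : Type*} (S : Finset (Mon σ)) : Mon σ := S.sup id

/-- `S` is saturated in `M`: for all `m ∈ M` and every connected subset `T ⊆ S`,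
`m ∣ m_T` implies `m ∈ S`. -/
def Saturated {σ : Type*} (M S : Finset (Mon σ)) : Prop :=
  S ⊆ M ∧ ∀ m ∈ M, ∀ T ⊆ S, IsConnected T → m ≤ mlcm T → m ∈ S

/-- The set `sat M` of non-empty saturated subsets of `M`. -/
def satSets {σ : Type*} (M : Finset (Mon σ)) : Finset (Finset (Mon σ)) :=
  M.powerset.filter (fun S => S.Nonempty ∧ Saturated M S)

/-- The saturation `S̄` of `S` in `M`. -/
def saturation {σ : Type*} (M S : Finset (Mon σ)) : Finset (Mon σ) :=
  M.filter (fun m => ∃ C ∈ components S, m ≤ mlcm C)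

/-- The simplicial complex `Δ'_S`: faces are the `T ⊆ S` with `m_T ≠ m_S`, or such that
`S_i ∩ T` is disconnected for some connected component `S_i` of `S`. -/
def dprime {σ : Type*} (S : Finset (Mon σ)) : Set (Finset (Mon σ)) :=
  {T | T ⊆ S ∧ (mlcm T ≠ mlcm S ∨ ∃ C ∈ components S, ¬ IsConnected (C ∩ T))}

/-- The simplicial complex `Δ_N`: faces are the `S ⊆ N` with `m_S ≠ m_N` or `S`
disconnected. -/
def dcomplex {σ : Type*} (N : Finset (Mon σ)) : Set (Finset (Mon σ)) :=
  {T | T ⊆ N ∧ (mlcm T ≠ mlcm N ∨ ¬ IsConnected T)}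

/-- A discrete monomial set: the monomials are pairwise without common factors. -/
def Discrete {σ : Type*} (S : Finset (Mon σ)) : Prop :=
  ∀ a ∈ S, ∀ b ∈ S, a ≠ b → ¬ NCF a b

/-- The lcm-lattice of the monomial set `M` (as a finite set of monomials,
ordered by divisibility i.e. by `≤` on exponent vectors). -/
def lcmLattice {σ : Type*} (M : Finset (Mon σ)) : Finset (Mon σ) :=
  M.powerset.image mlcm

/-- `M_l`: the set of monomials in `M` dividing the monomial `l`. -/
def divisorsIn {σ : Type*} (M : Finset (Mon σ)) (l : Mon σ) : Finset (Mon σ) :=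
  M.filter (fun m => m ≤ l)

/-- `M_N`: the set of monomials in `M` dividing some monomial of `N`. -/
def divisorsInSet {σ : Type*} (M N : Finset (Mon σ)) : Finset (Mon σ) :=
  M.filter (fun m => ∃ l ∈ N, m ≤ l)

/-- An antichain of monomials (the minimal generating set of the monomial ideal
it generates). -/
def IsAntichain' {σ : Type*} (M : Finset (Mon σ)) : Prop :=
  ∀ m ∈ M, ∀ n ∈ M, m ≤ n → m = n

/-- total degree of a monomial -/
def mdeg {t : ℕ} (m : Mon (Fin t)) : ℕ := ∑ i, m i

end MonomialRings
namespace MonomialRings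

/-! ### The multigraded Poincaré series, via the bar resolution

For a monomial ring `R = k[x₁,…,x_t]/I`, the multigraded vector spaces `Tor^R_{i,α}(k,k)`
are computed by the (normalized) bar resolution of `k` over `R`.  The monomial ring is
determined by the set `J` of exponents of monomials lying in `I`; `R` has `k`-basis the
monomials `x^β` with `β ∉ J`, and the degree-`(i,α)` part of the bar complex has basis the
lists `[β₁,…,β_i]` of nonzero exponent vectors not in `J` with `β₁ + ⋯ + β_i = α`. -/

/-- Lists forming the basis of the multigraded piece of the bar complex. -/
def barBasis {σ : Type*} (J : Set (Mon σ)) (i : ℕ) (α : Mon σ) : Set (List (Mon σ)) :=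
  {l | l.length = i ∧ l.sum = α ∧ ∀ β ∈ l, β ≠ 0 ∧ β ∉ J}

/-- Merging the entries at positions `j` and `j+1` of a list. -/
def mergeAt {σ : Type*} (l : List (Mon σ)) (j : ℕ) : List (Mon σ) :=
  l.take j ++ [l.getD j 0 + l.getD (j + 1) 0] ++ l.drop (j + 2)

/-- The bar differential on a basis element. -/
def barAux (k : Type*) [Field k] {σ : Type*} (J : Set (Mon σ)) (l : List (Mon σ)) :
    List (Mon σ) →₀ k :=
  ∑ j ∈ Finset.range (l.length - 1),
    if l.getD j 0 + l.getD (j + 1) 0 ∉ J then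
      ((-1 : k) ^ (j + 1)) • Finsupp.single (mergeAt l j) (1 : k)
    else 0

/-- The bar differential. -/
def barD (k : Type*) [Field k] {σ : Type*} (J : Set (Mon σ)) :
    (List (Mon σ) →₀ k) →ₗ[k] (List (Mon σ) →₀ k) :=
  Finsupp.linearCombination k (barAux k J)

/-- The degree-`(i,α)` part of the bar complex. -/
def barSub (k : Type*) [Field k] {σ : Type*} (J : Set (Mon σ)) (i : ℕ) (α : Mon σ) :
    Submodule k (List (Mon σ) →₀ k) :=
  Submodule.span k ((fun l => Finsupp.single l (1 : k)) '' barBasis J i α)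

/-- `dim_k Tor^R_{i,α}(k,k)` for the monomial ring `R` determined by `J`. -/
def torDim (k : Type*) [Field k] {σ : Type*} (J : Set (Mon σ)) (i : ℕ) (α : Mon σ) : ℕ :=
  Module.finrank k ↥(barSub k J i α ⊓ LinearMap.ker (barD k J))
    - Module.finrank k ↥(Submodule.map (barD k J) (barSub k J (i + 1) α))

/-- The set of exponent vectors of monomials lying in the ideal `I`. -/
def expSet {t : ℕ} {k : Type*} [Field k] (I : Ideal (MvPolynomial (Fin t) k)) :
    Set (Mon (Fin t)) :=
  {β | MvPolynomial.monomial (Finsupp.equivFunOnFinite.symm β) (1 : k) ∈ I}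

/-- The exponent (in `ℕ^t × ℕ`) of the monomial `x^α z^d`; the extra variable `none`
is the homological variable `z`. -/
def expOf {t : ℕ} (α : Mon (Fin t)) (d : ℕ) : Option (Fin t) →₀ ℕ :=
  Finsupp.equivFunOnFinite.symm (fun o => Option.elim o d α)

/-- The multigraded Poincaré series
`P^R_k(x,z) = ∑_{i,α} dim_k Tor^R_{i,α}(k,k) x^α z^i` of the monomial ring `R`
determined by `J`, as a formal power series in `x₁,…,x_t` and `z` (the variable `none`). -/
def poincareSeries (k : Type*) [Field k] {t : ℕ} (J : Set (Mon (Fin t))) :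
    MvPowerSeries (Option (Fin t)) ℤ :=
  fun e => (torDim k J (e none) (fun i => e (some i)) : ℤ)

/-- The statement that `b` is the Backelin denominator of the Poincaré series:
`P^R_k(x,z) = ∏ᵢ(1+xᵢz) / b(x,z)`. -/
def IsDenominator (k : Type*) [Field k] {t : ℕ} (J : Set (Mon (Fin t)))
    (b : MvPolynomial (Option (Fin t)) ℤ) : Prop :=
  (b : MvPowerSeries (Option (Fin t)) ℤ) * poincareSeries k J
    = ∏ i : Fin t, (1 + MvPowerSeries.X (some i) * MvPowerSeries.X none)

/-- The multigraded ideal of a monomial set: the exponents `β` with `x^m ∣ x^β` for some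
`m ∈ M`. -/
def upperSet {σ : Type*} (M : Finset (Mon σ)) : Set (Mon σ) :=
  {β | ∃ m ∈ M, m ≤ β}

/-- `I` is the monomial ideal generated by the monomial set `M`. -/
def IsMonomialIdealOf {t : ℕ} {k : Type*} [Field k] (M : Finset (Mon (Fin t)))
    (I : Ideal (MvPolynomial (Fin t) k)) : Prop :=
  I = Ideal.span ((fun m => MvPolynomial.monomial (Finsupp.equivFunOnFinite.symm m) (1 : k)) '' ↑M)

/-- The specialization `b(z) = b(1,…,1,z)` of a polynomial in `x₁,…,x_t,z`. -/
def zSpecialize {t : ℕ} (b : MvPolynomial (Option (Fin t)) ℤ) : Polynomial ℤ :=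
  MvPolynomial.aeval (fun o : Option (Fin t) => Option.elim o Polynomial.X (fun _ => 1)) b

end MonomialRings
open MonomialRings


namespace MonomialRings

open Finsupp hiding some

section LinearAlgebra

variable {k : Type*} [Field k] {X Y : Type*}

lemma lin_mem {V : Type*} [AddCommGroup V] [Module k V] {s : Set X} {f : (X →₀ k) →ₗ[k] V}
    {p : Submodule k V} (h : ∀ x ∈ s, f (single x 1) ∈ p) {v : X →₀ k}
    (hv : v ∈ supported k k s) : f v ∈ p := by
  have : supported k k s ≤ p.comap f := by
    rw [supported_eq_span_single, Submodule.span_le]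
    rintro _ ⟨x, hx, rfl⟩
    exact h x hx
  exact this hv

lemma lin_eq {V : Type*} [AddCommGroup V] [Module k V] {s : Set X} {f g : (X →₀ k) →ₗ[k] V}
    (h : ∀ x ∈ s, f (single x 1) = g (single x 1)) {v : X →₀ k}
    (hv : v ∈ supported k k s) : f v = g v := by
  have := lin_mem (s := s) (f := f - g) (p := ⊥)
    (fun x hx => by simp [h x hx]) hv
  simpa [sub_eq_zero] using this

/-- The dimension of the image of `Z` in the quotient by `B`. -/
def qdim {V : Type*} [AddCommGroup V] [Module k V] (Z B : Submodule k V) : ℕ :=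
  Module.finrank k (Z ⧸ B.submoduleOf Z)

lemma qdim_eq {V W : Type*} [AddCommGroup V] [Module k V] [AddCommGroup W] [Module k W]
    {Z B : Submodule k V} {Z' B' : Submodule k W} (f : V →ₗ[k] W)
    (hf : ∀ v ∈ Z, f v ∈ Z') (h1 : ∀ v ∈ Z, f v ∈ B' ↔ v ∈ B)
    (h2 : ∀ w ∈ Z', ∃ v ∈ Z, w - f v ∈ B') : qdim Z B = qdim Z' B' := by
  have hB : B.submoduleOf Z ≤ (B'.submoduleOf Z').comap (f.restrict hf) := fun x hx =>
    (h1 x.1 x.2).2 hx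
  refine LinearEquiv.finrank_eq (LinearEquiv.ofBijective
    ((B.submoduleOf Z).mapQ (B'.submoduleOf Z') (f.restrict hf) hB) ⟨?_, ?_⟩)
  · rw [← LinearMap.ker_eq_bot, Submodule.eq_bot_iff]
    intro x hx
    induction x using Submodule.Quotient.induction_on with
    | _ x =>
      rw [LinearMap.mem_ker, Submodule.mapQ_apply, Submodule.Quotient.mk_eq_zero] at hx
      exact (Submodule.Quotient.mk_eq_zero _).2 ((h1 x.1 x.2).1 hx)
  · intro y
    induction y using Submodule.Quotient.induction_on with
    | _ y =>
      obtain ⟨x, hx, h⟩ := h2 y.1 y.2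
      refine ⟨Submodule.Quotient.mk ⟨x, hx⟩, ?_⟩
      rw [Submodule.mapQ_apply]
      exact ((Submodule.Quotient.eq (B'.submoduleOf Z')).2 h).symm

lemma qdim_eq_zero {V : Type*} [AddCommGroup V] [Module k V] {Z B : Submodule k V}
    (h : Z ≤ B) : qdim Z B = 0 := by
  have : B.submoduleOf Z = ⊤ := by
    rw [Submodule.submoduleOf, Submodule.comap_subtype_eq_top]
    exact h
  unfold qdim
  rw [this]
  exact Module.finrank_zero_of_subsingleton

lemma qdim_add_finrank {V : Type*} [AddCommGroup V] [Module k V] {Z B : Submodule k V}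
    [FiniteDimensional k Z] (h : B ≤ Z) : qdim Z B + Module.finrank k B = Module.finrank k Z := by
  rw [← Submodule.finrank_quotient_add_finrank (B.submoduleOf Z), qdim,
    (Submodule.submoduleOfEquivOfLe h).finrank_eq]

end LinearAlgebra

/-- Multidegrees: the index `none` is the homological degree. -/
abbrev Dg (σ : Type*) := Option σ →₀ ℕ

/-- The degree of the homological variable. -/
def zz {σ : Type*} : Dg σ := single none 1

/-- A multigraded complex with a distinguished basis, consisting of the elements of `ok`. -/
structure Cx (k : Type*) [Field k] (σ X : Type*) where
  ok : Set X
  deg : X → Dg σ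
  d : (X →₀ k) →ₗ[k] (X →₀ k)
  d_mem : ∀ x ∈ ok, d (single x 1) ∈ supported k k {y | y ∈ ok ∧ deg y + zz = deg x}
  dd : ∀ x ∈ ok, d (d (single x 1)) = 0

namespace Cx

variable {k : Type*} [Field k] {σ X Y : Type*} (C : Cx k σ X) (C' : Cx k σ Y)

/-- The homogeneous component of a given degree. -/
def gr (δ : Dg σ) : Submodule k (X →₀ k) := supported k k {x | x ∈ C.ok ∧ C.deg x = δ}

/-- The homogeneous component one homological degree below. -/
def gm (δ : Dg σ) : Submodule k (X →₀ k) := supported k k {x | x ∈ C.ok ∧ C.deg x + zz = δ}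

lemma single_mem_gr {x : X} (hx : x ∈ C.ok) {δ : Dg σ} (h : C.deg x = δ) (c : k) :
    single x c ∈ C.gr δ := single_mem_supported k c ⟨hx, h⟩

lemma d_gr {δ : Dg σ} {v : X →₀ k} (hv : v ∈ C.gr δ) : C.d v ∈ C.gm δ :=
  lin_mem (fun x hx => by have := C.d_mem x hx.1; rw [hx.2] at this; exact this) hv

lemma gm_add (δ : Dg σ) : C.gm (δ + zz) = C.gr δ := by
  unfold gm gr
  congr 1
  ext x
  simp

lemma d_gr' {δ : Dg σ} {v : X →₀ k} (hv : v ∈ C.gr (δ + zz)) : C.d v ∈ C.gr δ := by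
  rw [← C.gm_add]; exact C.d_gr hv

lemma d_d {δ : Dg σ} {v : X →₀ k} (hv : v ∈ C.gr δ) : C.d (C.d v) = 0 :=
  lin_eq (f := C.d ∘ₗ C.d) (g := 0) (fun x hx => by simpa using C.dd x hx.1) hv

lemma gm_eq_bot_or (δ : Dg σ) : C.gm δ = ⊥ ∨ ∃ δ', δ = δ' + zz := by
  by_cases h : ∃ δ', δ = δ' + zz
  · exact Or.inr h
  · left
    unfold gm
    rw [Set.eq_empty_of_forall_notMem (s := {x | x ∈ C.ok ∧ C.deg x + zz = δ})
      (fun x hx => h ⟨_, hx.2.symm⟩), supported_empty]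

/-- Cycles. -/
def Z (δ : Dg σ) : Submodule k (X →₀ k) := C.gr δ ⊓ LinearMap.ker C.d

/-- Boundaries. -/
def B (δ : Dg σ) : Submodule k (X →₀ k) := (C.gr (δ + zz)).map C.d

/-- Dimension of the homology. -/
def hdim (δ : Dg σ) : ℕ := qdim (C.Z δ) (C.B δ)

/-- Exactness at a degree. -/
def Exact (δ : Dg σ) : Prop := ∀ v ∈ C.gr δ, C.d v = 0 → ∃ w ∈ C.gr (δ + zz), C.d w = v

lemma B_le_Z (δ : Dg σ) : C.B δ ≤ C.Z δ := by
  rintro _ ⟨v, hv, rfl⟩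
  exact ⟨C.d_gr' hv, C.d_d hv⟩

lemma Exact.hdim {C : Cx k σ X} {δ : Dg σ} (h : C.Exact δ) : C.hdim δ = 0 :=
  qdim_eq_zero fun v hv => h v hv.1 hv.2

variable {C C'}

lemma hdim_eq_of_map {δ : Dg σ} (f : (X →₀ k) →ₗ[k] (Y →₀ k))
    (hf : ∀ v ∈ C.Z δ, f v ∈ C'.Z δ)
    (h1 : ∀ v ∈ C.Z δ, f v ∈ C'.B δ ↔ v ∈ C.B δ)
    (h2 : ∀ w ∈ C'.Z δ, ∃ v ∈ C.Z δ, w - f v ∈ C'.B δ) : C.hdim δ = C'.hdim δ :=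
  qdim_eq f hf h1 h2

/-- Perturbed contraction data induce isomorphisms on homology. -/
structure QI (C : Cx k σ X) (C' : Cx k σ Y) where
  f : (X →₀ k) →ₗ[k] (Y →₀ k)
  sec : (Y →₀ k) →ₗ[k] (X →₀ k)
  h : (X →₀ k) →ₗ[k] (X →₀ k)
  μ : X → ℕ
  f_mem : ∀ x ∈ C.ok, f (single x 1) ∈ C'.gr (C.deg x)
  f_d : ∀ x ∈ C.ok, f (C.d (single x 1)) = C'.d (f (single x 1))
  sec_mem : ∀ y ∈ C'.ok, sec (single y 1) ∈ C.gr (C'.deg y)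
  f_sec : ∀ y ∈ C'.ok, f (sec (single y 1)) = single y 1
  h_mem : ∀ x ∈ C.ok, h (single x 1) ∈ C.gr (C.deg x + zz)
  f_h : ∀ x ∈ C.ok, f (h (single x 1)) = 0
  lower : ∀ x ∈ C.ok, single x 1 - (C.d (h (single x 1)) + h (C.d (single x 1)) +
    sec (f (single x 1))) ∈ supported k k {y | μ y < μ x}

namespace QI

variable (q : QI C C')
include q

lemma f_gr {δ : Dg σ} {v : X →₀ k} (hv : v ∈ C.gr δ) : q.f v ∈ C'.gr δ :=
  lin_mem (fun x hx => by rw [← hx.2]; exact q.f_mem x hx.1) hv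

lemma f_d' {δ : Dg σ} {v : X →₀ k} (hv : v ∈ C.gr δ) : q.f (C.d v) = C'.d (q.f v) :=
  lin_eq (f := q.f ∘ₗ C.d) (g := C'.d ∘ₗ q.f) (fun x hx => q.f_d x hx.1) hv

lemma sec_gr {δ : Dg σ} {v : Y →₀ k} (hv : v ∈ C'.gr δ) : q.sec v ∈ C.gr δ :=
  lin_mem (fun x hx => by rw [← hx.2]; exact q.sec_mem x hx.1) hv

lemma f_sec' {δ : Dg σ} {v : Y →₀ k} (hv : v ∈ C'.gr δ) : q.f (q.sec v) = v :=
  lin_eq (f := q.f ∘ₗ q.sec) (g := LinearMap.id) (fun x hx => q.f_sec x hx.1) hv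

lemma h_gm {δ : Dg σ} {v : X →₀ k} (hv : v ∈ C.gm δ) : q.h v ∈ C.gr δ :=
  lin_mem (fun x hx => by rw [← hx.2]; exact q.h_mem x hx.1) hv

lemma f_h' {δ : Dg σ} {v : X →₀ k} (hv : v ∈ C.gm δ) : q.f (q.h v) = 0 :=
  lin_eq (f := q.f ∘ₗ q.h) (g := 0) (fun x hx => q.f_h x hx.1) hv

lemma exists_lift {δ : Dg σ} (n : ℕ) : ∀ v ∈ C.gm δ, v ∈ supported k k {x | q.μ x < n} →
    C.d v = 0 → q.f v = 0 → ∃ w ∈ C.gr δ, C.d w = v ∧ q.f w = 0 := by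
  induction n with
  | zero =>
    intro v _ hv _ _
    have : v = 0 := by simpa using hv
    subst this
    exact ⟨0, Submodule.zero_mem _, by simp, by simp⟩
  | succ n ih =>
    intro v hv hn hd hf
    have hh := q.h_gm hv
    have h1 : v - C.d (q.h v) ∈ supported k k {x | q.μ x < n} := by
      have : v ∈ supported k k {x | x ∈ C.ok ∧ q.μ x < n + 1} := by
        rw [mem_supported] at hn ⊢
        have := (mem_supported _ _).1 hv
        exact fun x hx => ⟨(this hx).1, hn hx⟩
      have := lin_mem (f := LinearMap.id - (C.d ∘ₗ q.h + q.h ∘ₗ C.d + q.sec ∘ₗ q.f))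
        (p := supported k k {x | q.μ x < n}) (fun x hx => by
          refine supported_mono ?_ (q.lower x hx.1)
          intro y hy
          exact lt_of_lt_of_le hy (Nat.lt_succ_iff.1 hx.2)) this
      simpa [hd, hf] using this
    obtain ⟨w, hw, hdw, hfw⟩ := ih (v - C.d (q.h v))
      (Submodule.sub_mem _ hv (C.d_gr hh)) h1
      (by rw [map_sub, hd, C.d_d hh, sub_zero])
      (by rw [map_sub, hf, q.f_d' hh, q.f_h' hv, map_zero, sub_zero])
    exact ⟨w + q.h v, Submodule.add_mem _ hw hh, by rw [map_add, hdw]; abel,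
      by rw [map_add, hfw, q.f_h' hv, add_zero]⟩

lemma exists_lift' {δ : Dg σ} {v : X →₀ k} (hv : v ∈ C.gm δ) (hd : C.d v = 0) (hf : q.f v = 0) :
    ∃ w ∈ C.gr δ, C.d w = v ∧ q.f w = 0 := by
  refine q.exists_lift (v.support.sup q.μ + 1) v hv ?_ hd hf
  rw [mem_supported]
  exact fun x hx => Nat.lt_succ_iff.2 (Finset.le_sup (f := q.μ) hx)

theorem hdim_eq (δ : Dg σ) : C.hdim δ = C'.hdim δ := by
  refine hdim_eq_of_map q.f ?_ ?_ ?_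
  · rintro v ⟨hv, hd⟩
    exact ⟨q.f_gr hv, LinearMap.mem_ker.2 <| by rw [← q.f_d' hv, LinearMap.mem_ker.1 hd, map_zero]⟩
  · rintro v ⟨hv, hd⟩
    constructor
    · rintro ⟨y, hy, hyv⟩
      have hs := q.sec_gr hy
      obtain ⟨w, hw, hdw, -⟩ := q.exists_lift' (δ := δ + zz) (v := v - C.d (q.sec y))
        (by rw [C.gm_add]; exact Submodule.sub_mem _ hv (C.d_gr' hs))
        (by rw [map_sub, LinearMap.mem_ker.1 hd, C.d_d hs, sub_zero])
        (by rw [map_sub, q.f_d' hs, q.f_sec' hy, hyv, sub_self])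
      exact ⟨w + q.sec y, Submodule.add_mem _ hw hs, by rw [map_add, hdw]; abel⟩
    · rintro ⟨w, hw, rfl⟩
      exact ⟨q.f w, q.f_gr hw, (q.f_d' hw).symm⟩
  · rintro y ⟨hy, hd⟩
    have hs := q.sec_gr hy
    obtain ⟨w, hw, hdw, hfw⟩ := q.exists_lift' (δ := δ) (v := C.d (q.sec y)) (C.d_gr hs)
        (C.d_d hs) (by rw [q.f_d' hs, q.f_sec' hy, LinearMap.mem_ker.1 hd])
    refine ⟨q.sec y - w, ⟨Submodule.sub_mem _ hs hw, LinearMap.mem_ker.2 ?_⟩, ?_⟩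
    · rw [map_sub, hdw, sub_self]
    · rw [map_sub, q.f_sec' hy, hfw]
      simp

end QI

/-- A perturbed contraction to zero gives exactness. -/
lemma exact_of_contraction (C : Cx k σ X) (s : Dg σ → Prop) (h : (X →₀ k) →ₗ[k] (X →₀ k))
    (μ : X → ℕ)
    (h_mem : ∀ x ∈ C.ok, s (C.deg x) → h (single x 1) ∈ C.gr (C.deg x + zz))
    (lower : ∀ x ∈ C.ok, s (C.deg x) → single x 1 - (C.d (h (single x 1)) +
      h (C.d (single x 1))) ∈ supported k k {y | μ y < μ x}) (δ : Dg σ) (hδ : s δ) :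
    C.Exact δ := by
  have hh : ∀ v ∈ C.gr δ, h v ∈ C.gr (δ + zz) := fun v hv =>
    lin_mem (fun x hx => by
      have := h_mem x hx.1 (by rw [hx.2]; exact hδ)
      rwa [hx.2] at this) hv
  have key : ∀ n : ℕ, ∀ v ∈ C.gr δ, v ∈ supported k k {x | μ x < n} → C.d v = 0 →
      ∃ w ∈ C.gr (δ + zz), C.d w = v := by
    intro n
    induction n with
    | zero =>
      intro v _ hv _
      have : v = 0 := by simpa using hv
      subst this
      exact ⟨0, Submodule.zero_mem _, by simp⟩
    | succ n ih =>
      intro v hv hn hd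
      have h1 : v - C.d (h v) ∈ supported k k {x | μ x < n} := by
        have : v ∈ supported k k {x | (x ∈ C.ok ∧ C.deg x = δ) ∧ μ x < n + 1} := by
          rw [mem_supported] at hn ⊢
          have := (mem_supported _ _).1 hv
          exact fun x hx => ⟨this hx, hn hx⟩
        have := lin_mem (f := LinearMap.id - (C.d ∘ₗ h + h ∘ₗ C.d))
          (p := supported k k {x | μ x < n}) (fun x hx => by
            refine supported_mono ?_ (lower x hx.1.1 (by rw [hx.1.2]; exact hδ))
            intro y hy
            exact lt_of_lt_of_le hy (Nat.lt_succ_iff.1 hx.2)) this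
        simpa [hd] using this
      obtain ⟨w, hw, hdw⟩ := ih (v - C.d (h v))
        (Submodule.sub_mem _ hv (C.d_gr' (hh v hv))) h1
        (by rw [map_sub, hd, C.d_d (hh v hv), sub_zero])
      exact ⟨w + h v, Submodule.add_mem _ hw (hh v hv), by rw [map_add, hdw]; abel⟩
  intro v hv hd
  refine key (v.support.sup μ + 1) v hv ?_ hd
  rw [mem_supported]
  exact fun x hx => Nat.lt_succ_iff.2 (Finset.le_sup (f := μ) hx)

end Cx

end MonomialRings

namespace MonomialRings

open Finsupp hiding some

namespace Cx

variable {k : Type*} [Field k] {σ X Y : Type*}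

/-- Every homogeneous component has a finite basis. -/
def LocFin (C : Cx k σ X) : Prop := ∀ δ, {x | x ∈ C.ok ∧ C.deg x = δ}.Finite

lemma LocFin.finiteDimensional {C : Cx k σ X} (h : C.LocFin) (δ : Dg σ) :
    FiniteDimensional k (C.gr δ) := by
  unfold gr
  rw [supported_eq_span_single]
  exact FiniteDimensional.span_of_finite k ((h δ).image _)

lemma Z_le_gr (C : Cx k σ X) (δ : Dg σ) : C.Z δ ≤ C.gr δ := inf_le_left

lemma LocFin.hdim_add_finrank {C : Cx k σ X} (h : C.LocFin) (δ : Dg σ) :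
    C.hdim δ + Module.finrank k (C.B δ) = Module.finrank k (C.Z δ) := by
  have := h.finiteDimensional δ
  have : FiniteDimensional k (C.Z δ) := Submodule.finiteDimensional_of_le (C.Z_le_gr δ)
  exact qdim_add_finrank (C.B_le_Z δ)

lemma finrank_sup_of_disjoint {V : Type*} [AddCommGroup V] [Module k V] {A B : Submodule k V}
    [FiniteDimensional k A] [FiniteDimensional k B] (h : Disjoint A B) :
    Module.finrank k ↥(A ⊔ B) = Module.finrank k A + Module.finrank k B := by
  rw [← Submodule.finrank_sup_add_finrank_inf_eq, h.eq_bot, finrank_bot, add_zero]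

lemma hdim_add {C C1 C2 : Cx k σ X} (hd1 : C1.d = C.d) (hd2 : C2.d = C.d)
    (hg1 : C1.deg = C.deg) (hg2 : C2.deg = C.deg) (hok : C.ok = C1.ok ∪ C2.ok)
    (hdis : Disjoint C1.ok C2.ok) (hfin : C.LocFin) (δ : Dg σ) :
    C.hdim δ = C1.hdim δ + C2.hdim δ := by
  have hf1 : C1.LocFin := fun δ => (hfin δ).subset fun x hx =>
    ⟨by rw [hok]; exact Or.inl hx.1, by rw [← hg1]; exact hx.2⟩
  have hf2 : C2.LocFin := fun δ => (hfin δ).subset fun x hx =>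
    ⟨by rw [hok]; exact Or.inr hx.1, by rw [← hg2]; exact hx.2⟩
  have hgr : ∀ δ, C.gr δ = C1.gr δ ⊔ C2.gr δ := by
    intro δ
    unfold gr
    rw [← supported_union, hok, hg1, hg2]
    congr 1
    ext x
    simp [or_and_right]
  have hdisg : ∀ δ, Disjoint (C1.gr δ) (C2.gr δ) := fun δ =>
    disjoint_supported_supported (hdis.mono (fun x hx => hx.1) (fun x hx => hx.1))
  have hdism : ∀ δ, Disjoint (C1.gm δ) (C2.gm δ) := fun δ =>
    disjoint_supported_supported (hdis.mono (fun x hx => hx.1) (fun x hx => hx.1))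
  have hZ : C.Z δ = C1.Z δ ⊔ C2.Z δ := by
    apply le_antisymm
    · rintro v ⟨hv, hd⟩
      rw [hgr] at hv
      obtain ⟨v1, h1, v2, h2, rfl⟩ := Submodule.mem_sup.1 hv
      have hd' : C.d v1 + C.d v2 = 0 := by rw [← map_add]; exact hd
      have e1 : C.d v1 ∈ C1.gm δ := by rw [← hd1]; exact C1.d_gr h1
      have e2 : C.d v2 ∈ C2.gm δ := by rw [← hd2]; exact C2.d_gr h2
      have z1 : C.d v1 = 0 := by
        refine (Submodule.disjoint_def.1 (hdism δ)) _ e1 ?_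
        rw [eq_neg_of_add_eq_zero_left hd']
        exact Submodule.neg_mem _ e2
      have z2 : C.d v2 = 0 := by rw [z1, zero_add] at hd'; exact hd'
      exact Submodule.mem_sup.2 ⟨v1, ⟨h1, LinearMap.mem_ker.2 (by rw [hd1, z1])⟩, v2,
        ⟨h2, LinearMap.mem_ker.2 (by rw [hd2, z2])⟩, rfl⟩
    · refine sup_le ?_ ?_
      · rintro v ⟨hv, hd⟩
        rw [hd1] at hd
        exact ⟨by rw [hgr]; exact Submodule.mem_sup_left hv, hd⟩
      · rintro v ⟨hv, hd⟩
        rw [hd2] at hd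
        exact ⟨by rw [hgr]; exact Submodule.mem_sup_right hv, hd⟩
  have hB : C.B δ = C1.B δ ⊔ C2.B δ := by
    unfold B
    rw [hgr, Submodule.map_sup, hd1, hd2]
  have i1 := hf1.finiteDimensional δ
  have i2 := hf2.finiteDimensional δ
  have : FiniteDimensional k (C1.Z δ) := Submodule.finiteDimensional_of_le (C1.Z_le_gr δ)
  have : FiniteDimensional k (C2.Z δ) := Submodule.finiteDimensional_of_le (C2.Z_le_gr δ)
  have : FiniteDimensional k (C1.B δ) := Submodule.finiteDimensional_of_le (C1.B_le_Z δ)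
  have : FiniteDimensional k (C2.B δ) := Submodule.finiteDimensional_of_le (C2.B_le_Z δ)
  have e0 := hfin.hdim_add_finrank δ
  have e1 := hf1.hdim_add_finrank δ
  have e2 := hf2.hdim_add_finrank δ
  have eZ := finrank_sup_of_disjoint ((hdisg δ).mono (C1.Z_le_gr δ) (C2.Z_le_gr δ))
  have eB := finrank_sup_of_disjoint ((hdisg δ).mono ((C1.B_le_Z δ).trans (C1.Z_le_gr δ))
    ((C2.B_le_Z δ).trans (C2.Z_le_gr δ)))
  rw [← hZ] at eZ
  rw [← hB] at eB
  omega

/-- Chain homotopy equivalences with strict homotopy data on both sides. -/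
lemma hdim_eq_of_homotopy {C : Cx k σ X} {C' : Cx k σ Y} (f : (X →₀ k) →ₗ[k] (Y →₀ k))
    (g : (Y →₀ k) →ₗ[k] (X →₀ k)) (h : (X →₀ k) →ₗ[k] (X →₀ k))
    (f_mem : ∀ x ∈ C.ok, f (single x 1) ∈ C'.gr (C.deg x))
    (f_d : ∀ x ∈ C.ok, f (C.d (single x 1)) = C'.d (f (single x 1)))
    (g_mem : ∀ y ∈ C'.ok, g (single y 1) ∈ C.gr (C'.deg y))
    (g_d : ∀ y ∈ C'.ok, g (C'.d (single y 1)) = C.d (g (single y 1)))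
    (f_g : ∀ y ∈ C'.ok, f (g (single y 1)) = single y 1)
    (h_mem : ∀ x ∈ C.ok, h (single x 1) ∈ C.gr (C.deg x + zz))
    (hom : ∀ x ∈ C.ok, single x 1 = C.d (h (single x 1)) + h (C.d (single x 1)) +
      g (f (single x 1))) (δ : Dg σ) : C.hdim δ = C'.hdim δ := by
  have f_gr : ∀ δ, ∀ v ∈ C.gr δ, f v ∈ C'.gr δ := fun δ v hv =>
    lin_mem (fun x hx => by rw [← hx.2]; exact f_mem x hx.1) hv
  have f_d' : ∀ δ, ∀ v ∈ C.gr δ, f (C.d v) = C'.d (f v) := fun δ v hv =>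
    lin_eq (f := f ∘ₗ C.d) (g := C'.d ∘ₗ f) (fun x hx => f_d x hx.1) hv
  have g_gr : ∀ δ, ∀ v ∈ C'.gr δ, g v ∈ C.gr δ := fun δ v hv =>
    lin_mem (fun x hx => by rw [← hx.2]; exact g_mem x hx.1) hv
  have g_d' : ∀ δ, ∀ v ∈ C'.gr δ, g (C'.d v) = C.d (g v) := fun δ v hv =>
    lin_eq (f := g ∘ₗ C'.d) (g := C.d ∘ₗ g) (fun x hx => g_d x hx.1) hv
  have f_g' : ∀ δ, ∀ v ∈ C'.gr δ, f (g v) = v := fun δ v hv =>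
    lin_eq (f := f ∘ₗ g) (g := LinearMap.id) (fun x hx => f_g x hx.1) hv
  have h_gr : ∀ δ, ∀ v ∈ C.gr δ, h v ∈ C.gr (δ + zz) := fun δ v hv =>
    lin_mem (fun x hx => by rw [← hx.2]; exact h_mem x hx.1) hv
  have hom' : ∀ δ, ∀ v ∈ C.gr δ, v = C.d (h v) + h (C.d v) + g (f v) := fun δ v hv =>
    lin_eq (f := LinearMap.id) (g := C.d ∘ₗ h + h ∘ₗ C.d + g ∘ₗ f) (fun x hx => hom x hx.1) hv
  refine hdim_eq_of_map f ?_ ?_ ?_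
  · rintro v ⟨hv, hd⟩
    exact ⟨f_gr _ _ hv, LinearMap.mem_ker.2 <| by
      rw [← f_d' _ _ hv, LinearMap.mem_ker.1 hd, map_zero]⟩
  · rintro v ⟨hv, hd⟩
    constructor
    · rintro ⟨y, hy, hyv⟩
      refine ⟨h v + g y, Submodule.add_mem _ (h_gr _ _ hv) (g_gr _ _ hy), ?_⟩
      conv_rhs => rw [hom' _ _ hv, LinearMap.mem_ker.1 hd, ← hyv, g_d' _ _ hy]
      rw [map_add, map_zero, add_zero]
    · rintro ⟨w, hw, rfl⟩
      exact ⟨f w, f_gr _ _ hw, (f_d' _ _ hw).symm⟩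
  · rintro y ⟨hy, hd⟩
    refine ⟨g y, ⟨g_gr _ _ hy, LinearMap.mem_ker.2 ?_⟩, ?_⟩
    · rw [← g_d' _ _ hy, LinearMap.mem_ker.1 hd, map_zero]
    · rw [f_g' _ _ hy, sub_self]
      exact Submodule.zero_mem _

/-- A complex with zero differential. -/
def ofBasis (k : Type*) [Field k] (b : Y → Dg σ) : Cx k σ Y where
  ok := Set.univ
  deg := b
  d := 0
  d_mem := by simp
  dd := by simp

lemma ofBasis_hdim (b : Y → Dg σ) (δ : Dg σ) (hf : {y | b y = δ}.Finite) :
    (ofBasis k b).hdim δ = {y | b y = δ}.ncard := by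
  have hZ : (ofBasis k b).Z δ = supported k k {y | b y = δ} := by
    simp [Z, gr, ofBasis]
  have hB : (ofBasis k b).B δ = ⊥ := by
    simp [B, ofBasis]
  unfold hdim
  rw [hZ, hB]
  have : Finite {y | b y = δ} := hf
  have : Fintype {y | b y = δ} := Fintype.ofFinite _
  have e := supportedEquivFinsupp (M := k) (R := k) {y | b y = δ}
  have : FiniteDimensional k (supported k k {y | b y = δ}) := e.symm.finiteDimensional
  have := qdim_add_finrank (k := k) (Z := supported k k {y | b y = δ}) (B := ⊥) bot_le
  rw [finrank_bot, add_zero] at this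
  rw [this, e.finrank_eq, Module.finrank_finsupp_self,
    Set.ncard_eq_toFinset_card', Set.toFinset_card]

end Cx

end MonomialRings

namespace MonomialRings

open Finsupp hiding some

section Tensor

variable {k : Type*} [Field k] {X Y X' Y' : Type*}

lemma exists_projection {V : Type*} [AddCommGroup V] [Module k V] (W : Submodule k V) :
    ∃ π : V →ₗ[k] W, ∀ v (hv : v ∈ W), π v = ⟨v, hv⟩ := by
  obtain ⟨π, hπ⟩ := W.subtype.exists_leftInverse_of_injective (Submodule.ker_subtype _)
  exact ⟨π, fun v hv => LinearMap.congr_fun hπ ⟨v, hv⟩⟩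

lemma exists_partial_inverse_on {V W : Type*} [AddCommGroup V] [Module k V] [AddCommGroup W]
    [Module k W] (f : V →ₗ[k] W) (A : Submodule k V) :
    ∃ g : W →ₗ[k] V, (∀ w, g w ∈ A) ∧ ∀ v ∈ A, f (g (f v)) = f v := by
  let D : A →ₗ[k] W := f.domRestrict _
  obtain ⟨r, hr⟩ := D.rangeRestrict.exists_rightInverse_of_surjective
    (LinearMap.range_rangeRestrict D)
  obtain ⟨π, hπ⟩ := exists_projection (LinearMap.range D)
  refine ⟨Submodule.subtype _ ∘ₗ r ∘ₗ π, fun v => (r (π v)).2, fun v hv => ?_⟩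
  have h1 : π (f v) = D.rangeRestrict ⟨v, hv⟩ := hπ _ (D.rangeRestrict ⟨v, hv⟩).2
  have h2 := congrArg Subtype.val (LinearMap.congr_fun hr (D.rangeRestrict ⟨v, hv⟩))
  simp only [LinearMap.comp_apply, h1]
  exact h2

lemma nonempty_basis {V : Type*} [AddCommGroup V] [Module k V] (W : Submodule k V)
    [FiniteDimensional k W] : Nonempty (Module.Basis (Fin (Module.finrank k W)) k W) :=
  ⟨Module.finBasis k W⟩

/-- The tensor product of two finitely supported functions. -/
def tm : (X →₀ k) →ₗ[k] (Y →₀ k) →ₗ[k] (X × Y →₀ k) :=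
  (TensorProduct.mk k (X →₀ k) (Y →₀ k)).compr₂ (finsuppTensorFinsupp' k X Y).toLinearMap

lemma tm_single (x : X) (y : Y) (a b : k) :
    tm (single x a) (single y b) = single (x, y) (a * b) := by
  simp [tm]

/-- The tensor product of two linear maps. -/
def tens (A : (X →₀ k) →ₗ[k] (X' →₀ k)) (B : (Y →₀ k) →ₗ[k] (Y' →₀ k)) :
    (X × Y →₀ k) →ₗ[k] (X' × Y' →₀ k) :=
  (finsuppTensorFinsupp' k X' Y').toLinearMap ∘ₗ TensorProduct.map A B ∘ₗ
    (finsuppTensorFinsupp' k X Y).symm.toLinearMap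

lemma tens_tm (A : (X →₀ k) →ₗ[k] (X' →₀ k)) (B : (Y →₀ k) →ₗ[k] (Y' →₀ k)) (u : X →₀ k)
    (v : Y →₀ k) : tens A B (tm u v) = tm (A u) (B v) := by
  simp [tm, tens]

lemma tm_mem {s : Set X} {t : Set Y} {u : X →₀ k} {v : Y →₀ k} (hu : u ∈ supported k k s)
    (hv : v ∈ supported k k t) : tm u v ∈ supported k k (s ×ˢ t) := by
  refine lin_mem (f := tm.flip v) (fun x hx => ?_) hu
  rw [LinearMap.flip_apply]
  refine lin_mem (f := tm (single x (1 : k))) (fun y hy => ?_) hv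
  rw [tm_single]
  exact single_mem_supported _ _ ⟨hx, hy⟩

end Tensor

namespace Cx

variable {k : Type*} [Field k] {σ X Y : Type*}

/-- The parity of a degree. -/
def chi (k : Type*) [Field k] (δ : Dg σ) : k := (-1) ^ δ none

lemma chi_add (δ δ' : Dg σ) : chi k (δ + δ') = chi k δ * chi k δ' := by
  simp [chi, pow_add]

lemma chi_zz (δ : Dg σ) : chi k (δ + zz) = -chi k δ := by
  simp [chi, pow_add, zz]

lemma chi_mul_self (δ : Dg σ) : chi k δ * chi k δ = 1 := by
  rw [chi, ← mul_pow]; simp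

/-- The parity operator. -/
def eps (C : Cx k σ X) : (X →₀ k) →ₗ[k] (X →₀ k) :=
  Finsupp.linearCombination k fun x => single x (chi k (C.deg x))

lemma eps_gr {C : Cx k σ X} {δ : Dg σ} {v : X →₀ k} (hv : v ∈ C.gr δ) :
    C.eps v = chi k δ • v :=
  lin_eq (g := chi k δ • LinearMap.id) (fun x hx => by simp [eps, ← hx.2]) hv

lemma eps_gm {C : Cx k σ X} {δ : Dg σ} {v : X →₀ k} (hv : v ∈ C.gm δ) :
    C.eps v = -chi k δ • v :=
  lin_eq (g := -chi k δ • LinearMap.id) (fun x hx => by simp [eps, ← hx.2, chi_zz]) hv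

lemma gr_sum {C : Cx k σ X} {δ δ' : Dg σ} (h : δ = δ') {v : X →₀ k} (hv : v ∈ C.gr δ) :
    v ∈ C.gr δ' := by
  rwa [← h]

/-- The differential of a product. -/
def prodD (C : Cx k σ X) (C' : Cx k σ Y) : (X × Y →₀ k) →ₗ[k] (X × Y →₀ k) :=
  tens C.d LinearMap.id + tens C.eps C'.d

lemma prodD_tm (C : Cx k σ X) (C' : Cx k σ Y) {δ : Dg σ} {u : X →₀ k} (hu : u ∈ C.gr δ)
    (v : Y →₀ k) : prodD C C' (tm u v) = tm (C.d u) v + chi k δ • tm u (C'.d v) := by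
  simp [prodD, tens_tm, eps_gr hu]

lemma prodD_tm' (C : Cx k σ X) (C' : Cx k σ Y) {δ : Dg σ} {u : X →₀ k} (hu : u ∈ C.gm δ)
    (v : Y →₀ k) : prodD C C' (tm u v) = tm (C.d u) v - chi k δ • tm u (C'.d v) := by
  simp [prodD, tens_tm, eps_gm hu, sub_eq_add_neg]

/-- The tensor product of complexes. -/
def prod (C : Cx k σ X) (C' : Cx k σ Y) : Cx k σ (X × Y) where
  ok := C.ok ×ˢ C'.ok
  deg x := C.deg x.1 + C'.deg x.2
  d := prodD C C'
  d_mem := by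
    rintro ⟨x, y⟩ ⟨hx, hy⟩
    have e : single (x, y) (1 : k) = tm (single x 1) (single y 1) := by simp [tm_single]
    rw [e, prodD_tm C C' (C.single_mem_gr hx rfl 1)]
    refine Submodule.add_mem _ ?_ (Submodule.smul_mem _ _ ?_)
    · refine supported_mono ?_ (tm_mem (C.d_mem x hx)
        (single_mem_supported k (1 : k) (Set.mem_singleton y)))
      rintro ⟨x', y'⟩ ⟨h1, h2⟩
      obtain rfl : y' = y := h2
      exact ⟨⟨h1.1, hy⟩, by rw [← h1.2]; exact add_right_comm _ _ _⟩
    · refine supported_mono ?_ (tm_mem (single_mem_supported k (1 : k) (Set.mem_singleton x))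
        (C'.d_mem y hy))
      rintro ⟨x', y'⟩ ⟨h1, h2⟩
      obtain rfl : x' = x := h1
      exact ⟨⟨hx, h2.1⟩, by rw [← h2.2]; exact add_assoc _ _ _⟩
  dd := by
    rintro ⟨x, y⟩ ⟨hx, hy⟩
    have e : single (x, y) (1 : k) = tm (single x 1) (single y 1) := by simp [tm_single]
    have hx' := C.single_mem_gr hx rfl 1
    rw [e, prodD_tm C C' hx', map_add, map_smul, prodD_tm C C' hx', prodD_tm' C C' (C.d_gr hx'),
      C.dd x hx, C'.dd y hy]
    simp

lemma prod_d (C : Cx k σ X) (C' : Cx k σ Y) : (C.prod C').d = prodD C C' := rfl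

lemma prod_gr {C : Cx k σ X} {C' : Cx k σ Y} {δ δ' : Dg σ} {u : X →₀ k} {v : Y →₀ k}
    (hu : u ∈ C.gr δ) (hv : v ∈ C'.gr δ') : tm u v ∈ (C.prod C').gr (δ + δ') := by
  refine supported_mono ?_ (tm_mem hu hv)
  rintro ⟨x, y⟩ ⟨h1, h2⟩
  exact ⟨⟨h1.1, h2.1⟩, by rw [← h1.2, ← h2.2]; rfl⟩

lemma exists_partial_inverse (C : Cx k σ X) : ∃ h : (X →₀ k) →ₗ[k] (X →₀ k),
    (∀ δ, ∀ v ∈ C.gr δ, h v ∈ C.gr (δ + zz)) ∧ ∀ δ, ∀ v ∈ C.gr δ, C.d (h (C.d v)) = C.d v := by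
  have H := fun δ => exists_partial_inverse_on C.d (C.gr (δ + zz))
  choose g hg1 hg2 using H
  let h : (X →₀ k) →ₗ[k] (X →₀ k) := Finsupp.linearCombination k fun x => g (C.deg x) (single x 1)
  have hh : ∀ δ, ∀ v ∈ C.gr δ, h v = g δ v := fun δ v hv =>
    lin_eq (fun x hx => by simp [h, hx.2]) hv
  refine ⟨h, fun δ v hv => by rw [hh δ v hv]; exact hg1 δ v, fun δ v hv => ?_⟩
  rcases C.gm_eq_bot_or δ with hb | ⟨δ', rfl⟩
  · have := C.d_gr hv
    rw [hb, Submodule.mem_bot] at this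
    simp [this]
  · rw [hh _ _ (C.d_gr' hv)]
    exact hg2 _ v hv

/-- A model of a complex with zero differential. -/
structure Model (C : Cx k σ X) where
  n : Dg σ → ℕ
  q : (X →₀ k) →ₗ[k] ((Σ δ, Fin (n δ)) →₀ k)
  ι : ((Σ δ, Fin (n δ)) →₀ k) →ₗ[k] (X →₀ k)
  h : (X →₀ k) →ₗ[k] (X →₀ k)
  q_mem : ∀ x ∈ C.ok, q (single x 1) ∈ (ofBasis k Sigma.fst).gr (C.deg x)
  q_d : ∀ x ∈ C.ok, q (C.d (single x 1)) = 0
  ι_mem : ∀ y, ι (single y 1) ∈ C.gr y.1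
  d_ι : ∀ y, C.d (ι (single y 1)) = 0
  q_ι : ∀ y, q (ι (single y 1)) = single y 1
  h_mem : ∀ x ∈ C.ok, h (single x 1) ∈ C.gr (C.deg x + zz)
  hom : ∀ x ∈ C.ok, single x 1 = C.d (h (single x 1)) + h (C.d (single x 1)) +
      ι (q (single x 1))

lemma exists_model {C : Cx k σ X} (hC : C.LocFin) : Nonempty C.Model := by
  obtain ⟨h, hh, hd⟩ := C.exists_partial_inverse
  let E : (X →₀ k) →ₗ[k] (X →₀ k) :=
    LinearMap.id - C.d ∘ₗ h - h ∘ₗ C.d + C.d ∘ₗ h ∘ₗ h ∘ₗ C.d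
  have hE : ∀ v, E v = v - C.d (h v) - h (C.d v) + C.d (h (h (C.d v))) := fun v => rfl
  have hhd : ∀ δ, ∀ v ∈ C.gr δ, h (C.d v) ∈ C.gr δ := by
    intro δ v hv
    rcases C.gm_eq_bot_or δ with hb | ⟨δ', rfl⟩
    · have := C.d_gr hv
      rw [hb, Submodule.mem_bot] at this
      simp [this]
    · exact hh _ _ (C.d_gr' hv)
  have Egr : ∀ δ, ∀ v ∈ C.gr δ, E v ∈ C.gr δ := by
    intro δ v hv
    exact Submodule.add_mem _ (Submodule.sub_mem _ (Submodule.sub_mem _ hv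
      (C.d_gr' (hh _ _ hv))) (hhd _ _ hv)) (C.d_gr' (hh _ _ (hhd _ _ hv)))
  have dE : ∀ δ, ∀ v ∈ C.gr δ, C.d (E v) = 0 := by
    intro δ v hv
    rw [hE, map_add, map_sub, map_sub, C.d_d (hh _ _ hv), hd _ _ hv, C.d_d (hh _ _ (hhd _ _ hv))]
    simp
  have Ed : ∀ δ, ∀ v ∈ C.gr δ, E (C.d v) = 0 := by
    intro δ v hv
    rw [hE, C.d_d hv, hd _ _ hv]
    simp
  have EE : ∀ δ, ∀ v ∈ C.gr δ, E (E v) = E v := by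
    intro δ v hv
    rw [hE (E v), dE _ _ hv]
    have : C.d (h (E v)) = 0 := by
      rw [hE]
      simp only [map_add, map_sub]
      rw [hd _ _ (hh _ _ hv), hd _ _ (hh _ _ (hhd _ _ hv))]
      abel
    rw [this]
    simp
  let W : ∀ δ, Submodule k (X →₀ k) := fun δ => (C.gr δ).map E
  have hW : ∀ δ, W δ ≤ C.gr δ := by
    rintro δ _ ⟨v, hv, rfl⟩
    exact Egr _ _ hv
  have hfd : ∀ δ, FiniteDimensional k (W δ) := fun δ => by
    have := hC.finiteDimensional δ
    exact Submodule.finiteDimensional_of_le (hW δ)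
  let b : ∀ δ, Module.Basis (Fin (Module.finrank k (W δ))) k (W δ) := fun δ =>
    (nonempty_basis (W δ)).some
  choose P hP' using fun δ => exists_projection (W δ)
  let T := Σ δ, Fin (Module.finrank k (W δ))
  let qq : ∀ δ, (X →₀ k) →ₗ[k] (T →₀ k) := fun δ =>
    lmapDomain k k (Sigma.mk δ) ∘ₗ (b δ).repr.toLinearMap ∘ₗ P δ ∘ₗ E
  let q : (X →₀ k) →ₗ[k] (T →₀ k) :=
    Finsupp.linearCombination k fun x => qq (C.deg x) (single x 1)
  let ι : (T →₀ k) →ₗ[k] (X →₀ k) :=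
    Finsupp.linearCombination k fun y => ((b y.1 y.2 : W y.1) : X →₀ k)
  have hq : ∀ δ, ∀ v ∈ C.gr δ, q v = qq δ v := fun δ v hv =>
    lin_eq (fun x hx => by simp [q, hx.2]) hv
  have hι : ∀ y : T, ι (single y 1) = ((b y.1 y.2 : W y.1) : X →₀ k) := fun y => by simp [ι]
  have hEW : ∀ δ, ∀ v ∈ W δ, E v = v := by
    rintro δ _ ⟨v, hv, rfl⟩
    exact EE _ _ hv
  refine ⟨⟨fun δ => Module.finrank k (W δ), q, ι, h - h ∘ₗ h ∘ₗ C.d, ?_, ?_, ?_, ?_, ?_, ?_, ?_⟩⟩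
  · intro x hx
    rw [hq _ _ (C.single_mem_gr hx rfl 1)]
    change mapDomain _ _ ∈ _
    rw [gr, mem_supported]
    intro y hy
    obtain ⟨i, -, rfl⟩ := Finset.mem_image.1 (mapDomain_support hy)
    exact ⟨trivial, rfl⟩
  · intro x hx
    have hx' := C.single_mem_gr hx rfl 1
    rcases C.gm_eq_bot_or (C.deg x) with hb | ⟨δ', hδ⟩
    · have := C.d_gr hx'
      rw [hb, Submodule.mem_bot] at this
      rw [this, map_zero]
    · rw [hδ] at hx'
      rw [hq _ _ (C.d_gr' hx')]
      simp [qq, Ed _ _ hx']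
  · intro y
    rw [hι]
    exact hW _ (b y.1 y.2).2
  · intro y
    rw [hι]
    obtain ⟨v, hv, he⟩ := (b y.1 y.2).2
    rw [← he]
    exact dE _ _ hv
  · intro y
    rw [hι, hq _ _ (hW _ (b y.1 y.2).2)]
    simp [qq, hEW _ _ (b y.1 y.2).2, hP' _ _ (b y.1 y.2).2]
  · intro x hx
    have hx' := C.single_mem_gr hx rfl 1
    exact Submodule.sub_mem _ (hh _ _ hx') (hh _ _ (hhd _ _ hx'))
  · intro x hx
    have hx' := C.single_mem_gr hx rfl 1
    have : ι (q (single x 1)) = E (single x 1) := by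
      rw [hq _ _ hx']
      have hm : E (single x 1) ∈ W (C.deg x) := ⟨_, hx', rfl⟩
      simp only [qq, LinearMap.comp_apply, hP' _ _ hm, lmapDomain_apply, ι,
        linearCombination_mapDomain]
      have := congrArg Subtype.val ((b (C.deg x)).linearCombination_repr ⟨_, hm⟩)
      rw [Finsupp.linearCombination_apply, Finsupp.sum] at this ⊢
      simpa using this
    rw [this, hE]
    simp only [LinearMap.sub_apply, LinearMap.comp_apply, map_sub, C.dd x hx, map_zero]
    abel

lemma Model.n_eq {C : Cx k σ X} (m : C.Model) (δ : Dg σ) : C.hdim δ = m.n δ := by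
  have := hdim_eq_of_homotopy (C := C) (C' := ofBasis k (Sigma.fst : (Σ δ, Fin (m.n δ)) → _))
    m.q m.ι m.h m.q_mem (fun x hx => by rw [m.q_d x hx]; rfl) (fun y _ => m.ι_mem y)
    (fun y _ => by rw [m.d_ι]; exact map_zero _) (fun y _ => m.q_ι y) m.h_mem m.hom δ
  have e : {y : Σ δ, Fin (m.n δ) | y.1 = δ} = Set.range (Sigma.mk δ) := by
    ext ⟨a, b⟩
    simp only [Set.mem_ofPred_eq, Set.mem_range]
    constructor
    · rintro rfl
      exact ⟨b, rfl⟩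
    · rintro ⟨c, hc⟩
      exact (congrArg Sigma.fst hc).symm
  rw [this, ofBasis_hdim _ _ (by rw [e]; exact Set.finite_range _), e, ← Set.image_univ,
    Set.ncard_image_of_injective _ sigma_mk_injective, Set.ncard_univ, Nat.card_fin]

/-- The generating series of the homology. -/
def series (C : Cx k σ X) : MvPowerSeries (Option σ) ℤ := fun δ => C.hdim δ

lemma coeff_series (C : Cx k σ X) (δ : Dg σ) : MvPowerSeries.coeff δ C.series = C.hdim δ := rfl

lemma ofBasis_prod_hdim (n n' : Dg σ → ℕ) (δ : Dg σ) :
    (ofBasis k (fun y : (Σ δ, Fin (n δ)) × (Σ δ, Fin (n' δ)) => y.1.1 + y.2.1)).hdim δ =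
      ∑ p ∈ Finset.HasAntidiagonal.antidiagonal δ, n p.1 * n' p.2 := by
  let φ : (Σ p : Dg σ × Dg σ, Fin (n p.1) × Fin (n' p.2)) →
      (Σ δ, Fin (n δ)) × (Σ δ, Fin (n' δ)) := fun y => (⟨y.1.1, y.2.1⟩, ⟨y.1.2, y.2.2⟩)
  have hφ : Function.Injective φ := by
    rintro ⟨⟨a, b⟩, c, d⟩ ⟨⟨a', b'⟩, c', d'⟩ h
    simp only [φ, Prod.mk.injEq, Sigma.mk.injEq] at h
    obtain ⟨⟨rfl, h1⟩, rfl, h2⟩ := h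
    obtain rfl := eq_of_heq h1
    obtain rfl := eq_of_heq h2
    rfl
  have e : {y : (Σ δ, Fin (n δ)) × (Σ δ, Fin (n' δ)) | y.1.1 + y.2.1 = δ} =
      ((Finset.HasAntidiagonal.antidiagonal δ).sigma fun _ => Finset.univ).map ⟨φ, hφ⟩ := by
    ext ⟨⟨a, b⟩, ⟨c, d⟩⟩
    simp only [Set.mem_ofPred_eq, Finset.coe_map, Function.Embedding.coeFn_mk, Set.mem_image,
      Finset.mem_coe, Finset.mem_sigma, Finset.HasAntidiagonal.mem_antidiagonal,
      Finset.mem_univ, and_true]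
    constructor
    · intro h
      exact ⟨⟨(a, c), b, d⟩, h, rfl⟩
    · rintro ⟨⟨⟨a', c'⟩, b', d'⟩, h, h2⟩
      simp only [φ, Prod.mk.injEq, Sigma.mk.injEq] at h2
      rw [← h2.1.1, ← h2.2.1]
      exact h
  rw [ofBasis_hdim _ _ (by rw [e]; exact Finset.finite_toSet _), e, Set.ncard_coe_finset,
    Finset.card_map, Finset.card_sigma]
  simp

lemma Model.hdim_prod {C : Cx k σ X} {C' : Cx k σ Y} (m : C.Model) (m' : C'.Model) (δ : Dg σ) :
    (C.prod C').hdim δ = (ofBasis k (fun y : (Σ δ, Fin (m.n δ)) × (Σ δ, Fin (m'.n δ)) =>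
      y.1.1 + y.2.1)).hdim δ := by
  have mem_ofBasis : ∀ {A B δ δ'} {u : A →₀ k} {v : B →₀ k} {b : A → Dg σ} {b' : B → Dg σ},
      u ∈ (ofBasis k b).gr δ → v ∈ (ofBasis k b').gr δ' →
      tm u v ∈ (ofBasis k (fun y : A × B => b y.1 + b' y.2)).gr (δ + δ') := by
    intro A B δ δ' u v b b' hu hv
    refine supported_mono ?_ (tm_mem hu hv)
    rintro ⟨x, y⟩ ⟨h1, h2⟩
    exact ⟨trivial, by rw [← h1.2, ← h2.2]; rfl⟩
  have ιgr : ∀ δ, ∀ v ∈ (ofBasis k Sigma.fst).gr δ, m.ι v ∈ C.gr δ := fun δ v hv =>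
    lin_mem (fun y hy => by rw [← hy.2]; exact m.ι_mem y) hv
  have ιgr' : ∀ δ, ∀ v ∈ (ofBasis k Sigma.fst).gr δ, m'.ι v ∈ C'.gr δ := fun δ v hv =>
    lin_mem (fun y hy => by rw [← hy.2]; exact m'.ι_mem y) hv
  have dι : ∀ v, C.d (m.ι v) = 0 := fun v =>
    lin_eq (s := Set.univ) (f := C.d ∘ₗ m.ι) (g := 0) (fun y _ => m.d_ι y) (by simp)
  have dι' : ∀ v, C'.d (m'.ι v) = 0 := fun v =>
    lin_eq (s := Set.univ) (f := C'.d ∘ₗ m'.ι) (g := 0) (fun y _ => m'.d_ι y) (by simp)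
  refine hdim_eq_of_homotopy (tens m.q m'.q) (tens m.ι m'.ι)
    (tens m.h LinearMap.id + tens (C.eps ∘ₗ m.ι ∘ₗ m.q) m'.h) ?_ ?_ ?_ ?_ ?_ ?_ ?_ δ
  · rintro ⟨x, y⟩ ⟨hx, hy⟩
    rw [← one_mul (1 : k), ← tm_single, tens_tm]
    exact mem_ofBasis (m.q_mem x hx) (m'.q_mem y hy)
  · rintro ⟨x, y⟩ ⟨hx, hy⟩
    rw [prod_d]
    rw [← one_mul (1 : k), ← tm_single, prodD_tm C C' (C.single_mem_gr hx rfl 1), map_add,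
      map_smul, tens_tm, tens_tm, m.q_d x hx, m'.q_d y hy]
    simp [ofBasis]
  · rintro ⟨x, y⟩ -
    rw [← one_mul (1 : k), ← tm_single, tens_tm]
    exact prod_gr (m.ι_mem x) (m'.ι_mem y)
  · rintro ⟨x, y⟩ -
    rw [prod_d]
    rw [← one_mul (1 : k), ← tm_single, tens_tm, prodD_tm C C' (m.ι_mem x), m.d_ι, m'.d_ι]
    simp [ofBasis]
  · rintro ⟨x, y⟩ -
    rw [← one_mul (1 : k), ← tm_single, tens_tm, tens_tm, m.q_ι, m'.q_ι]
  · rintro ⟨x, y⟩ ⟨hx, hy⟩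
    rw [← one_mul (1 : k), ← tm_single, LinearMap.add_apply, tens_tm, tens_tm]
    refine Submodule.add_mem _ (gr_sum (add_right_comm _ _ _)
      (prod_gr (m.h_mem x hx) (C'.single_mem_gr hy rfl 1)))
      (gr_sum (add_assoc _ _ _).symm (prod_gr ?_ (m'.h_mem y hy)))
    rw [LinearMap.comp_apply, LinearMap.comp_apply, eps_gr (ιgr _ _ (m.q_mem x hx))]
    exact Submodule.smul_mem _ _ (ιgr _ _ (m.q_mem x hx))
  · rintro ⟨x, y⟩ ⟨hx, hy⟩
    rw [prod_d]
    have hx' := C.single_mem_gr hx rfl 1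
    have hι := ιgr _ _ (m.q_mem x hx)
    rw [← one_mul (1 : k), ← tm_single, prodD_tm C C' hx']
    simp only [LinearMap.add_apply, map_add, map_smul, tens_tm, LinearMap.comp_apply,
      LinearMap.id_apply, m.q_d x hx, map_zero, LinearMap.zero_apply, add_zero,
      eps_gr hι, LinearMap.smul_apply, prodD_tm C C' (m.h_mem x hx), prodD_tm C C' hι, dι,
      chi_zz, smul_add, smul_smul, chi_mul_self, one_smul, zero_add]
    have e1 : tm (single x 1) (single y (1 : k)) = tm (C.d (m.h (single x 1))) (single y 1) +
        tm (m.h (C.d (single x 1))) (single y 1) + tm (m.ι (m.q (single x 1))) (single y 1) := by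
      conv_lhs => rw [m.hom x hx]
      simp only [map_add, LinearMap.add_apply]
    have e2 : tm (m.ι (m.q (single x 1))) (single y (1 : k)) =
        tm (m.ι (m.q (single x 1))) (C'.d (m'.h (single y 1))) +
        tm (m.ι (m.q (single x 1))) (m'.h (C'.d (single y 1))) +
        tm (m.ι (m.q (single x 1))) (m'.ι (m'.q (single y 1))) := by
      conv_lhs => rw [m'.hom y hy]
      simp only [map_add]
    conv_lhs => rw [e1, e2]
    simp only [neg_smul]
    abel

theorem series_prod {C : Cx k σ X} {C' : Cx k σ Y} (hC : C.LocFin) (hC' : C'.LocFin) :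
    (C.prod C').series = C.series * C'.series := by
  obtain ⟨m⟩ := exists_model hC
  obtain ⟨m'⟩ := exists_model hC'
  ext δ
  rw [MvPowerSeries.coeff_mul]
  simp only [coeff_series, m.n_eq, m'.n_eq]
  rw [m.hdim_prod m', ofBasis_prod_hdim]
  push_cast
  convert rfl

end Cx

end MonomialRings

namespace MonomialRings

open Finsupp hiding some

/-- Letters: monomials of a ring, and elements of a module over it. -/
inductive Let (σ : Type*)
  | s (β : Mon σ) : Let σ
  | h (a : Mon σ) : Let σ

/-- A monomial ideal `J` together with a subquotient of the quotient ring by `J`. -/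
structure Par (σ : Type*) where
  J : Set (Mon σ)
  F : Set (Mon σ)
  up : ∀ β ∈ J, ∀ γ, β + γ ∈ J
  disj : ∀ a ∈ F, a ∉ J
  conv : ∀ a β γ, a ∈ F → γ + (β + a) ∈ F → β + a ∈ F

namespace Let

variable {σ : Type*} (P : Par σ)

/-- Product of letters. -/
def mul : Let σ → Let σ → Option (Let σ)
  | s β, s γ => if β + γ ∈ P.J then none else some (s (β + γ))
  | s β, h a => if a ∈ P.F ∧ β + a ∈ P.F then some (h (β + a)) else none
  | h a, s β => if a ∈ P.F ∧ β + a ∈ P.F then some (h (β + a)) else none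
  | h _, h _ => none

/-- The sign of a letter. -/
def sg (k : Type*) [Field k] : Let σ → k
  | s _ => 1
  | h _ => -1

lemma sg_mul_self (k : Type*) [Field k] (c : Let σ) : sg k c * sg k c = 1 := by
  cases c <;> simp [sg]

lemma sg_mul (k : Type*) [Field k] {c c' c'' : Let σ} (hm : mul P c c' = some c'') :
    sg k c'' = sg k c * sg k c' := by
  cases c <;> cases c' <;> simp only [mul] at hm <;> grind [sg]

lemma mul_assoc' (x y z : Let σ) :
    (mul P x y).bind (fun c => mul P c z) = (mul P y z).bind (fun c => mul P x c) := by
  have up' : ∀ β γ, γ ∈ P.J → β + γ ∈ P.J := fun β γ hγ => by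
    rw [add_comm]; exact P.up γ hγ β
  cases x with
  | s β =>
    cases y with
    | s γ =>
      cases z with
      | s ε =>
        simp only [mul]
        by_cases h1 : β + γ ∈ P.J <;> by_cases h2 : γ + ε ∈ P.J
        · simp [h1, h2]
        · simp [h1, h2, ← add_assoc, P.up _ h1 ε]
        · simp [h1, h2, add_assoc, up' β _ h2]
        · simp [h1, h2, add_assoc]
      | h a =>
        simp only [mul]
        by_cases h1 : β + γ ∈ P.J
        · by_cases h2 : a ∈ P.F ∧ γ + a ∈ P.F
          · have : β + (γ + a) ∉ P.F := fun h => P.disj _ h (by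
              rw [← add_assoc]; exact P.up _ h1 a)
            simp [h1, h2, this]
          · simp [h1, h2]
        · by_cases h2 : a ∈ P.F ∧ γ + a ∈ P.F
          · simp [h1, h2, add_assoc]
          · have : ¬ (a ∈ P.F ∧ β + (γ + a) ∈ P.F) := fun h =>
              h2 ⟨h.1, P.conv a γ β h.1 h.2⟩
            simp [h1, h2, add_assoc, this]
    | h a =>
      cases z with
      | s ε =>
        simp only [mul]
        have e : ε + (β + a) = β + (ε + a) := add_left_comm _ _ _
        by_cases h1 : a ∈ P.F ∧ β + a ∈ P.F <;> by_cases h2 : a ∈ P.F ∧ ε + a ∈ P.F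
        · simp [h1, h2, e]
        · have : ¬ (β + (ε + a) ∈ P.F) := fun h => h2 ⟨h1.1, P.conv a ε β h1.1 h⟩
          rw [if_pos h1, if_neg h2]
          simp [e, this]
        · have : ¬ (β + (ε + a) ∈ P.F) := fun h => h1 ⟨h2.1, P.conv a β ε h2.1 (e ▸ h)⟩
          rw [if_pos h2, if_neg h1]
          simp [this]
        · simp [h1, h2]
      | h a' =>
        simp only [mul]
        by_cases h1 : a ∈ P.F ∧ β + a ∈ P.F <;> simp [h1]
  | h a =>
    cases y with
    | s γ =>
      cases z with
      | s ε =>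
        simp only [mul]
        have e : ε + (γ + a) = γ + ε + a := by abel
        by_cases h1 : a ∈ P.F ∧ γ + a ∈ P.F
        · by_cases h2 : γ + ε ∈ P.J
          · have : γ + ε + a ∉ P.F := fun h => P.disj _ h (P.up _ h2 a)
            simp [h1, h2, e, this]
          · simp [h1, h2, e]
        · have : ¬ (a ∈ P.F ∧ γ + ε + a ∈ P.F) := fun h =>
              h1 ⟨h.1, P.conv a γ ε h.1 (e ▸ h.2)⟩
          by_cases h2 : γ + ε ∈ P.J <;> simp [h1, h2, this]
      | h a' =>
        simp only [mul]
        by_cases h1 : a ∈ P.F ∧ γ + a ∈ P.F <;>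
          by_cases h2 : a' ∈ P.F ∧ γ + a' ∈ P.F <;> simp [h1, h2]
    | h a' =>
      cases z with
      | s ε =>
        simp only [mul]
        by_cases h1 : a' ∈ P.F ∧ ε + a' ∈ P.F <;> simp [h1]
      | h a' => simp [mul]

end Let

section Operators

variable {k : Type*} [Field k] {σ : Type*}

/-- Linear combinations of words. -/
abbrev Wd (k : Type*) [Field k] (σ : Type*) := List (Let σ) →₀ k

/-- Prepending a letter. -/
def cs (c : Let σ) : Wd k σ →ₗ[k] Wd k σ := lmapDomain k k (c :: ·)

lemma cs_single (c : Let σ) (l : List (Let σ)) (a : k) :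
    cs c (single l a) = single (c :: l) a := by
  simp [cs]

@[simp] lemma single_cons (c : Let σ) (l : List (Let σ)) (a : k) :
    single (c :: l) a = cs c (single l a) := (cs_single c l a).symm

/-- Prepending a letter, or zero. -/
def csO : Option (Let σ) → Wd k σ →ₗ[k] Wd k σ
  | none => 0
  | some c => cs c

@[simp] lemma csO_none : (csO none : Wd k σ →ₗ[k] Wd k σ) = 0 := rfl
@[simp] lemma csO_some (c : Let σ) : (csO (some c) : Wd k σ →ₗ[k] Wd k σ) = cs c := rfl

lemma word_ext {V : Type*} [AddCommMonoid V] [Module k V] {f g : Wd k σ →ₗ[k] V}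
    (h : ∀ l, f (single l 1) = g (single l 1)) (v : Wd k σ) : f v = g v := by
  rw [Finsupp.lhom_ext' (φ := f) (ψ := g) fun l => LinearMap.ext_ring (h l)]

/-- Extending a function on words linearly. -/
def lin {V : Type*} [AddCommMonoid V] [Module k V] (φ : List (Let σ) → V) : Wd k σ →ₗ[k] V :=
  Finsupp.linearCombination k φ

@[simp] lemma lin_single {V : Type*} [AddCommMonoid V] [Module k V] (φ : List (Let σ) → V)
    (l : List (Let σ)) : lin φ (single l (1 : k)) = φ l := by
  simp [lin]

variable (P : Par σ)

/-- Multiplying the first letter. -/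
def ml (c : Let σ) : Wd k σ →ₗ[k] Wd k σ := lin fun l =>
  match l with
  | [] => 0
  | c' :: w => csO (Let.mul P c c') (single w 1)

@[simp] lemma ml_nil (c : Let σ) : ml P c (single [] (1 : k)) = 0 := by simp [ml]

@[simp] lemma ml_cs (c c' : Let σ) (v : Wd k σ) : ml P c (cs c' v) = csO (Let.mul P c c') v :=
  word_ext (f := ml P c ∘ₗ cs c') (g := csO (Let.mul P c c')) (fun l => by
    rw [LinearMap.comp_apply, cs_single, ml, lin_single]) v

/-- Multiplying the first letter, or zero. -/
def mlO : Option (Let σ) → Wd k σ →ₗ[k] Wd k σ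
  | none => 0
  | some c => ml P c

@[simp] lemma mlO_none : (mlO P none : Wd k σ →ₗ[k] Wd k σ) = 0 := rfl
@[simp] lemma mlO_some (c : Let σ) : (mlO P (some c) : Wd k σ →ₗ[k] Wd k σ) = ml P c := rfl

lemma ml_csO (c : Let σ) (o : Option (Let σ)) (v : Wd k σ) :
    ml P c (csO o v) = csO (o.bind fun c' => Let.mul P c c') v := by
  cases o <;> simp

lemma ml_ml (c d : Let σ) (v : Wd k σ) : ml P c (ml P d v) = mlO P (Let.mul P c d) v := by
  refine word_ext (f := ml P c ∘ₗ ml P d) (fun l => ?_) v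
  cases l with
  | nil => cases Let.mul P c d <;> simp
  | cons e w =>
    rw [single_cons, LinearMap.comp_apply, ml_cs, ml_csO, ← Let.mul_assoc']
    cases Let.mul P c d <;> simp

/-- The bar differential with an additional differential `e` on letters, on words. -/
def Dl (e : Let σ → Option (Let σ)) : List (Let σ) → Wd k σ
  | [] => 0
  | c :: w => Let.sg k c • (ml P c (single w 1) - cs c (Dl e w)) + csO (e c) (single w 1)

/-- The bar differential with an additional differential `e` on letters. -/
def De (e : Let σ → Option (Let σ)) : Wd k σ →ₗ[k] Wd k σ := lin (Dl P e)

@[simp] lemma De_nil (e : Let σ → Option (Let σ)) : De P e (single [] (1 : k)) = 0 := by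
  simp [De, Dl]

@[simp] lemma De_cs (e : Let σ → Option (Let σ)) (c : Let σ) (v : Wd k σ) :
    De P e (cs c v) = Let.sg k c • (ml P c v - cs c (De P e v)) + csO (e c) v := by
  have := word_ext (f := De P e ∘ₗ cs c)
    (g := Let.sg k c • (ml P c - cs c ∘ₗ De P e) + csO (e c)) (fun l => by
      rw [LinearMap.comp_apply, cs_single, De, lin_single, Dl, LinearMap.add_apply,
        LinearMap.smul_apply, LinearMap.sub_apply, LinearMap.comp_apply, lin_single]) v
  rw [LinearMap.comp_apply] at this
  rw [this, LinearMap.add_apply, LinearMap.smul_apply, LinearMap.sub_apply, LinearMap.comp_apply]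

/-- The bar differential. -/
def D : Wd k σ →ₗ[k] Wd k σ := De P fun _ => none

@[simp] lemma D_nil : D P (single [] (1 : k)) = 0 := De_nil _ _

@[simp] lemma D_cs (c : Let σ) (v : Wd k σ) :
    D P (cs c v) = Let.sg k c • (ml P c v - cs c (D P v)) := by
  simp [D]

lemma D_csO {c c' : Let σ} (v : Wd k σ) : D P (csO (Let.mul P c c') v) =
    (Let.sg k c * Let.sg k c') • (mlO P (Let.mul P c c') v - csO (Let.mul P c c') (D P v)) := by
  cases h : Let.mul P c c' with
  | none => simp
  | some c'' => simp [Let.sg_mul P k h]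

lemma D_ml (c : Let σ) (v : Wd k σ) : D P (ml P c v) = Let.sg k c • ml P c (D P v) := by
  refine word_ext (f := D P ∘ₗ ml P c) (g := Let.sg k c • (ml P c ∘ₗ D P)) (fun l => ?_) v
  cases l with
  | nil => simp
  | cons d w =>
    rw [← cs_single]
    simp only [LinearMap.comp_apply, ml_cs, D_csO, D_cs, map_sub, map_smul, ml_ml,
      LinearMap.smul_apply, smul_smul]

lemma D_D (v : Wd k σ) : D P (D P v) = 0 := by
  refine word_ext (f := D P ∘ₗ D P) (g := 0) (fun l => ?_) v
  induction l with
  | nil => simp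
  | cons c w ih =>
    rw [LinearMap.comp_apply, LinearMap.zero_apply] at ih
    rw [← cs_single]
    simp [D_ml, ih]

/-- One word arises from another by multiplying adjacent letters. -/
inductive Step : List (Let σ) → List (Let σ) → Prop
  | head {c c' c'' w} : Let.mul P c c' = some c'' → Step (c :: c' :: w) (c'' :: w)
  | tail {c w w'} : Step w w' → Step (c :: w) (c :: w')

lemma cs_mem {s t : Set (List (Let σ))} {c : Let σ} (h : ∀ l ∈ s, c :: l ∈ t) {v : Wd k σ}
    (hv : v ∈ supported k k s) : cs c v ∈ supported k k t :=
  lin_mem (fun l hl => by rw [cs_single]; exact single_mem_supported _ _ (h l hl)) hv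

lemma ml_mem_step (c : Let σ) (w : List (Let σ)) :
    ml P c (single w (1 : k)) ∈ supported k k {l | Step P (c :: w) l} := by
  cases w with
  | nil => simp
  | cons d w =>
    rw [← cs_single, ml_cs]
    cases h : Let.mul P c d with
    | none => simp
    | some e =>
      rw [csO_some, cs_single]
      exact single_mem_supported _ _ (Step.head h)

lemma D_mem_step (l : List (Let σ)) :
    D P (single l (1 : k)) ∈ supported k k {l' | Step P l l'} := by
  induction l with
  | nil => simp
  | cons c w ih =>
    rw [← cs_single, D_cs]
    exact Submodule.smul_mem _ _ (Submodule.sub_mem _ (ml_mem_step P c w)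
      (cs_mem (fun l hl => Step.tail hl) ih))

end Operators

section Degrees

variable {k : Type*} [Field k] {σ : Type*} [Finite σ] (P : Par σ) (e0 : Dg σ)

/-- The multidegree of a monomial. -/
def ex (β : Mon σ) : Dg σ := Finsupp.equivFunOnFinite.symm fun o => Option.elim o 0 β

@[simp] lemma ex_none (β : Mon σ) : ex β none = 0 := rfl
@[simp] lemma ex_some (β : Mon σ) (i : σ) : ex β (some i) = β i := rfl

lemma ex_add (β γ : Mon σ) : ex (β + γ) = ex β + ex γ := by
  ext o
  cases o <;> rfl

@[simp] lemma ex_zero : ex (0 : Mon σ) = 0 := by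
  ext o
  cases o <;> rfl

/-- The degree of a letter; `e0` is the degree shift of the module. -/
def ldeg : Let σ → Dg σ
  | .s β => ex β + zz
  | .h a => ex a + e0

/-- The degree of a word. -/
def wdeg (l : List (Let σ)) : Dg σ := (l.map (ldeg e0)).sum

@[simp] lemma wdeg_nil : wdeg e0 ([] : List (Let σ)) = 0 := rfl
@[simp] lemma wdeg_cons (c : Let σ) (l : List (Let σ)) :
    wdeg e0 (c :: l) = ldeg e0 c + wdeg e0 l := by simp [wdeg]
@[simp] lemma wdeg_append (l l' : List (Let σ)) :
    wdeg e0 (l ++ l') = wdeg e0 l + wdeg e0 l' := by simp [wdeg]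

lemma ldeg_mul {c c' c'' : Let σ} (h : Let.mul P c c' = some c'') :
    ldeg e0 c'' + zz = ldeg e0 c + ldeg e0 c' := by
  cases c <;> cases c' <;> simp only [Let.mul] at h
  · split_ifs at h
    obtain rfl := Option.some.inj h
    simp only [ldeg, ex_add]; abel
  · split_ifs at h
    obtain rfl := Option.some.inj h
    simp only [ldeg, ex_add]; abel
  · split_ifs at h
    obtain rfl := Option.some.inj h
    simp only [ldeg, ex_add]; abel
  · cases h

lemma Step.deg {l l' : List (Let σ)} (h : Step P l l') : wdeg e0 l' + zz = wdeg e0 l := by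
  induction h with
  | head h =>
    rw [wdeg_cons, wdeg_cons, wdeg_cons, ← add_assoc, ← ldeg_mul P e0 h]
    abel
  | tail _ ih => rw [wdeg_cons, wdeg_cons, ← ih]; abel

variable (k)

/-- The complex spanned by a set of words closed under `Step`. -/
def wordCx (ok : Set (List (Let σ))) (hok : ∀ l ∈ ok, ∀ l', Step P l l' → l' ∈ ok) :
    Cx k σ (List (Let σ)) where
  ok := ok
  deg := wdeg e0
  d := D P
  d_mem l hl := by
    refine supported_mono ?_ (D_mem_step P l)
    exact fun l' h => ⟨hok l hl l' h, Step.deg P e0 h⟩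
  dd l _ := D_D P _

end Degrees

end MonomialRings

namespace MonomialRings

open Finsupp hiding some

section Shuffle

variable {k : Type*} [Field k] {σ : Type*} (P : Par σ)

/-- The sign of a word. -/
def wsg (k : Type*) [Field k] : List (Let σ) → k
  | [] => 1
  | c :: l => -Let.sg k c * wsg k l

lemma wsg_mul_self (l : List (Let σ)) : wsg k l * wsg k l = 1 := by
  induction l with
  | nil => simp [wsg]
  | cons c l ih => rw [wsg, neg_mul, neg_mul_neg, mul_mul_mul_comm,
      Let.sg_mul_self, ih, mul_one]

/-- The sign operator on words. -/
def ew : Wd k σ →ₗ[k] Wd k σ := lin fun l => single l (wsg k l)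

@[simp] lemma ew_nil : ew (single [] (1 : k)) = (single [] 1 : Wd k σ) := by simp [ew, wsg]

lemma ew_single (l : List (Let σ)) : ew (single l (1 : k)) = wsg k l • single l 1 := by
  simp [ew]

@[simp] lemma ew_cs (c : Let σ) (v : Wd k σ) : ew (cs c v) = -(Let.sg k c • cs c (ew v)) := by
  rw [← neg_smul]
  refine word_ext (f := ew ∘ₗ cs c) (g := (-Let.sg k c) • (cs c ∘ₗ ew)) (fun l => ?_) v
  rw [LinearMap.comp_apply, cs_single, ew_single, LinearMap.smul_apply,
    LinearMap.comp_apply, ew_single, map_smul, cs_single, wsg, smul_smul]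

lemma ew_ew (v : Wd k σ) : ew (ew v) = v := by
  refine word_ext (f := ew ∘ₗ ew) (g := LinearMap.id) (fun l => ?_) v
  rw [LinearMap.comp_apply, LinearMap.id_apply]
  induction l with
  | nil => simp
  | cons c w ih =>
    rw [← cs_single]
    simp [ih, smul_smul, Let.sg_mul_self]

lemma ew_ml (c : Let σ) (v : Wd k σ) : ew (ml P c v) = Let.sg k c • ml P c (ew v) := by
  refine word_ext (f := ew ∘ₗ ml P c) (g := Let.sg k c • (ml P c ∘ₗ ew)) (fun l => ?_) v
  cases l with
  | nil => simp
  | cons d w =>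
    rw [← cs_single, LinearMap.comp_apply, LinearMap.smul_apply, LinearMap.comp_apply]
    cases h : Let.mul P c d with
    | none => simp [h]
    | some e => simp [h, Let.sg_mul P k h, smul_smul]

lemma ew_D (v : Wd k σ) : ew (D P v) = -D P (ew v) := by
  rw [← neg_one_smul k]
  refine word_ext (f := ew ∘ₗ D P) (g := (-1 : k) • (D P ∘ₗ ew)) (fun l => ?_) v
  rw [LinearMap.comp_apply, LinearMap.smul_apply, LinearMap.comp_apply, neg_one_smul]
  induction l with
  | nil => simp
  | cons c w ih =>
    rw [← cs_single]
    simp [ew_ml, ih, smul_smul, smul_sub, Let.sg_mul_self]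

/-- The shuffle product of words, where the second word is shuffled only up to its first
module letter. -/
def shl (k : Type*) [Field k] : List (Let σ) → List (Let σ) → Wd k σ
  | [], y => single y 1
  | c :: x, [] => single (c :: x) 1
  | c :: x, .h a :: y => cs c (shl k x (.h a :: y))
  | c :: x, .s γ :: y => cs c (shl k x (.s γ :: y)) + wsg k (c :: x) • cs (.s γ) (shl k (c :: x) y)
termination_by x y => x.length + y.length

/-- The shuffle product. -/
def sh : Wd k σ →ₗ[k] Wd k σ →ₗ[k] Wd k σ := lin fun x => lin fun y => shl k x y

lemma sh_single (x y : List (Let σ)) : sh (single x (1 : k)) (single y 1) = shl k x y := by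
  simp [sh]

@[simp] lemma sh_nil_left (v : Wd k σ) : sh (single [] (1 : k)) v = v :=
  word_ext (f := sh (single [] (1 : k))) (g := LinearMap.id)
    (fun l => by rw [sh_single, shl, LinearMap.id_apply]) v

@[simp] lemma sh_nil_right (v : Wd k σ) : sh v (single [] (1 : k)) = v :=
  word_ext (f := sh.flip (single [] (1 : k))) (g := LinearMap.id)
    (fun l => by cases l <;> rw [LinearMap.flip_apply, sh_single, shl, LinearMap.id_apply]) v

lemma bilin_ext {V : Type*} [AddCommMonoid V] [Module k V] {f g : Wd k σ →ₗ[k] Wd k σ →ₗ[k] V}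
    (h : ∀ x y, f (single x 1) (single y 1) = g (single x 1) (single y 1)) (u v : Wd k σ) :
    f u v = g u v :=
  word_ext (f := f u) (g := g u) (fun y => word_ext (f := f.flip (single y 1))
    (g := g.flip (single y 1)) (fun x => h x y) u) v

@[simp] lemma sh_cs_h (c : Let σ) (a : Mon σ) (u v : Wd k σ) :
    sh (cs c u) (cs (.h a) v) = cs c (sh u (cs (.h a) v)) :=
  bilin_ext (f := sh.compl₁₂ (cs c) (cs (.h a)))
    (g := (sh.compl₁₂ LinearMap.id (cs (.h a))).compr₂ (cs c)) (fun x y => by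
      simp only [LinearMap.compl₁₂_apply, LinearMap.compr₂_apply, cs_single, sh_single,
        LinearMap.id_apply]
      rw [shl]) u v

@[simp] lemma sh_cs_s (c : Let σ) (γ : Mon σ) (u v : Wd k σ) :
    sh (cs c u) (cs (.s γ) v) = cs c (sh u (cs (.s γ) v)) + cs (.s γ) (sh (ew (cs c u)) v) := by
  have := bilin_ext (f := sh.compl₁₂ (cs c) (cs (.s γ)))
    (g := (sh.compl₁₂ LinearMap.id (cs (.s γ))).compr₂ (cs c) +
      (sh.compl₁₂ (ew ∘ₗ cs c) LinearMap.id).compr₂ (cs (.s γ))) (fun x y => by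
      simp only [LinearMap.compl₁₂_apply, LinearMap.compr₂_apply, cs_single, sh_single,
        LinearMap.id_apply, LinearMap.add_apply, LinearMap.comp_apply, ew_single, map_smul,
        LinearMap.smul_apply]
      rw [shl]) u v
  simpa only [LinearMap.compl₁₂_apply, LinearMap.compr₂_apply, LinearMap.id_apply,
    LinearMap.add_apply, LinearMap.comp_apply] using this

lemma Let.mul_s_comm (c : Let σ) (γ : Mon σ) : Let.mul P c (.s γ) = Let.mul P (.s γ) c := by
  cases c <;> simp [Let.mul, add_comm]

lemma Let.mul_s_h (γ a : Mon σ) : Let.mul P (.s γ) (.h a) = none ∨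
    ∃ a', Let.mul P (.s γ) (.h a) = some (.h a') := by
  simp only [Let.mul]
  split_ifs <;> simp

lemma Let.mul_s_s (γ β : Mon σ) : Let.mul P (.s γ) (.s β) = none ∨
    ∃ a', Let.mul P (.s γ) (.s β) = some (.s a') := by
  simp only [Let.mul]
  split_ifs <;> simp

lemma ml_sh_right (γ : Mon σ) (c : Let σ) (v : Wd k σ) (y : List (Let σ)) :
    ml P (.s γ) (sh (cs c v) (single y 1)) =
      csO (Let.mul P (.s γ) c) (sh v (single y 1)) + sh (cs c v) (ml P (.s γ) (single y 1)) -
        cs c (sh v (ml P (.s γ) (single y 1))) := by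
  cases y with
  | nil => simp
  | cons d y =>
    rw [← cs_single]
    cases d with
    | h a =>
      rcases Let.mul_s_h P γ a with h | ⟨a', h⟩ <;> simp [h]
    | s β =>
      rcases Let.mul_s_s P γ β with h | ⟨a', h⟩
      · simp [h]
      · simp only [ml_cs, h, csO_some, sh_cs_s, map_add]
        abel

lemma ml_sh_left (c : Let σ) (γ : Mon σ) (x : List (Let σ)) (v : Wd k σ) :
    ml P c (sh (single x 1) (cs (.s γ) v)) =
      sh (ml P c (single x 1)) (cs (.s γ) v) + csO (Let.mul P c (.s γ)) (sh (ew (single x 1)) v) -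
        cs (.s γ) (sh (ew (ml P c (single x 1))) v) := by
  cases x with
  | nil => simp
  | cons d x =>
    rw [← cs_single]
    cases h : Let.mul P c d with
    | none => simp [h]
    | some e =>
      simp only [ml_cs, h, csO_some, sh_cs_s, map_add]
      abel

/-- Words with a single module letter, at the end. -/
def Zok : List (Let σ) → Prop
  | [] => False
  | .h a :: w => a ∈ P.F ∧ w = []
  | .s β :: w => (β ≠ 0 ∧ β ∉ P.J) ∧ Zok w

lemma D_sh (x y : List (Let σ)) (hx : x = [] ∨ Zok P x) :
    D P (sh (single x (1 : k)) (single y 1)) =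
      sh (D P (single x 1)) (single y 1) + sh (ew (single x 1)) (D P (single y 1)) := by
  cases x with
  | nil => simp
  | cons c x =>
  cases y with
  | nil => simp
  | cons d y =>
  have hx' : x = [] ∨ Zok P x := by
    cases c with
    | s β =>
      have := hx.resolve_left (List.cons_ne_nil _ _)
      exact Or.inr this.2
    | h a =>
      have := hx.resolve_left (List.cons_ne_nil _ _)
      exact Or.inl this.2
  cases d with
  | h a =>
    have ih := D_sh x (.h a :: y) hx'
    have hD : ∀ u, sh (cs c u) (D P (cs (.h a) (single y (1 : k)))) =
        cs c (sh u (D P (cs (.h a) (single y 1)))) := fun u => by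
      have hm : ∀ u, sh (cs c u) (ml P (.h a) (single y (1 : k))) =
          cs c (sh u (ml P (.h a) (single y 1))) := fun u => by
        cases y with
        | nil => simp
        | cons e y =>
          rw [← cs_single, ml_cs]
          cases e with
          | h a' => simp [Let.mul]
          | s β =>
            rw [Let.mul_s_comm]
            rcases Let.mul_s_h P β a with h | ⟨a', h⟩ <;> simp [h]
      rw [D_cs]
      simp only [map_smul, map_sub, sh_cs_h, hm]
    have hml : ml P c (sh (single x (1 : k)) (cs (.h a) (single y 1))) =
        sh (ml P c (single x 1)) (cs (.h a) (single y 1)) := by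
      cases x with
      | nil =>
        cases c with
        | s β => exact absurd (hx.resolve_left (by simp)) (by simp [Zok])
        | h a' => simp [Let.mul]
      | cons e x =>
        rw [← cs_single]
        cases h : Let.mul P c e <;> simp [h]
    rw [← cs_single, ← cs_single] at *
    rw [sh_cs_h, D_cs, D_cs P c, ih, ew_cs]
    simp only [map_neg, map_smul, map_add, map_sub, LinearMap.neg_apply, LinearMap.smul_apply,
      LinearMap.sub_apply, hD, sh_cs_h, hml]
    module
  | s γ =>
    have ih := D_sh x (.s γ :: y) hx'
    have ih2 : D P (sh (cs c (ew (single x (1 : k)))) (single y 1)) =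
        sh (D P (cs c (ew (single x 1)))) (single y 1) -
          Let.sg k c • sh (cs c (single x 1)) (D P (single y 1)) := by
      have := D_sh (c :: x) y hx
      rw [← cs_single, ew_cs] at this
      rw [ew_single] at this ⊢
      simp only [map_smul, LinearMap.smul_apply, this, smul_add, map_neg, LinearMap.neg_apply,
        smul_neg, smul_smul]
      rw [show wsg k x * (Let.sg k c * wsg k x) = Let.sg k c * (wsg k x * wsg k x) by ring,
        wsg_mul_self, mul_one, sub_eq_add_neg]
    have e2 := ml_sh_right P γ c (ew (single x (1 : k))) y
    have e1 := ml_sh_left P c γ x (single y (1 : k))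
    have hs := Let.sg_mul_self k c
    have hγ : Let.sg k (.s γ) = 1 := rfl
    rw [← cs_single] at *
    rw [← cs_single]
    simp only [sh_cs_s, D_cs, map_add, map_sub, map_smul, ih, ih2, e1, ew_cs, ew_D, ew_ml,
      map_neg, LinearMap.sub_apply, LinearMap.smul_apply,
      LinearMap.neg_apply, e2, smul_sub, smul_add, smul_neg, smul_smul, hs, one_smul,
      ew_ew, hγ, one_mul, Let.mul_s_comm P c γ]
    abel
termination_by x.length + y.length

end Shuffle

end MonomialRings

namespace MonomialRings

open Finsupp hiding some

namespace Cx

variable {k : Type*} [Field k] {σ X Y : Type*} {C : Cx k σ X} {C' : Cx k σ Y}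

/-- A unitriangular chain map preserves dimensions of homology. -/
lemma hdim_eq_of_triangular (f : (X →₀ k) →ₗ[k] (Y →₀ k)) (π : X → Y) (μ : Y → ℕ)
    (f_mem : ∀ x ∈ C.ok, f (single x 1) ∈ C'.gr (C.deg x))
    (f_d : ∀ x ∈ C.ok, f (C.d (single x 1)) = C'.d (f (single x 1)))
    (hπ : Set.BijOn π C.ok C'.ok) (hdeg : ∀ x ∈ C.ok, C'.deg (π x) = C.deg x)
    (lower : ∀ x ∈ C.ok, f (single x 1) - single (π x) 1 ∈ supported k k {y | μ y < μ (π x)})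
    (δ : Dg σ) : C.hdim δ = C'.hdim δ := by
  have f_gr : ∀ {δ v}, v ∈ C.gr δ → f v ∈ C'.gr δ := fun {δ v} hv =>
    lin_mem (fun x hx => by rw [← hx.2]; exact f_mem x hx.1) hv
  have f_d' : ∀ {δ v}, v ∈ C.gr δ → f (C.d v) = C'.d (f v) := fun {δ v} hv =>
    lin_eq (f := f ∘ₗ C.d) (g := C'.d ∘ₗ f) (fun x hx => f_d x hx.1) hv
  have inj : ∀ {δ v}, v ∈ C.gr δ → f v = 0 → v = 0 := by
    intro δ v hv h0
    by_contra hne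
    obtain ⟨x, hx, hmax⟩ := Finset.exists_max_image v.support (fun x => μ (π x))
      (Finsupp.support_nonempty_iff.2 hne)
    have hok : ∀ x ∈ v.support, x ∈ C.ok := fun x hx => ((mem_supported k v).1 hv hx).1
    have e : f v (π x) = v x := by
      conv_lhs => rw [← Finsupp.sum_single v]
      rw [Finsupp.sum, map_sum, Finsupp.finsetSum_apply, Finset.sum_eq_single x]
      · have h1 := lower x (hok x hx)
        have h2 : ((f (single x 1) - single (π x) 1 : Y →₀ k)) (π x) = 0 := by
          by_contra hc
          exact absurd ((mem_supported k _).1 h1 (Finsupp.mem_support_iff.2 hc))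
            (lt_irrefl (μ (π x)))
        rw [Finsupp.sub_apply, single_eq_same, sub_eq_zero] at h2
        rw [← mul_one (v x), ← smul_eq_mul, ← smul_single, map_smul, Finsupp.smul_apply, h2]
      · intro x' hx' hxx
        have h1 := lower x' (hok x' hx')
        have h2 : ((f (single x' 1) - single (π x') 1 : Y →₀ k)) (π x) = 0 := by
          by_contra hc
          exact absurd ((mem_supported k _).1 h1 (Finsupp.mem_support_iff.2 hc))
            (not_lt.2 (hmax x' hx'))
        rw [Finsupp.sub_apply, single_eq_of_ne (fun h => hxx
          (hπ.injOn (hok _ hx) (hok _ hx') h).symm), sub_zero] at h2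
        rw [← mul_one (v x'), ← smul_eq_mul, ← smul_single, map_smul, Finsupp.smul_apply, h2,
          smul_zero]
      · exact fun h => absurd hx h
    rw [h0, Finsupp.zero_apply] at e
    exact Finsupp.mem_support_iff.1 hx e.symm
  have surj : ∀ {δ} (n : ℕ), ∀ w ∈ C'.gr δ, w ∈ supported k k {y | μ y < n} →
      ∃ v ∈ C.gr δ, f v = w := by
    intro δ n
    induction n with
    | zero =>
      intro w _ hw
      refine ⟨0, Submodule.zero_mem _, ?_⟩
      simp only [not_lt_zero, Set.ofPred_false, supported_empty, Submodule.mem_bot] at hw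
      rw [hw, map_zero]
    | succ n ih =>
      intro w hw hn
      choose ρ hρ using fun y (hy : y ∈ C'.ok) => hπ.surjOn hy
      have hw' : w ∈ supported k k {y | (y ∈ C'.ok ∧ C'.deg y = δ) ∧ μ y < n + 1} := by
        rw [mem_supported] at *
        exact fun y hy => ⟨hw hy, hn hy⟩
      let r : (Y →₀ k) →ₗ[k] (X →₀ k) :=
        Finsupp.linearCombination k fun y => if hy : y ∈ C'.ok then single (ρ y hy) 1 else 0
      have hr : ∀ y (hy : y ∈ C'.ok), r (single y 1) = single (ρ y hy) 1 := fun y hy => by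
        simp [r, hy]
      have h1 : r w ∈ C.gr δ := lin_mem (fun y hy => by
        rw [hr y hy.1]
        refine C.single_mem_gr (hρ y hy.1).1 ?_ 1
        rw [← hdeg _ (hρ y hy.1).1, (hρ y hy.1).2, hy.2]) hw
      have h2 : w - f (r w) ∈ supported k k {y | μ y < n} :=
        lin_mem (f := LinearMap.id - f ∘ₗ r) (fun y hy => by
          have := lower _ (hρ y hy.1.1).1
          rw [(hρ y hy.1.1).2, ← Submodule.neg_mem_iff, neg_sub] at this
          rw [LinearMap.sub_apply, LinearMap.comp_apply, LinearMap.id_apply,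
            hr y hy.1.1]
          refine supported_mono ?_ this
          intro z hz
          exact lt_of_lt_of_le hz (Nat.lt_succ_iff.1 hy.2)) hw'
      obtain ⟨v, hv, e⟩ := ih _ (Submodule.sub_mem _ hw (f_gr h1)) h2
      exact ⟨v + r w, Submodule.add_mem _ hv h1, by rw [map_add, e, sub_add_cancel]⟩
  have surj' : ∀ {δ}, ∀ w ∈ C'.gr δ, ∃ v ∈ C.gr δ, f v = w := fun {δ} w hw =>
    surj (w.support.sup μ + 1) w hw ((mem_supported k w).2 fun y hy =>
      Nat.lt_succ_iff.2 (Finset.le_sup (f := μ) hy))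
  refine hdim_eq_of_map f ?_ ?_ ?_
  · rintro v ⟨hv, hd⟩
    exact ⟨f_gr hv, LinearMap.mem_ker.2 (by rw [← f_d' hv, LinearMap.mem_ker.1 hd, map_zero])⟩
  · rintro v ⟨hv, hd⟩
    constructor
    · rintro ⟨w, hw, e⟩
      obtain ⟨u, hu, rfl⟩ := surj' w hw
      refine ⟨u, hu, ?_⟩
      rw [← f_d' hu] at e
      exact sub_eq_zero.1 (inj (Submodule.sub_mem _ (C.d_gr' hu) hv) (by rw [map_sub, e, sub_self]))
    · rintro ⟨u, hu, rfl⟩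
      exact ⟨f u, f_gr hu, (f_d' hu).symm⟩
  · rintro w ⟨hw, hd⟩
    obtain ⟨v, hv, rfl⟩ := surj' w hw
    refine ⟨v, ⟨hv, LinearMap.mem_ker.2 ?_⟩, by rw [sub_self]; exact Submodule.zero_mem _⟩
    have h0 : f (C.d v) = 0 := by rw [f_d' hv, LinearMap.mem_ker.1 hd]
    have hg := C.d_gr hv
    rcases C.gm_eq_bot_or δ with h | ⟨δ', rfl⟩
    · rw [h] at hg
      exact (Submodule.mem_bot k).1 hg
    · rw [C.gm_add] at hg
      exact inj hg h0

end Cx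

section Finiteness

variable {k : Type*} [Field k] {σ : Type*} [Finite σ] (P : Par σ) (e0 : Dg σ)

lemma ldeg_le_wdeg {c : Let σ} {l : List (Let σ)} (h : c ∈ l) : ldeg e0 c ≤ wdeg e0 l :=
  List.single_le_sum (fun _ _ => zero_le) _ (List.mem_map_of_mem h)

lemma finite_words (δ : Dg σ) (n : ℕ) :
    {l : List (Let σ) | l.length ≤ n ∧ wdeg e0 l = δ}.Finite := by
  have hfin : {β : Mon σ | ∀ i, β i ≤ δ (some i)}.Finite := by
    have := Fintype.ofFinite σ
    exact (Set.finite_Iic (fun i => δ (some i))).subset fun β hβ => hβ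
  let T : Set (Let σ) := Let.s '' {β : Mon σ | ∀ i, β i ≤ δ (some i)} ∪
    Let.h '' {β : Mon σ | ∀ i, β i ≤ δ (some i)}
  have hT : T.Finite := (hfin.image _).union (hfin.image _)
  have := hT.to_subtype
  refine ((List.finite_length_le T n).image (List.map Subtype.val)).subset ?_
  rintro l ⟨hl, rfl⟩
  have hm : ∀ c ∈ l, c ∈ T := fun c hc => by
    have h1 := ldeg_le_wdeg e0 hc
    cases c with
    | s β =>
      refine Or.inl ⟨β, fun i => le_trans ?_ (h1 (some i)), rfl⟩
      simp [ldeg]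
    | h a =>
      refine Or.inr ⟨a, fun i => le_trans ?_ (h1 (some i)), rfl⟩
      simp [ldeg]
  exact ⟨l.attach.map fun c => ⟨c.1, hm c.1 c.2⟩, by simpa using hl, by simp⟩

lemma wordCx_locFin {ok : Set (List (Let σ))} {hok} (N : Dg σ → ℕ)
    (hN : ∀ l ∈ ok, l.length ≤ N (wdeg e0 l)) : (wordCx k P e0 ok hok).LocFin := fun δ =>
  (finite_words e0 δ (N δ)).subset fun l hl =>
    ⟨(hN l hl.1).trans (le_of_eq (congrArg N hl.2)), hl.2⟩

end Finiteness

section Complexes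

variable {k : Type*} [Field k] {σ : Type*} (P : Par σ)

/-- Nontrivial monomials of the ring, and elements of the module. -/
def Let.Good : Let σ → Prop
  | .s β => β ≠ 0 ∧ β ∉ P.J
  | .h a => a ∈ P.F

lemma Let.Good.mul {c c' c'' : Let σ} (h : Let.Good P c) (h' : Let.Good P c')
    (hm : Let.mul P c c' = some c'') : Let.Good P c'' := by
  cases c <;> cases c' <;> simp only [Let.mul] at hm
  · split_ifs at hm with hJ
    obtain rfl := Option.some.inj hm
    exact ⟨fun h0 => h.1 (by simpa using (add_eq_zero.1 h0).1), hJ⟩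
  · split_ifs at hm with hF
    obtain rfl := Option.some.inj hm
    exact hF.2
  · split_ifs at hm with hF
    obtain rfl := Option.some.inj hm
    exact hF.2
  · cases hm

lemma Step.good {l l' : List (Let σ)} (h : Step P l l') (hl : ∀ c ∈ l, Let.Good P c) :
    ∀ c ∈ l', Let.Good P c := by
  induction h with
  | head hm =>
    simp only [List.mem_cons, forall_eq_or_imp] at hl ⊢
    exact ⟨hl.1.mul P hl.2.1 hm, hl.2.2⟩
  | tail _ ih =>
    simp only [List.mem_cons, forall_eq_or_imp] at hl ⊢
    exact ⟨hl.1, ih hl.2⟩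

lemma Step.hat {l l' : List (Let σ)} (h : Step P l l') :
    (∃ a, Let.h a ∈ l) ↔ ∃ a, Let.h a ∈ l' := by
  induction h with
  | @head c c' c'' w hm =>
    cases c <;> cases c' <;> simp only [Let.mul] at hm
    · split_ifs at hm
      obtain rfl := Option.some.inj hm
      simp
    · split_ifs at hm
      obtain rfl := Option.some.inj hm
      simp
    · split_ifs at hm
      obtain rfl := Option.some.inj hm
      simp
    · cases hm
  | tail _ ih => simp [exists_or, ih]

lemma Zok.good : ∀ {l : List (Let σ)}, Zok P l → ∀ c ∈ l, Let.Good P c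
  | [], h => h.elim
  | .h a :: w, ⟨h, hw⟩ => by
    subst hw
    intro c hc
    rw [List.mem_singleton.1 hc]
    exact h
  | .s β :: w, ⟨h, hw⟩ => by
    simp only [List.mem_cons, forall_eq_or_imp]
    exact ⟨h, Zok.good hw⟩

lemma Zok.hat : ∀ {l : List (Let σ)}, Zok P l → ∃ a, Let.h a ∈ l
  | [], h => h.elim
  | .h a :: w, _ => ⟨a, by simp⟩
  | .s β :: w, ⟨_, hw⟩ => by
    obtain ⟨a, ha⟩ := Zok.hat hw
    exact ⟨a, by simp [ha]⟩

lemma Step.zok {l l' : List (Let σ)} (h : Step P l l') (hl : Zok P l) : Zok P l' := by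
  induction h with
  | @head c c' c'' w hm =>
    have hg := (hl.good P c (by simp)).mul P (hl.good P c' (by simp)) hm
    cases c <;> cases c' <;> simp only [Let.mul] at hm
    · split_ifs at hm
      obtain rfl := Option.some.inj hm
      exact ⟨hg, hl.2.2⟩
    · split_ifs at hm
      obtain rfl := Option.some.inj hm
      exact ⟨hg, hl.2.2⟩
    · exact absurd hl.2 (by simp)
    · cases hm
  | @tail c w w' h ih =>
    cases c with
    | s β => exact ⟨hl.1, ih hl.2⟩
    | h a => obtain ⟨_, rfl⟩ := hl; cases h

variable (k) [Finite σ] (e0 : Dg σ)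

/-- The bar complex of the trivial extension. -/
def cxAll : Cx k σ (List (Let σ)) :=
  wordCx k P e0 {l | ∀ c ∈ l, Let.Good P c} fun _ hl _ h => h.good P hl

/-- The bar complex of the ring. -/
def cxS : Cx k σ (List (Let σ)) :=
  wordCx k P e0 {l | (∀ c ∈ l, Let.Good P c) ∧ ¬ ∃ a, Let.h a ∈ l} fun _ hl _ h =>
    ⟨h.good P hl.1, fun hh => hl.2 ((h.hat P).2 hh)⟩

/-- The part of the bar complex of the trivial extension involving the module. -/
def cxQ : Cx k σ (List (Let σ)) :=
  wordCx k P e0 {l | (∀ c ∈ l, Let.Good P c) ∧ ∃ a, Let.h a ∈ l} fun _ hl _ h =>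
    ⟨h.good P hl.1, (h.hat P).1 hl.2⟩

/-- The bar complex of the module. -/
def cxZ : Cx k σ (List (Let σ)) := wordCx k P e0 {l | Zok P l} fun _ hl _ h => h.zok P hl

variable {k}

lemma length_le_wdeg (he : e0 none ≠ 0) (l : List (Let σ)) : l.length ≤ wdeg e0 l none := by
  induction l with
  | nil => simp
  | cons c l ih =>
    have : 1 ≤ ldeg e0 c none := by
      cases c <;> simp [ldeg, zz]
      omega
    rw [wdeg_cons, Finsupp.add_apply, List.length_cons]
    omega

lemma cxAll_locFin (he : e0 none ≠ 0) : (cxAll k P e0).LocFin :=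
  wordCx_locFin P e0 (fun δ => δ none) fun l _ => length_le_wdeg e0 he l

lemma Zok.length_le {l : List (Let σ)} (h : Zok P l) : l.length ≤ wdeg e0 l none + 1 := by
  induction l with
  | nil => simp
  | cons c l ih =>
    cases c with
    | s β =>
      have := ih h.2
      simp only [wdeg_cons, Finsupp.add_apply, List.length_cons, ldeg, ex_none, zz,
        single_eq_same]
      omega
    | h a =>
      obtain ⟨_, rfl⟩ := h
      simp

lemma cxZ_locFin : (cxZ k P e0).LocFin :=
  wordCx_locFin P e0 (fun δ => δ none + 1) fun _ hl => Zok.length_le P e0 hl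

lemma cxAll_hdim (he : e0 none ≠ 0) (δ : Dg σ) :
    (cxAll k P e0).hdim δ = (cxS k P e0).hdim δ + (cxQ k P e0).hdim δ := by
  refine Cx.hdim_add (C := cxAll k P e0) (C1 := cxS k P e0) (C2 := cxQ k P e0) rfl rfl rfl rfl ?_ ?_
    (cxAll_locFin P e0 he) δ
  · ext l
    change (_) ↔ (_ ∧ _) ∨ (_ ∧ _)
    rw [← and_or_left]
    exact ⟨fun h => ⟨h, (em _).symm⟩, fun h => h.1⟩
  · rw [Set.disjoint_left]
    exact fun l h1 h2 => h1.2 h2.2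

end Complexes

end MonomialRings

namespace MonomialRings

open Finsupp hiding some

section Kunneth

variable {k : Type*} [Field k] {σ : Type*} (P : Par σ)

lemma shl_perm (x y : List (Let σ)) : shl k x y ∈ supported k k {l | l.Perm (x ++ y)} := by
  cases x with
  | nil => rw [shl]; exact single_mem_supported _ _ (List.Perm.refl _)
  | cons c x =>
    cases y with
    | nil =>
      rw [shl]
      exact single_mem_supported _ _ (by simp)
    | cons d y =>
      have h1 : cs c (shl k x (d :: y)) ∈ supported k k {l | l.Perm (c :: x ++ d :: y)} :=
        cs_mem (s := {l | l.Perm (x ++ d :: y)})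
          (t := {l | l.Perm (c :: x ++ d :: y)}) (fun l hl => List.Perm.cons c hl)
          (shl_perm x (d :: y))
      cases d with
      | h a => rw [shl]; exact h1
      | s γ =>
        rw [shl]
        refine Submodule.add_mem _ h1 (Submodule.smul_mem _ _
          (cs_mem (s := {l | l.Perm (c :: x ++ y)}) (fun l hl => ?_) (shl_perm (c :: x) y)))
        exact (List.Perm.cons _ hl).trans List.perm_middle.symm
termination_by x.length + y.length

/-- The number of letters after the first module letter. -/
def aft : List (Let σ) → ℕ
  | [] => 0
  | .h _ :: w => w.length
  | .s _ :: w => aft w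

lemma Zok.aft_append {x : List (Let σ)} (hx : Zok P x) (y : List (Let σ)) :
    aft (x ++ y) = y.length := by
  induction x with
  | nil => exact hx.elim
  | cons c x ih =>
    cases c with
    | s β => exact ih hx.2
    | h a => rw [hx.2]; rfl

lemma shl_lower (x y : List (Let σ)) (hx : Zok P x) :
    shl k x y - single (x ++ y) 1 ∈ supported k k {l | aft l < y.length} := by
  cases x with
  | nil => exact hx.elim
  | cons c x =>
    cases y with
    | nil => rw [shl, List.append_nil, sub_self]; exact Submodule.zero_mem _
    | cons d y =>
      have h1 : cs c (shl k x (d :: y)) - single (c :: x ++ d :: y) 1 ∈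
          supported k k {l | aft l < (d :: y).length} := by
        rw [List.cons_append, ← cs_single, ← map_sub]
        cases c with
        | s β => exact cs_mem (fun l hl => hl) (shl_lower x (d :: y) hx.2)
        | h a =>
          rw [hx.2, shl, List.nil_append, sub_self, map_zero]
          exact Submodule.zero_mem _
      cases d with
      | h a => rw [shl]; exact h1
      | s γ =>
        rw [shl, add_sub_right_comm]
        refine Submodule.add_mem _ h1 (Submodule.smul_mem _ _ ?_)
        have h2 : shl k (c :: x) y ∈ supported k k {l | aft l ≤ y.length} := by
          rw [← sub_add_cancel (shl k (c :: x) y) (single (c :: x ++ y) 1)]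
          exact Submodule.add_mem _
            (supported_mono (s := {l | aft l < y.length})
              (t := {l | aft l ≤ y.length}) (fun l hl => Nat.le_of_lt hl) (shl_lower (c :: x) y hx))
            (single_mem_supported _ _ (le_of_eq (hx.aft_append P y)))
        exact cs_mem (fun l hl => Nat.lt_succ_of_le hl) h2
termination_by x.length + y.length

lemma Zok.append_inj : ∀ {x x' y y' : List (Let σ)}, Zok P x → Zok P x' → x ++ y = x' ++ y' →
    x = x' ∧ y = y'
  | [], _, _, _, h, _, _ => h.elim
  | _, [], _, _, _, h, _ => h.elim
  | .s β :: x, .h a :: x', _, _, _, _, h => by simp at h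
  | .h a :: x, .s β :: x', _, _, _, _, h => by simp at h
  | .h a :: x, .h a' :: x', _, _, h1, h2, h => by
    obtain ⟨_, rfl⟩ := h1
    obtain ⟨_, rfl⟩ := h2
    simpa using h
  | .s a :: x, .s a' :: x', _, _, h1, h2, h => by
    simp only [List.cons_append, List.cons.injEq] at h
    obtain ⟨rfl, rfl⟩ := Zok.append_inj h1.2 h2.2 h.2
    exact ⟨by rw [h.1], rfl⟩

lemma exists_split (l : List (Let σ)) (hl : ∀ c ∈ l, Let.Good P c) (h : ∃ a, Let.h a ∈ l) :
    ∃ x y, Zok P x ∧ (∀ c ∈ y, Let.Good P c) ∧ x ++ y = l := by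
  induction l with
  | nil => simp at h
  | cons c l ih =>
    simp only [List.mem_cons, forall_eq_or_imp] at hl
    cases c with
    | s β =>
      obtain ⟨x, y, hx, hy, rfl⟩ := ih hl.2 (by simpa using h)
      exact ⟨.s β :: x, y, ⟨hl.1, hx⟩, hy, rfl⟩
    | h a => exact ⟨[.h a], l, ⟨hl.1, rfl⟩, hl.2, rfl⟩

variable [Finite σ] (e0 : Dg σ)

lemma chi_wdeg (he : Cx.chi k e0 = 1) (l : List (Let σ)) : Cx.chi k (wdeg e0 l) = wsg k l := by
  induction l with
  | nil => simp [Cx.chi, wsg]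
  | cons c l ih =>
    rw [wdeg_cons, Cx.chi_add, ih, wsg]
    congr 1
    cases c with
    | s β => simp [ldeg, zz, Let.sg, Cx.chi]
    | h a =>
      rw [ldeg, Cx.chi_add, he]
      simp [Let.sg, Cx.chi]

lemma cxQ_hdim (he : Cx.chi k e0 = 1) (δ : Dg σ) :
    ((cxZ k P e0).prod (cxAll k P e0)).hdim δ = (cxQ k P e0).hdim δ := by
  let f : (List (Let σ) × List (Let σ) →₀ k) →ₗ[k] Wd k σ :=
    Finsupp.linearCombination k fun p => shl k p.1 p.2
  have f_single : ∀ p, f (single p 1) = shl k p.1 p.2 := fun p => by simp [f]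
  have f_tm : ∀ u v : Wd k σ, f (tm u v) = sh u v := bilin_ext (f := tm.compr₂ f) (g := sh)
    (fun x y => by
      rw [LinearMap.compr₂_apply, tm_single, sh_single, mul_one, f_single])
  refine Cx.hdim_eq_of_triangular f (fun p => p.1 ++ p.2) aft ?_ ?_ ⟨?_, ?_, ?_⟩ ?_ ?_ δ
  · rintro ⟨x, y⟩ ⟨hx, hy⟩
    rw [f_single]
    refine supported_mono (fun l hl => ?_) (shl_perm x y)
    have hp : l.Perm (x ++ y) := hl
    obtain ⟨a, ha⟩ := Zok.hat P hx
    refine ⟨⟨fun c hc => ?_, a, ?_⟩, ?_⟩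
    · rcases List.mem_append.1 (hp.mem_iff.1 hc) with h | h
      · exact Zok.good P hx c h
      · exact hy c h
    · exact hp.mem_iff.2 (List.mem_append_left _ ha)
    · change wdeg e0 l = wdeg e0 x + wdeg e0 y
      rw [← wdeg_append]
      exact (hp.map _).sum_eq
  · rintro ⟨x, y⟩ ⟨hx, hy⟩
    have hx' : single x (1 : k) ∈ (cxZ k P e0).gr (wdeg e0 x) := Cx.single_mem_gr _ hx rfl 1
    have e : single (x, y) (1 : k) = tm (single x 1) (single y 1) := by
      rw [tm_single, mul_one]
    rw [e, Cx.prod_d, Cx.prodD_tm _ _ hx', map_add, map_smul, f_tm, f_tm, f_tm,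
      chi_wdeg e0 he]
    change _ = D P _
    rw [D_sh P x y (Or.inr hx), ew_single, map_smul, LinearMap.smul_apply]
    rfl
  · rintro ⟨x, y⟩ ⟨hx, hy⟩
    obtain ⟨a, ha⟩ := Zok.hat P hx
    refine ⟨fun c hc => ?_, a, List.mem_append_left _ ha⟩
    rcases List.mem_append.1 hc with h | h
    · exact Zok.good P hx c h
    · exact hy c h
  · rintro ⟨x, y⟩ ⟨hx, hy⟩ ⟨x', y'⟩ ⟨hx', hy'⟩ h
    obtain ⟨rfl, rfl⟩ := Zok.append_inj P hx hx' h
    rfl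
  · rintro l ⟨hl, ha⟩
    obtain ⟨x, y, hx, hy, rfl⟩ := exists_split P l hl ha
    exact ⟨(x, y), ⟨hx, hy⟩, rfl⟩
  · rintro ⟨x, y⟩ ⟨hx, hy⟩
    exact wdeg_append e0 x y
  · rintro ⟨x, y⟩ ⟨hx, hy⟩
    rw [f_single]
    refine supported_mono (fun l hl => ?_) (shl_lower P x y hx)
    change aft l < aft (x ++ y)
    rw [Zok.aft_append P hx]
    exact hl

lemma cxAll_series (he : Cx.chi k e0 = 1) (he' : e0 none ≠ 0) :
    (cxAll k P e0).series =
      (cxS k P e0).series + (cxZ k P e0).series * (cxAll k P e0).series := by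
  rw [← Cx.series_prod (cxZ_locFin P e0) (cxAll_locFin P e0 he')]
  ext δ
  rw [map_add, Cx.coeff_series, Cx.coeff_series, Cx.coeff_series, cxQ_hdim P e0 he,
    cxAll_hdim P e0 he']
  push_cast
  rfl

end Kunneth

end MonomialRings

namespace MonomialRings

open Finsupp hiding some

section Poincare

variable {k : Type*} [Field k] {σ : Type*} (P : Par σ)

/-- The inclusion of the bar complex in the space of words. -/
def toWd : (List (Mon σ) →₀ k) →ₗ[k] Wd k σ := lmapDomain k k (List.map Let.s)

lemma map_s_injective : Function.Injective (List.map (Let.s (σ := σ))) :=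
  List.map_injective_iff.2 fun _ _ h => Let.s.inj h

lemma toWd_injective : Function.Injective (toWd (k := k) (σ := σ)) :=
  mapDomain_injective map_s_injective

lemma toWd_single (l : List (Mon σ)) (a : k) : toWd (single l a) = single (l.map Let.s) a := by
  simp [toWd]

lemma barAux_cons_cons (J : Set (Mon σ)) (β γ : Mon σ) (w : List (Mon σ)) :
    barAux k J (β :: γ :: w) = (if β + γ ∉ J then -single ((β + γ) :: w) 1 else 0) -
      lmapDomain k k (β :: ·) (barAux k J (γ :: w)) := by
  unfold barAux
  rw [List.length_cons, Nat.add_sub_cancel, List.length_cons, Finset.sum_range_succ', add_comm,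
    sub_eq_add_neg]
  congr 1
  · simp [mergeAt]
  · rw [map_sum, ← Finset.sum_neg_distrib]
    refine Finset.sum_congr (by simp) fun j _ => ?_
    simp only [List.getD_cons_succ]
    split_ifs with h
    · simp
    · rw [lmapDomain_apply, mapDomain_smul, mapDomain_single, ← neg_smul, pow_succ _ (j + 1),
        mul_neg_one]
      rfl

lemma D_toWd (v : List (Mon σ) →₀ k) : D P (toWd v) = -toWd (barD k P.J v) := by
  rw [← neg_one_smul k]
  refine lin_eq (s := Set.univ) (f := D P ∘ₗ toWd) (g := (-1 : k) • (toWd ∘ₗ barD k P.J))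
    (fun l hl => ?_) (by simp)
  clear hl
  have hb : ∀ l, barD k P.J (single l 1) = barAux k P.J l := fun l => by simp [barD]
  rw [LinearMap.comp_apply, LinearMap.smul_apply, LinearMap.comp_apply, toWd_single, hb]
  induction l with
  | nil => simp [barAux]
  | cons β l ih =>
    cases l with
    | nil => simp [barAux]
    | cons γ w =>
      have hc : ∀ v : List (Mon σ) →₀ k,
          toWd (lmapDomain k k (β :: ·) v) = cs (.s β) (toWd v) := fun v =>
        lin_eq (s := Set.univ) (f := toWd ∘ₗ lmapDomain k k (β :: ·)) (g := cs (.s β) ∘ₗ toWd)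
          (fun l _ => by
            rw [LinearMap.comp_apply, LinearMap.comp_apply, toWd_single, cs_single,
              lmapDomain_apply, mapDomain_single, toWd_single]
            rfl) (by simp)
      rw [barAux_cons_cons, map_sub, hc, List.map_cons, ← cs_single, D_cs, ih, List.map_cons,
        ← cs_single, ml_cs]
      by_cases h : β + γ ∈ P.J
      · simp [Let.mul, h, Let.sg]
      · simp [Let.mul, h, Let.sg, toWd_single, add_comm]

variable [Finite σ] (e0 : Dg σ)

lemma wdeg_map_s (l : List (Mon σ)) (δ : Dg σ) :
    wdeg e0 (l.map Let.s) = δ ↔ l.length = δ none ∧ l.sum = fun i => δ (some i) := by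
  have h1 : wdeg e0 (l.map Let.s) none = l.length := by
    induction l with
    | nil => simp
    | cons β l ih => simp [ih, ldeg, zz, add_comm]
  have h2 : ∀ i, wdeg e0 (l.map Let.s) (some i) = l.sum i := fun i => by
    clear h1
    induction l with
    | nil => simp
    | cons β l ih => simp [ih, ldeg, zz]
  constructor
  · rintro rfl
    exact ⟨h1.symm, funext fun i => (h2 i).symm⟩
  · rintro ⟨h3, h4⟩
    ext o
    cases o with
    | none => rw [h1, h3]
    | some i => rw [h2, h4]

lemma cxS_gr (δ : Dg σ) : (cxS k P e0).gr δ =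
    (barSub k P.J (δ none) fun i => δ (some i)).map toWd := by
  have : barSub k P.J (δ none) (fun i => δ (some i)) =
      supported k k (barBasis P.J (δ none) fun i => δ (some i)) := by
    rw [supported_eq_span_single]; rfl
  rw [this, toWd, lmapDomain_supported, Cx.gr]
  congr 1
  ext l
  constructor
  · rintro ⟨⟨h1, h2⟩, h3⟩
    have : ∃ l', l = List.map Let.s l' := by
      clear h3
      induction l with
      | nil => exact ⟨[], rfl⟩
      | cons c l ih =>
        simp only [List.mem_cons, forall_eq_or_imp, exists_or, not_or] at h1 h2
        obtain ⟨l', rfl⟩ := ih h1.2 h2.2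
        cases c with
        | s β => exact ⟨β :: l', rfl⟩
        | h a => exact absurd ⟨a, rfl⟩ h2.1
    obtain ⟨l, rfl⟩ := this
    have := (wdeg_map_s e0 l δ).1 h3
    exact ⟨l, ⟨this.1, this.2, fun β hβ => h1 _ (List.mem_map_of_mem hβ)⟩, rfl⟩
  · rintro ⟨l, ⟨h1, h2, h3⟩, rfl⟩
    refine ⟨⟨?_, by simp⟩, (wdeg_map_s e0 l δ).2 ⟨h1, h2⟩⟩
    intro c hc
    obtain ⟨β, hβ, rfl⟩ := List.mem_map.1 hc
    exact h3 β hβ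

lemma cxS_locFin : (cxS k P e0).LocFin :=
  wordCx_locFin P e0 (fun δ => δ none) fun l hl => by
    have h2 := hl.2
    clear hl
    induction l with
    | nil => simp
    | cons c l ih =>
      simp only [List.mem_cons, exists_or, not_or] at h2
      cases c with
      | s β =>
        have := ih h2.2
        simp only [wdeg_cons, List.length_cons, Finsupp.add_apply, ldeg, zz, single_eq_same]
        omega
      | h a => exact absurd ⟨a, rfl⟩ h2.1

lemma cxS_hdim (δ : Dg σ) :
    (cxS k P e0).hdim δ = torDim k P.J (δ none) fun i => δ (some i) := by
  have h0 := (cxS_locFin (k := k) P e0).hdim_add_finrank δ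
  have hB : (cxS k P e0).B δ =
      ((barSub k P.J (δ none + 1) fun i => δ (some i)).map (barD k P.J)).map toWd := by
    have e := cxS_gr (k := k) P e0 (δ + zz)
    rw [show (δ + zz : Dg σ) none = δ none + 1 by simp [zz],
      show (fun i => (δ + zz : Dg σ) (some i)) = fun i => δ (some i) by funext i; simp [zz]] at e
    rw [Cx.B, e]
    ext v
    simp only [Submodule.mem_map, exists_exists_and_eq_and]
    constructor
    · rintro ⟨u, hu, rfl⟩
      exact ⟨-u, Submodule.neg_mem _ hu, by
        rw [map_neg, map_neg]; exact (D_toWd P u).symm⟩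
    · rintro ⟨u, hu, rfl⟩
      exact ⟨-u, Submodule.neg_mem _ hu, by
        rw [map_neg, map_neg, ← neg_eq_iff_eq_neg.2 (D_toWd P u)]; rfl⟩
  have hZ : (cxS k P e0).Z δ =
      (barSub k P.J (δ none) (fun i => δ (some i)) ⊓ LinearMap.ker (barD k P.J)).map toWd := by
    rw [Cx.Z, cxS_gr]
    ext v
    simp only [Submodule.mem_map, Submodule.mem_inf, LinearMap.mem_ker]
    constructor
    · rintro ⟨⟨u, hu, rfl⟩, h⟩
      refine ⟨u, ⟨hu, toWd_injective ?_⟩, rfl⟩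
      have h' : D P (toWd u) = 0 := h
      rw [D_toWd, neg_eq_zero] at h'
      rw [h', map_zero]
    · rintro ⟨u, ⟨hu, h⟩, rfl⟩
      refine ⟨⟨u, hu, rfl⟩, ?_⟩
      change D P (toWd u) = 0
      rw [D_toWd, h, map_zero, neg_zero]
  rw [hB, hZ, ← (Submodule.equivMapOfInjective toWd toWd_injective _).finrank_eq,
    ← (Submodule.equivMapOfInjective toWd toWd_injective _).finrank_eq] at h0
  unfold torDim
  omega

variable (k) in
/-- The multigraded Poincaré series, for arbitrary index types of variables. -/
def pser (J : Set (Mon σ)) : MvPowerSeries (Option σ) ℤ :=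
  fun δ => (torDim k J (δ none) fun i => δ (some i) : ℤ)

lemma cxS_series : (cxS k P e0).series = pser k P.J := by
  ext δ
  rw [Cx.coeff_series, cxS_hdim]
  rfl

end Poincare

end MonomialRings

namespace MonomialRings

open Finsupp hiding some

section Twist

variable {k : Type*} [Field k] {σ : Type*} (P : Par σ)

/-- The module is an ideal on which multiplication by the nontrivial monomial `x` is injective. -/
structure Par.Mult (x : Mon σ) : Prop where
  ne : x ≠ 0
  notMem : x ∉ P.J
  ann : ∀ a ∈ P.F, x + a ∉ P.J
  ideal : ∀ a ∈ P.F, ∀ β, β + a ∉ P.J → β + a ∈ P.F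
  ne_zero : ∀ a ∈ P.F, a ≠ 0

/-- The inclusion of the module in the ring. -/
def Let.inc : Let σ → Option (Let σ)
  | .s _ => none
  | .h a => if a ∈ P.F then some (.s a) else none

/-- The inclusion of the module in the ring followed by multiplication with a monomial. -/
def Let.incX (x : Mon σ) : Let σ → Option (Let σ)
  | .s _ => none
  | .h a => if a ∈ P.F then some (.s (x + a)) else none

variable {P} {x : Mon σ}

lemma Par.Mult.mem_iff (hx : P.Mult x) {a : Mon σ} (ha : a ∈ P.F) (β : Mon σ) :
    β + a ∈ P.F ↔ β + a ∉ P.J :=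
  ⟨P.disj _, hx.ideal a ha β⟩

lemma Par.Mult.add_mem_iff (hx : P.Mult x) {a : Mon σ} (ha : a ∈ P.F) (β : Mon σ) :
    β + (x + a) ∈ P.J ↔ β + a ∈ P.J := by
  constructor
  · intro h
    by_contra h'
    exact hx.ann _ (hx.ideal a ha β h') (by rwa [add_left_comm] at h)
  · intro h
    have := P.up _ h x
    rwa [add_assoc, add_comm a x] at this

lemma Let.inc_bind (hx : P.Mult x) (c : Let σ) :
    (Let.inc P c).bind (fun c' => Let.mul P (.s x) c') = Let.incX P x c := by
  cases c with
  | s β => rfl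
  | h a =>
    by_cases ha : a ∈ P.F
    · simp [inc, incX, ha, mul, hx.ann a ha]
    · simp [inc, incX, ha]

lemma Let.inc_mul (hx : P.Mult x) (c d : Let σ) (v : Wd k σ) :
    csO ((Let.mul P c d).bind (Let.inc P)) v =
      Let.sg k c • csO ((Let.inc P d).bind fun c' => Let.mul P c c') v +
        csO ((Let.inc P c).bind fun c' => Let.mul P c' d) v := by
  cases c with
  | s β =>
    cases d with
    | s γ => by_cases h : β + γ ∈ P.J <;> simp [mul, inc, h]
    | h a =>
      by_cases ha : a ∈ P.F
      · by_cases h : β + a ∈ P.J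
        · simp [mul, inc, ha, h, hx.mem_iff ha]
        · simp [mul, inc, ha, h, hx.mem_iff ha, sg]
      · simp [mul, inc, ha]
  | h a =>
    cases d with
    | s β =>
      by_cases ha : a ∈ P.F
      · by_cases h : β + a ∈ P.J
        · simp [mul, inc, ha, h, hx.mem_iff ha, add_comm a β]
        · simp [mul, inc, ha, h, hx.mem_iff ha, add_comm a β]
      · simp [mul, inc, ha]
    | h b =>
      by_cases ha : a ∈ P.F <;> by_cases hb : b ∈ P.F
      · have e : b + a ∈ P.F ↔ a + b ∈ P.F := by rw [add_comm]
        by_cases h : a + b ∈ P.F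
        · simp [mul, inc, ha, hb, sg, h, add_comm b a]
        · simp [mul, inc, ha, hb, h, e]
      · have e : b + a ∈ P.F ↔ b + a ∉ P.J := hx.mem_iff ha b
        simp [mul, inc, ha, hb]
      · simp [mul, inc, ha, hb]
      · simp [mul, inc, ha, hb]

lemma Let.incX_mul (hx : P.Mult x) (c d : Let σ) (v : Wd k σ) :
    csO ((Let.mul P c d).bind (Let.incX P x)) v =
      Let.sg k c • csO ((Let.incX P x d).bind fun c' => Let.mul P c c') v +
        csO ((Let.incX P x c).bind fun c' => Let.mul P c' d) v := by
  have h := congrArg (ml P (.s x)) (Let.inc_mul (k := k) hx c d v)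
  simp only [map_add, map_smul, ml_csO, Option.bind_assoc, Let.inc_bind hx] at h
  have e1 : ((Let.inc P d).bind fun y => (Let.mul P c y).bind fun c' => Let.mul P (.s x) c') =
      (Let.incX P x d).bind fun c' => Let.mul P c c' := by
    rw [← Let.inc_bind hx d, Option.bind_assoc]
    refine congrArg _ (funext fun y => ?_)
    rw [← Let.mul_assoc', ← Let.mul_s_comm, Let.mul_assoc']
  have e2 : ((Let.inc P c).bind fun y => (Let.mul P y d).bind fun c' => Let.mul P (.s x) c') =
      (Let.incX P x c).bind fun c' => Let.mul P c' d := by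
    rw [← Let.inc_bind hx c, Option.bind_assoc]
    exact congrArg _ (funext fun y => (Let.mul_assoc' P _ _ _).symm)
  rw [h, e1, e2]

lemma De_ml (hx : P.Mult x) (c : Let σ) (v : Wd k σ) : De P (Let.incX P x) (ml P c v) =
    Let.sg k c • ml P c (De P (Let.incX P x) v) + mlO P (Let.incX P x c) v := by
  refine word_ext (f := De P (Let.incX P x) ∘ₗ ml P c)
    (g := Let.sg k c • (ml P c ∘ₗ De P (Let.incX P x)) + mlO P (Let.incX P x c))
    (fun l => ?_) v
  rw [LinearMap.comp_apply, LinearMap.add_apply, LinearMap.smul_apply, LinearMap.comp_apply]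
  cases l with
  | nil => cases Let.incX P x c <;> simp
  | cons d w =>
    rw [← cs_single, ml_cs, De_cs, map_add, map_smul, map_sub, ml_cs, ml_ml, ml_csO]
    have e : mlO P (Let.incX P x c) (cs d (single w (1 : k))) =
        csO ((Let.incX P x c).bind fun c' => Let.mul P c' d) (single w 1) := by
      cases Let.incX P x c <;> simp
    rw [e, smul_add, add_assoc, ← Let.incX_mul hx, smul_smul]
    cases h : Let.mul P c d with
    | none => simp
    | some c' => simp [Let.sg_mul P k h]

lemma De_De (hx : P.Mult x) (v : Wd k σ) :
    De P (Let.incX P x) (De P (Let.incX P x) v) = 0 := by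
  refine word_ext (f := De P (Let.incX P x) ∘ₗ De P (Let.incX P x)) (g := 0) (fun l => ?_) v
  induction l with
  | nil => simp
  | cons c w ih =>
    rw [LinearMap.comp_apply, LinearMap.zero_apply] at ih
    rw [← cs_single, LinearMap.comp_apply, LinearMap.zero_apply]
    cases c with
    | s β => simp [De_ml hx, ih, Let.sg, Let.incX]
    | h a => by_cases ha : a ∈ P.F <;> simp [De_ml hx, ih, Let.sg, Let.incX, ha]

variable (P x)

/-- The components of the isomorphism between the twisted and untwisted bar complexes. -/
def ABl (k : Type*) [Field k] : List (Let σ) → Wd k σ × Wd k σ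
  | [] => (single [] 1, 0)
  | c :: w =>
    let b := (-Let.sg k c) • cs c (ABl k w).2 + csO (Let.inc P c) (ABl k w).1
    (cs c (ABl k w).1 - cs (.s x) b, b)

/-- The isomorphism between the twisted and untwisted bar complexes. -/
def opA : Wd k σ →ₗ[k] Wd k σ := lin fun l => (ABl P x k l).1

/-- The correction term in `opA`. -/
def opB : Wd k σ →ₗ[k] Wd k σ := lin fun l => (ABl P x k l).2

@[simp] lemma opA_nil : opA P x (single [] (1 : k)) = single [] 1 := by simp [opA, ABl]
@[simp] lemma opB_nil : opB P x (single [] (1 : k)) = 0 := by simp [opB, ABl]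

@[simp] lemma opB_cs (c : Let σ) (v : Wd k σ) : opB P x (cs c v) =
    (-Let.sg k c) • cs c (opB P x v) + csO (Let.inc P c) (opA P x v) := by
  have := word_ext (f := opB P x ∘ₗ cs c)
    (g := (-Let.sg k c) • (cs c ∘ₗ opB P x) + csO (Let.inc P c) ∘ₗ opA P x) (fun l => by
      rw [LinearMap.comp_apply, cs_single, LinearMap.add_apply, LinearMap.smul_apply,
        LinearMap.comp_apply, LinearMap.comp_apply, opB, opA, lin_single, lin_single, lin_single,
        ABl]) v
  simpa only [LinearMap.comp_apply, LinearMap.add_apply, LinearMap.smul_apply] using this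

lemma opA_cs (c : Let σ) (v : Wd k σ) : opA P x (cs c v) =
    cs c (opA P x v) - cs (.s x) (opB P x (cs c v)) := by
  have := word_ext (f := opA P x ∘ₗ cs c)
    (g := cs c ∘ₗ opA P x - cs (.s x) ∘ₗ opB P x ∘ₗ cs c) (fun l => by
      simp only [LinearMap.comp_apply, LinearMap.sub_apply, cs_single]
      simp only [opB, opA, lin_single, ABl]) v
  simpa only [LinearMap.comp_apply, LinearMap.sub_apply] using this

variable {P x}

lemma opB_ml (hx : P.Mult x) (c : Let σ) (v : Wd k σ) : opB P x (ml P c v) =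
    Let.sg k c • ml P c (opB P x v) + mlO P (Let.inc P c) (opA P x v) +
      csO (Let.incX P x c) (opB P x v) := by
  refine word_ext (f := opB P x ∘ₗ ml P c) (g := Let.sg k c • (ml P c ∘ₗ opB P x) +
    mlO P (Let.inc P c) ∘ₗ opA P x + csO (Let.incX P x c) ∘ₗ opB P x) (fun l => ?_) v
  simp only [LinearMap.comp_apply, LinearMap.add_apply, LinearMap.smul_apply]
  cases l with
  | nil => cases Let.inc P c <;> simp
  | cons d w =>
    rw [← cs_single]
    have e : ∀ u : Wd k σ, mlO P (Let.inc P c) (cs (.s x) u) = csO (Let.incX P x c) u := fun u => by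
      rw [← Let.inc_bind hx c]
      cases Let.inc P c with
      | none => simp
      | some c' => simp [Let.mul_s_comm P c' x]
    have e' : ∀ u : Wd k σ, mlO P (Let.inc P c) (cs d u) =
        csO ((Let.inc P c).bind fun c' => Let.mul P c' d) u := fun u => by
      cases Let.inc P c <;> simp
    rw [opA_cs, map_sub, e, add_assoc, sub_add_cancel, opB_cs, map_add,
      map_smul, ml_csO, smul_add, e', add_assoc, ← Let.inc_mul hx, ml_cs, ml_cs]
    cases h : Let.mul P c d with
    | none => simp
    | some c' => simp [Let.sg_mul P k h, smul_smul]

lemma opA_ml (c : Let σ) (v : Wd k σ) : opA P x (ml P c v) =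
    ml P c (opA P x v) + ml P c (cs (.s x) (opB P x v)) - cs (.s x) (opB P x (ml P c v)) := by
  refine word_ext (f := opA P x ∘ₗ ml P c) (g := ml P c ∘ₗ opA P x +
    ml P c ∘ₗ cs (.s x) ∘ₗ opB P x - cs (.s x) ∘ₗ opB P x ∘ₗ ml P c) (fun l => ?_) v
  simp only [LinearMap.comp_apply, LinearMap.add_apply, LinearMap.sub_apply]
  cases l with
  | nil => simp
  | cons d w =>
    rw [← cs_single, opA_cs, map_sub, sub_add_cancel, ml_cs, ml_cs]
    cases h : Let.mul P c d with
    | none => simp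
    | some c' => rw [csO_some, opA_cs]

lemma opB_D_opA_D (hx : P.Mult x) (l : List (Let σ)) :
    De P (Let.incX P x) (opB P x (single l (1 : k))) = -opB P x (D P (single l 1)) ∧
    De P (Let.incX P x) (opA P x (single l (1 : k))) = opA P x (D P (single l 1)) := by
  induction l with
  | nil => simp
  | cons c w ih =>
    have hb : De P (Let.incX P x) (opB P x (cs c (single w (1 : k)))) =
        -opB P x (D P (cs c (single w 1))) := by
      rw [opB_cs, D_cs, map_smul, map_sub, opB_cs, opB_ml hx, map_add, map_smul, De_cs, ih.1]
      cases c with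
      | s β =>
        simp [Let.sg, Let.inc, Let.incX]
        abel
      | h a =>
        by_cases ha : a ∈ P.F
        · simp [Let.sg, Let.inc, Let.incX, ha, ih.2]
          abel
        · simp [Let.sg, Let.inc, Let.incX, ha]
    rw [← cs_single]
    refine ⟨hb, ?_⟩
    rw [opA_cs, D_cs, map_smul, map_sub, map_sub, opA_cs P x c (D P _), opA_ml, De_cs, De_cs,
      hb, ih.2, D_cs, opB_cs P x c (single w 1)]
    simp only [map_add, map_smul, map_sub, map_neg, ml_cs, ml_csO, Let.inc_bind hx, smul_sub,
      smul_add, Let.mul_s_comm P c x]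
    simp [Let.sg, Let.incX]
    abel

end Twist

end MonomialRings

namespace MonomialRings

open Finsupp hiding some

section TwistedComplex

variable {k : Type*} [Field k] {σ : Type*} {P : Par σ} {x : Mon σ}

/-- The number of module letters. -/
def hats : List (Let σ) → ℕ
  | [] => 0
  | .s _ :: w => hats w
  | .h _ :: w => hats w + 1

variable [Finite σ]

/-- The degree shift appearing in the twisted bar complex. -/
def sh2 (x : Mon σ) : Dg σ := zz + zz + ex x

@[simp] lemma sh2_none (x : Mon σ) : sh2 x none = 2 := by simp [sh2, zz]

lemma chi_sh2 (x : Mon σ) : Cx.chi k (sh2 x) = 1 := by simp [Cx.chi]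

lemma ldeg_incX {a : Mon σ} : ldeg (sh2 x) (.s (x + a)) + zz = ldeg (sh2 x) (.h a) := by
  simp only [ldeg, sh2, ex_add]
  abel

omit [Finite σ] in
lemma Let.Good.incX (hx : P.Mult x) {a : Mon σ} (ha : a ∈ P.F) : Let.Good P (.s (x + a)) :=
  ⟨fun h => hx.ne (add_eq_zero.1 h).1, hx.ann a ha⟩

lemma De_mem (hx : P.Mult x) (l : List (Let σ)) (hl : ∀ c ∈ l, Let.Good P c) :
    De P (Let.incX P x) (single l (1 : k)) ∈ supported k k
      {l' | (∀ c ∈ l', Let.Good P c) ∧ wdeg (sh2 x) l' + zz = wdeg (sh2 x) l} := by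
  induction l with
  | nil => simp
  | cons c w ih =>
    have hl' := hl
    simp only [List.mem_cons, forall_eq_or_imp] at hl
    rw [← cs_single, De_cs]
    refine Submodule.add_mem _ (Submodule.smul_mem _ _ (Submodule.sub_mem _ ?_ ?_)) ?_
    · refine supported_mono ?_ (ml_mem_step P c w)
      exact fun l' h => ⟨Step.good P h hl', Step.deg P _ h⟩
    · refine cs_mem (fun l' h => ?_) (ih hl.2)
      refine ⟨fun d hd => ?_, ?_⟩
      · rcases List.mem_cons.1 hd with rfl | hd
        · exact hl.1
        · exact h.1 d hd
      · rw [wdeg_cons, wdeg_cons, add_assoc, h.2]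
    · cases c with
      | s β => exact Submodule.zero_mem _
      | h a =>
        simp only [Let.incX, if_pos (show a ∈ P.F from hl.1), csO_some, cs_single]
        refine single_mem_supported _ _ ⟨fun d hd => ?_, ?_⟩
        · rcases List.mem_cons.1 hd with rfl | hd
          · exact Let.Good.incX hx hl.1
          · exact hl.2 d hd
        · rw [wdeg_cons, wdeg_cons, ← ldeg_incX]
          abel

variable (k) in
/-- The twisted bar complex of the trivial extension. -/
def cxT (hx : P.Mult x) : Cx k σ (List (Let σ)) where
  ok := {l | ∀ c ∈ l, Let.Good P c}
  deg := wdeg (sh2 x)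
  d := De P (Let.incX P x)
  d_mem l hl := De_mem hx l hl
  dd _ _ := De_De hx _

lemma ABl_mem (hx : P.Mult x) (l : List (Let σ)) (hl : ∀ c ∈ l, Let.Good P c) :
    opB P x (single l (1 : k)) ∈ supported k k {l' | ((∀ c ∈ l', Let.Good P c) ∧
      wdeg (sh2 x) l' + (ex x + zz) = wdeg (sh2 x) l) ∧ hats l' < hats l} ∧
    opA P x (single l (1 : k)) - single l 1 ∈ supported k k {l' | ((∀ c ∈ l', Let.Good P c) ∧
      wdeg (sh2 x) l' = wdeg (sh2 x) l) ∧ hats l' < hats l} := by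
  induction l with
  | nil => simp
  | cons c w ih =>
    simp only [List.mem_cons, forall_eq_or_imp] at hl
    obtain ⟨ih1, ih2⟩ := ih hl.2
    have hb : opB P x (single (c :: w) (1 : k)) ∈ supported k k {l' | ((∀ c ∈ l', Let.Good P c) ∧
        wdeg (sh2 x) l' + (ex x + zz) = wdeg (sh2 x) (c :: w)) ∧ hats l' < hats (c :: w)} := by
      rw [← cs_single, opB_cs]
      refine Submodule.add_mem _ (Submodule.smul_mem _ _ ?_) ?_
      · refine cs_mem ?_ ih1
        intro l' h
        refine ⟨⟨?_, ?_⟩, ?_⟩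
        · exact List.forall_mem_cons.2 ⟨hl.1, h.1.1⟩
        · rw [wdeg_cons, wdeg_cons, add_assoc, h.1.2]
        · cases c
          · exact h.2
          · exact Nat.succ_lt_succ h.2
      · cases c with
        | s β => exact Submodule.zero_mem _
        | h a =>
          have h3 : opA P x (single w (1 : k)) ∈ supported k k {l' | ((∀ c ∈ l', Let.Good P c) ∧
              wdeg (sh2 x) l' = wdeg (sh2 x) w) ∧ hats l' ≤ hats w} := by
            rw [← sub_add_cancel (opA P x (single w (1 : k))) (single w 1)]
            refine Submodule.add_mem _ (supported_mono ?_ ih2)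
              (single_mem_supported _ _ ⟨⟨hl.2, rfl⟩, le_rfl⟩)
            exact fun l' h => ⟨h.1, h.2.le⟩
          simp only [Let.inc, if_pos (show a ∈ P.F from hl.1), csO_some]
          refine cs_mem ?_ h3
          intro l' h
          refine ⟨⟨?_, ?_⟩, Nat.lt_succ_of_le h.2⟩
          · exact List.forall_mem_cons.2 ⟨⟨hx.ne_zero a hl.1, P.disj a hl.1⟩, h.1.1⟩
          · rw [wdeg_cons, wdeg_cons, h.1.2]
            simp only [ldeg, sh2]
            abel
    refine ⟨hb, ?_⟩
    rw [← cs_single, opA_cs, sub_right_comm, ← map_sub]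
    refine Submodule.sub_mem _ ?_ ?_
    · refine cs_mem ?_ ih2
      intro l' h
      refine ⟨⟨?_, ?_⟩, ?_⟩
      · exact List.forall_mem_cons.2 ⟨hl.1, h.1.1⟩
      · rw [wdeg_cons, wdeg_cons, h.1.2]
      · cases c
        · exact h.2
        · exact Nat.succ_lt_succ h.2
    · rw [cs_single]
      refine cs_mem ?_ hb
      intro l' h
      refine ⟨⟨?_, ?_⟩, h.2⟩
      · exact List.forall_mem_cons.2 ⟨⟨hx.ne, hx.notMem⟩, h.1.1⟩
      · rw [wdeg_cons, ← h.1.2, ldeg]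
        abel

lemma cxT_hdim (hx : P.Mult x) (δ : Dg σ) :
    (cxAll k P (sh2 x)).hdim δ = (cxT k hx).hdim δ := by
  refine Cx.hdim_eq_of_triangular (C := cxAll k P (sh2 x)) (C' := cxT k hx) (opA P x) id hats
    (fun l hl => ?_) (fun l hl => ?_)
    (Set.bijOn_id _) (fun l hl => rfl) (fun l hl => ?_) δ
  · rw [← sub_add_cancel (opA P x (single l (1 : k))) (single l 1)]
    refine Submodule.add_mem _ (supported_mono ?_ (ABl_mem hx l hl).2)
      (single_mem_supported k _ ⟨hl, rfl⟩)
    exact fun l' h => h.1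
  · exact (opB_D_opA_D (k := k) hx l).2.symm
  · refine supported_mono ?_ (ABl_mem hx l hl).2
    exact fun l' h => h.2

end TwistedComplex

end MonomialRings

namespace MonomialRings

open Finsupp hiding some

section WordRec

variable {k : Type*} [Field k] {σ : Type*} (n0 : Wd k σ) (A B : Let σ → Wd k σ →ₗ[k] Wd k σ)

/-- Auxiliary recursion defining a linear map on words. -/
def wrecAux : List (Let σ) → Wd k σ
  | [] => n0
  | c :: w => A c (wrecAux w) + B c (single w 1)

/-- The linear map on words defined by recursion. -/
def wrec : Wd k σ →ₗ[k] Wd k σ := lin (wrecAux n0 A B)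

@[simp] lemma wrec_nil : wrec n0 A B (single [] (1 : k)) = n0 := by simp [wrec, wrecAux]

@[simp] lemma wrec_cs (c : Let σ) (v : Wd k σ) :
    wrec n0 A B (cs c v) = A c (wrec n0 A B v) + B c v := by
  have := word_ext (f := wrec n0 A B ∘ₗ cs c) (g := A c ∘ₗ wrec n0 A B + B c) (fun l => by
    rw [LinearMap.comp_apply, cs_single, wrec, lin_single, wrecAux, LinearMap.add_apply,
      LinearMap.comp_apply, lin_single]) v
  simpa only [LinearMap.comp_apply, LinearMap.add_apply] using this

end WordRec

section Golod

variable {k : Type*} [Field k] {σ : Type*} {P : Par σ} {x : Mon σ}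

/-- The monomial ideal enlarged by the image of the module under multiplication by `x`. -/
def Par.Mult.quo (hx : P.Mult x) : Par σ where
  J := P.J ∪ (x + ·) '' P.F
  F := ∅
  up := by
    rintro β (h | ⟨a, ha, rfl⟩) γ
    · exact Or.inl (P.up β h γ)
    · by_cases h : γ + a ∈ P.J
      · left
        have e : x + a + γ = γ + a + x := by abel
        exact e ▸ P.up _ h x
      · exact Or.inr ⟨γ + a, hx.ideal a ha γ h, by simp only; abel⟩
  disj := by simp
  conv := by simp

variable (hx : P.Mult x)
include hx

lemma Par.Mult.mem_quo_add {a : Mon σ} (ha : a ∈ P.F) (β : Mon σ) : β + (x + a) ∈ hx.quo.J := by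
  rw [add_comm]
  exact hx.quo.up _ (Or.inr ⟨a, ha, rfl⟩) β

lemma Par.Mult.quo_cases {β : Mon σ} (h : β ∈ hx.quo.J) (hJ : β ∉ P.J) :
    ∃ a ∈ P.F, x + a = β := h.resolve_left hJ

/-- A letter which survives in the quotient. -/
def Par.Mult.gd : Let σ → Prop
  | .s β => β ∉ hx.quo.J
  | .h _ => False

variable (k) in
/-- The projection to the bar complex of the quotient. -/
def Par.Mult.pr : Wd k σ →ₗ[k] Wd k σ :=
  wrec (single [] 1) (fun c => if hx.gd c then cs c else 0) 0

variable (k) in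
/-- The homotopy for the projection to the bar complex of the quotient. -/
def Par.Mult.ho : Wd k σ →ₗ[k] Wd k σ :=
  wrec 0 (fun c => if hx.gd c then (-1 : k) • cs c else 0) (fun c => match c with
    | .s β => if β ∈ hx.quo.J then cs (.h (β - x)) else 0
    | .h _ => 0)

/-- The position of the first letter which does not survive in the quotient. -/
def Par.Mult.pos : List (Let σ) → ℕ
  | [] => 0
  | c :: w => if hx.gd c then Par.Mult.pos w + 1 else 0

@[simp] lemma Par.Mult.pr_nil : hx.pr k (single [] 1) = single [] 1 := wrec_nil ..

lemma Par.Mult.pr_cs (c : Let σ) (v : Wd k σ) :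
    hx.pr k (cs c v) = if hx.gd c then cs c (hx.pr k v) else 0 := by
  rw [Par.Mult.pr, wrec_cs]
  split_ifs <;> simp

lemma Par.Mult.pr_good {β : Mon σ} (h : β ∉ hx.quo.J) (v : Wd k σ) :
    hx.pr k (cs (.s β) v) = cs (.s β) (hx.pr k v) := by
  rw [hx.pr_cs, if_pos]; exact h

lemma Par.Mult.pr_bad {β : Mon σ} (h : β ∈ hx.quo.J) (v : Wd k σ) :
    hx.pr k (cs (.s β) v) = 0 := by
  rw [hx.pr_cs, if_neg]; exact not_not.2 h

lemma Par.Mult.pr_hat (a : Mon σ) (v : Wd k σ) : hx.pr k (cs (.h a) v) = 0 := by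
  rw [hx.pr_cs, if_neg]; exact id

@[simp] lemma Par.Mult.ho_nil : hx.ho k (single [] 1) = 0 := wrec_nil ..

lemma Par.Mult.ho_good {β : Mon σ} (h : β ∉ hx.quo.J) (v : Wd k σ) :
    hx.ho k (cs (.s β) v) = -cs (.s β) (hx.ho k v) := by
  simp [Par.Mult.ho, Par.Mult.gd, h]

lemma Par.Mult.ho_bad {a : Mon σ} (h : a ∈ P.F) (v : Wd k σ) :
    hx.ho k (cs (.s (x + a)) v) = cs (.h a) v := by
  have : x + a ∈ hx.quo.J := Or.inr ⟨a, h, rfl⟩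
  simp [Par.Mult.ho, Par.Mult.gd, this]

lemma Par.Mult.ho_hat (a : Mon σ) (v : Wd k σ) : hx.ho k (cs (.h a) v) = 0 := by
  simp [Par.Mult.ho, Par.Mult.gd]

/-- The three kinds of admissible letters. -/
lemma Par.Mult.letter_cases {c : Let σ} (hc : Let.Good P c) :
    (∃ β, c = .s β ∧ β ∉ hx.quo.J) ∨ (∃ a ∈ P.F, c = .s (x + a)) ∨ ∃ a ∈ P.F, c = .h a := by
  cases c with
  | s β =>
    by_cases h : β ∈ hx.quo.J
    · obtain ⟨a, ha, rfl⟩ := hx.quo_cases h hc.2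
      exact Or.inr (Or.inl ⟨a, ha, rfl⟩)
    · exact Or.inl ⟨β, rfl, h⟩
  | h a => exact Or.inr (Or.inr ⟨a, hc, rfl⟩)

lemma Par.Mult.pr_ml (β : Mon σ) (l : List (Let σ)) (hl : ∀ c ∈ l, Let.Good P c) :
    hx.pr k (ml P (.s β) (single l 1)) = if β ∈ hx.quo.J then 0 else
      ml hx.quo (.s β) (hx.pr k (single l (1 : k))) := by
  have hup : ∀ γ, β + γ ∉ hx.quo.J → β ∉ hx.quo.J := fun γ h h' => h (hx.quo.up _ h' γ)
  cases l with
  | nil => simp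
  | cons c w =>
    rw [← cs_single, ml_cs]
    simp only [List.mem_cons, forall_eq_or_imp] at hl
    rcases hx.letter_cases hl.1 with ⟨γ, rfl, hγ⟩ | ⟨a, ha, rfl⟩ | ⟨a, ha, rfl⟩
    · rw [hx.pr_good hγ, ml_cs]
      by_cases h : β + γ ∈ hx.quo.J
      · have h1 : (csO (Let.mul hx.quo (.s β) (.s γ)) (hx.pr k (single w 1))) = 0 := by
          simp [Let.mul, h]
        rw [h1, ite_self]
        by_cases h' : β + γ ∈ P.J
        · simp [Let.mul, h']
        · simp only [Let.mul, if_neg h', csO_some]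
          exact hx.pr_bad h _
      · have h' : β + γ ∉ P.J := fun h' => h (Or.inl h')
        rw [if_neg (hup _ h)]
        simp [Let.mul, h, h', hx.pr_good h]
    · rw [hx.pr_bad (Or.inr ⟨a, ha, rfl⟩), map_zero, ite_self]
      by_cases h' : β + (x + a) ∈ P.J
      · simp [Let.mul, h']
      · simp only [Let.mul, if_neg h', csO_some]
        exact hx.pr_bad (hx.mem_quo_add ha β) _
    · rw [hx.pr_hat, map_zero, ite_self]
      simp only [Let.mul]
      split_ifs
      · exact hx.pr_hat _ _
      · simp

lemma Par.Mult.pr_d (l : List (Let σ)) (hl : ∀ c ∈ l, Let.Good P c) :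
    hx.pr k (De P (Let.incX P x) (single l 1)) = D hx.quo (hx.pr k (single l (1 : k))) := by
  induction l with
  | nil => simp
  | cons c w ih =>
    have ih := ih fun c hc => hl c (List.mem_cons_of_mem _ hc)
    simp only [List.mem_cons, forall_eq_or_imp] at hl
    rw [← cs_single, De_cs]
    rcases hx.letter_cases hl.1 with ⟨γ, rfl, hγ⟩ | ⟨a, ha, rfl⟩ | ⟨a, ha, rfl⟩
    · simp only [Let.sg, one_smul, map_sub, hx.pr_good hγ, Let.incX, csO_none,
        LinearMap.zero_apply, add_zero, ih, D_cs]
      rw [hx.pr_ml _ _ hl.2, if_neg hγ]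
    · have h : x + a ∈ hx.quo.J := Or.inr ⟨a, ha, rfl⟩
      simp only [Let.sg, one_smul, map_sub, hx.pr_bad h, Let.incX, csO_none,
        LinearMap.zero_apply, map_zero, add_zero, sub_zero]
      rw [hx.pr_ml _ _ hl.2, if_pos h]
    · have h : x + a ∈ hx.quo.J := Or.inr ⟨a, ha, rfl⟩
      simp only [Let.sg, map_add, map_sub, map_smul, hx.pr_hat, Let.incX, if_pos ha, csO_some,
        hx.pr_bad h, map_zero, add_zero, sub_zero]
      cases w with
      | nil => simp
      | cons d w =>
        rw [← cs_single, ml_cs]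
        cases d with
        | s β =>
          simp only [Let.mul]
          split_ifs
          · simp [hx.pr_hat]
          · simp
        | h b => simp [Let.mul]

lemma Par.Mult.ho_ml_hat (a : Mon σ) (v : Wd k σ) : hx.ho k (ml P (.h a) v) = 0 := by
  refine word_ext (f := hx.ho k ∘ₗ ml P (.h a)) (g := 0) (fun l => ?_) v
  cases l with
  | nil => simp
  | cons d w =>
    rw [← cs_single, LinearMap.comp_apply, ml_cs]
    cases d with
    | s β =>
      simp only [Let.mul]
      split_ifs
      · simp [hx.ho_hat]
      · simp
    | h b => simp [Let.mul]

/-- The homotopy commutes with multiplication by a letter of the submodule. -/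
lemma Par.Mult.ho_ml_bad {a : Mon σ} (ha : a ∈ P.F) (v : Wd k σ) :
    hx.ho k (ml P (.s (x + a)) v) = ml P (.h a) v := by
  refine word_ext (f := hx.ho k ∘ₗ ml P (.s (x + a))) (g := ml P (.h a)) (fun l => ?_) v
  cases l with
  | nil => simp
  | cons d w =>
    rw [← cs_single, LinearMap.comp_apply, ml_cs, ml_cs]
    cases d with
    | s β =>
      have e : x + a + β = β + (x + a) := add_comm _ _
      have e' : β + (x + a) = x + (β + a) := by abel
      by_cases h : β + a ∈ P.J
      · have : β + (x + a) ∈ P.J := (hx.add_mem_iff ha β).2 h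
        have h' : β + a ∉ P.F := fun h' => P.disj _ h' h
        simp [Let.mul, e, this, h']
      · have h1 : β + (x + a) ∉ P.J := fun h' => h ((hx.add_mem_iff ha β).1 h')
        have h' : β + a ∈ P.F := hx.ideal a ha β h
        simp only [Let.mul, e, if_neg h1, csO_some, ha, h', and_self, if_true]
        rw [e', hx.ho_bad h']
    | h b =>
      simp only [Let.mul]
      split_ifs
      · simp [hx.ho_hat]
      · simp

lemma Par.Mult.ho_ml_good (β : Mon σ) (l : List (Let σ))
    (hl : ∀ c ∈ l, Let.Good P c) :
    hx.ho k (ml P (.s β) (single l 1)) - ml P (.s β) (hx.ho k (single l (1 : k))) ∈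
      supported k k {l' | hx.pos l' = 0} := by
  cases l with
  | nil => simp
  | cons c w =>
    rw [← cs_single]
    simp only [List.mem_cons, forall_eq_or_imp] at hl
    rcases hx.letter_cases hl.1 with ⟨γ, rfl, hγ⟩ | ⟨a, ha, rfl⟩ | ⟨a, ha, rfl⟩
    · rw [hx.ho_good hγ, map_neg, ml_cs, ml_cs]
      by_cases h : β + γ ∈ P.J
      · simp [Let.mul, h]
      · simp only [Let.mul, if_neg h, csO_some]
        by_cases h' : β + γ ∈ hx.quo.J
        · obtain ⟨a, ha, e⟩ := hx.quo_cases h' h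
          rw [← e, hx.ho_bad ha]
          refine Submodule.sub_mem _ ?_ (Submodule.neg_mem _ ?_)
          · refine cs_mem (s := Set.univ) ?_ (by simp)
            intro l' _
            simp [Par.Mult.pos, Par.Mult.gd]
          · refine cs_mem (s := Set.univ) ?_ (by simp)
            intro l' _
            simp [Par.Mult.pos, Par.Mult.gd, e, h']
        · rw [hx.ho_good h', sub_self]
          exact Submodule.zero_mem _
    · convert Submodule.zero_mem _
      rw [hx.ho_bad ha, ml_cs, ml_cs]
      by_cases h : β + a ∈ P.J
      · have : β + (x + a) ∈ P.J := (hx.add_mem_iff ha β).2 h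
        have h' : β + a ∉ P.F := fun h' => P.disj _ h' h
        simp [Let.mul, this, h']
      · have h1 : β + (x + a) ∉ P.J := fun h' => h ((hx.add_mem_iff ha β).1 h')
        have h' : β + a ∈ P.F := hx.ideal a ha β h
        simp only [Let.mul, if_neg h1, csO_some, ha, h', and_self, if_true]
        rw [add_left_comm, hx.ho_bad h', sub_self]
    · convert Submodule.zero_mem _
      rw [hx.ho_hat, ml_cs]
      simp only [Let.mul]
      split_ifs
      · simp [hx.ho_hat]
      · simp

lemma Par.Mult.ho_lower (l : List (Let σ)) (hl : ∀ c ∈ l, Let.Good P c) :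
    single l 1 - (De P (Let.incX P x) (hx.ho k (single l 1)) +
      hx.ho k (De P (Let.incX P x) (single l 1)) + hx.pr k (single l (1 : k))) ∈
      supported k k {l' | hx.pos l' < hx.pos l} := by
  induction l with
  | nil => simp
  | cons c w ih =>
    have ih := ih fun c hc => hl c (List.mem_cons_of_mem _ hc)
    simp only [List.mem_cons, forall_eq_or_imp] at hl
    rw [← cs_single]
    rcases hx.letter_cases hl.1 with ⟨γ, rfl, hγ⟩ | ⟨a, ha, rfl⟩ | ⟨a, ha, rfl⟩
    · have e : cs (.s γ) (single w 1) - (De P (Let.incX P x) (hx.ho k (cs (.s γ) (single w 1))) +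
          hx.ho k (De P (Let.incX P x) (cs (.s γ) (single w 1))) +
            hx.pr k (cs (.s γ) (single w (1 : k)))) =
          cs (.s γ) (single w 1 - (De P (Let.incX P x) (hx.ho k (single w 1)) +
          hx.ho k (De P (Let.incX P x) (single w 1)) + hx.pr k (single w (1 : k)))) -
          (hx.ho k (ml P (.s γ) (single w 1)) - ml P (.s γ) (hx.ho k (single w (1 : k)))) := by
        simp only [De_cs, hx.ho_good hγ, hx.pr_good hγ, map_neg, map_add, map_sub, Let.sg,
          one_smul, Let.incX, csO_none, LinearMap.zero_apply, add_zero]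
        abel
      rw [e]
      refine Submodule.sub_mem _ (cs_mem ?_ ih) (supported_mono ?_ (hx.ho_ml_good γ w hl.2))
      · intro l' h
        have : hx.gd (.s γ) := hγ
        simpa [Par.Mult.pos, this] using h
      · intro l' h
        have : hx.gd (.s γ) := hγ
        rw [Set.mem_ofPred_eq] at h ⊢
        simp [Par.Mult.pos, this, h]
    · convert Submodule.zero_mem _
      have h : x + a ∈ hx.quo.J := Or.inr ⟨a, ha, rfl⟩
      simp only [De_cs, hx.ho_bad ha, hx.pr_bad h, map_sub, Let.sg, one_smul, Let.incX,
        csO_none, LinearMap.zero_apply, add_zero, hx.ho_ml_bad ha, if_pos ha, csO_some,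
        neg_smul]
      abel
    · convert Submodule.zero_mem _
      simp only [De_cs, hx.ho_hat, hx.pr_hat, map_add, map_sub, map_neg, Let.sg, one_smul, Let.incX,
        map_zero, add_zero, hx.ho_ml_hat, if_pos ha, csO_some, hx.ho_bad ha, neg_smul,
        neg_zero, zero_add, sub_self]

variable [Finite σ]

variable (k) in
/-- The twisted bar complex is quasi-isomorphic to the bar complex of the quotient. -/
def Par.Mult.qi : Cx.QI (cxT k hx) (cxS k hx.quo (sh2 x)) where
  f := hx.pr k
  sec := LinearMap.id
  h := hx.ho k
  μ := hx.pos
  f_mem l hl := by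
    change ∀ c ∈ l, Let.Good P c at hl
    induction l with
    | nil =>
      rw [hx.pr_nil]
      exact single_mem_supported k _ ⟨⟨by simp, by simp⟩, rfl⟩
    | cons c w ih =>
      simp only [List.mem_cons, forall_eq_or_imp] at hl
      rw [← cs_single, hx.pr_cs]
      split_ifs with h
      · refine cs_mem ?_ (ih hl.2)
        intro l' hl'
        obtain ⟨⟨h1, h2⟩, h3⟩ := hl'
        change wdeg (sh2 x) l' = wdeg (sh2 x) w at h3
        cases c with
        | s β =>
          refine ⟨⟨List.forall_mem_cons.2 ⟨⟨hl.1.1, h⟩, h1⟩, by simpa using h2⟩, ?_⟩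
          change wdeg (sh2 x) _ = wdeg (sh2 x) _
          rw [wdeg_cons, wdeg_cons, h3]
        | h a => exact h.elim
      · exact Submodule.zero_mem _
  f_d l hl := hx.pr_d l hl
  sec_mem l hl := by
    refine single_mem_supported k _ ⟨fun c hc => ?_, rfl⟩
    have := hl.1 c hc
    cases c with
    | s β => exact ⟨this.1, fun h => this.2 (Or.inl h)⟩
    | h a => exact absurd ⟨a, hc⟩ hl.2
  f_sec l hl := by
    change hx.pr k (single l 1) = _
    induction l with
    | nil => simp
    | cons c w ih =>
      have h1 := hl.1 c (by simp)
      cases c with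
      | s β =>
        rw [← cs_single, hx.pr_good h1.2, ih]
        exact ⟨fun c hc => hl.1 c (List.mem_cons_of_mem _ hc),
          fun ⟨a, ha⟩ => hl.2 ⟨a, List.mem_cons_of_mem _ ha⟩⟩
      | h a => exact absurd ⟨a, by simp⟩ hl.2
  h_mem l hl := by
    change ∀ c ∈ l, Let.Good P c at hl
    induction l with
    | nil => simp
    | cons c w ih =>
      simp only [List.mem_cons, forall_eq_or_imp] at hl
      rw [← cs_single]
      rcases hx.letter_cases hl.1 with ⟨γ, rfl, hγ⟩ | ⟨a, ha, rfl⟩ | ⟨a, ha, rfl⟩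
      · rw [hx.ho_good hγ]
        refine Submodule.neg_mem _ (cs_mem ?_ (ih hl.2))
        intro l' h
        refine ⟨List.forall_mem_cons.2 ⟨hl.1, h.1⟩, ?_⟩
        have := h.2
        change wdeg (sh2 x) l' = wdeg (sh2 x) w + zz at this
        change wdeg (sh2 x) _ = wdeg (sh2 x) _ + zz
        rw [wdeg_cons, wdeg_cons, this, add_assoc]
      · rw [hx.ho_bad ha, cs_single]
        refine single_mem_supported k _ ⟨List.forall_mem_cons.2 ⟨ha, hl.2⟩, ?_⟩
        change wdeg (sh2 x) _ = wdeg (sh2 x) _ + zz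
        rw [wdeg_cons, wdeg_cons, ← ldeg_incX]
        abel
      · rw [hx.ho_hat]
        exact Submodule.zero_mem _
  f_h l hl := by
    change ∀ c ∈ l, Let.Good P c at hl
    induction l with
    | nil => simp
    | cons c w ih =>
      simp only [List.mem_cons, forall_eq_or_imp] at hl
      rw [← cs_single]
      rcases hx.letter_cases hl.1 with ⟨γ, rfl, hγ⟩ | ⟨a, ha, rfl⟩ | ⟨a, ha, rfl⟩
      · rw [hx.ho_good hγ, map_neg, hx.pr_good hγ, ih hl.2, map_zero, neg_zero]
      · rw [hx.ho_bad ha, hx.pr_hat]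
      · rw [hx.ho_hat, map_zero]
  lower l hl := hx.ho_lower l hl

omit hx in
lemma cxZ_gr_add (e0 δ : Dg σ) : (cxZ k P e0).gr (δ + e0) = (cxZ k P 0).gr δ := by
  have : ∀ l : List (Let σ), Zok P l → wdeg e0 l = wdeg 0 l + e0 := by
    intro l hl
    induction l with
    | nil => exact hl.elim
    | cons c w ih =>
      cases c with
      | s β =>
        rw [wdeg_cons, wdeg_cons, ih hl.2, add_assoc]
        rfl
      | h a =>
        obtain ⟨-, rfl⟩ := hl
        simp [ldeg]
  refine congrArg (supported k k) (Set.ext fun l => and_congr_right fun hl => ?_)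
  change wdeg e0 l = _ ↔ wdeg 0 l = _
  rw [this l hl, add_left_inj]

omit hx in
lemma cxZ_hdim_add (e0 δ : Dg σ) : (cxZ k P e0).hdim (δ + e0) = (cxZ k P 0).hdim δ := by
  have h1 : (cxZ k P e0).Z (δ + e0) = (cxZ k P 0).Z δ := by
    rw [Cx.Z, Cx.Z, cxZ_gr_add]
    rfl
  have h2 : (cxZ k P e0).B (δ + e0) = (cxZ k P 0).B δ := by
    rw [Cx.B, Cx.B, add_right_comm, cxZ_gr_add]
    rfl
  rw [Cx.hdim, Cx.hdim, h1, h2]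

omit hx in
lemma cxZ_hdim_of_not_le {e0 δ : Dg σ} (h : ¬ e0 ≤ δ) : (cxZ k P e0).hdim δ = 0 := by
  have : ∀ l : List (Let σ), Zok P l → e0 ≤ wdeg e0 l := by
    intro l hl
    induction l with
    | nil => exact hl.elim
    | cons c w ih =>
      cases c with
      | s β => exact (ih hl.2).trans (by rw [wdeg_cons]; exact le_add_self)
      | h a => rw [wdeg_cons, ldeg, add_assoc]; exact le_add_left le_self_add
  refine Cx.Exact.hdim fun v hv _ => ⟨0, Submodule.zero_mem _, ?_⟩
  have hv' : (cxZ k P e0).gr δ ≤ supported k k ∅ :=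
    supported_mono fun l hl => h (hl.2 ▸ this l hl.1)
  have : v = 0 := by simpa using hv' hv
  simp [this]

omit hx in
variable (k) (P) in
/-- The Poincaré series of the module over the ring. -/
def tser : MvPowerSeries (Option σ) ℤ := (cxZ k P 0).series

omit hx in
lemma cxZ_series (e0 : Dg σ) :
    (cxZ k P e0).series = MvPowerSeries.monomial e0 1 * tser k P := by
  ext δ
  rw [MvPowerSeries.coeff_monomial_mul, Cx.coeff_series]
  split_ifs with h
  · obtain ⟨ε, rfl⟩ := exists_add_of_le h
    rw [add_tsub_cancel_left, add_comm, cxZ_hdim_add, tser, Cx.coeff_series, one_mul]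
  · rw [cxZ_hdim_of_not_le h, Nat.cast_zero]

/-- The Poincaré series of the ring in terms of the quotient and of the module. -/
theorem Par.Mult.golod : pser k P.J =
    pser k hx.quo.J * (1 - MvPowerSeries.monomial (sh2 x) 1 * tser k P) := by
  have h1 : (cxAll k P (sh2 x)).series = pser k hx.quo.J := by
    rw [← cxS_series hx.quo (sh2 x)]
    ext δ
    rw [Cx.coeff_series, Cx.coeff_series, cxT_hdim hx, (hx.qi k).hdim_eq]
  have h2 := cxAll_series (k := k) P (sh2 x) (chi_sh2 x) (by simp)
  rw [h1, cxS_series, cxZ_series] at h2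
  linear_combination -h2

end Golod

end MonomialRings

namespace MonomialRings

open Finsupp hiding some

section FreeVariable

variable {k : Type*} [Field k] {σ : Type*} {P : Par σ} {y : σ}

/-- A variable, as a monomial. -/
def va (y : σ) : Mon σ := Pi.single y 1

@[simp] lemma va_self (y : σ) : va y y = 1 := by simp [va]

lemma va_of_ne {i y : σ} (h : i ≠ y) : va y i = 0 := by simp [va, h]

lemma sub_va_add {β : Mon σ} (h : β y ≠ 0) : β - va y + va y = β := by
  refine tsub_add_cancel_of_le fun i => ?_
  by_cases hi : i = y
  · subst hi; simpa [Nat.one_le_iff_ne_zero] using h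
  · simp [va_of_ne hi]

/-- The variable `y` acts bijectively on the complement of the ideal and on the module. -/
structure Par.Free (P : Par σ) (y : σ) : Prop where
  J_iff : ∀ β, β + va y ∈ P.J ↔ β ∈ P.J
  F_iff : ∀ a, a + va y ∈ P.F ↔ a ∈ P.F

namespace Let

/-- The monomial of a letter. -/
def mon : Let σ → Mon σ
  | s β => β
  | h a => a

variable (y) in
/-- Dividing a letter by a variable. -/
def dn : Let σ → Let σ
  | s β => s (β - va y)
  | h a => h (a - va y)

@[simp] lemma mon_s (β : Mon σ) : (s β).mon = β := rfl
@[simp] lemma mon_h (a : Mon σ) : (h a).mon = a := rfl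

lemma sg_cases (c : Let σ) : sg k c = 1 ∨ sg k c = -1 := by cases c <;> simp [sg]

@[simp] lemma sg_dn (c : Let σ) : sg k (dn y c) = sg k c := by cases c <;> rfl

lemma mon_mul {c d e : Let σ} (h : mul P c d = some e) : e.mon = c.mon + d.mon := by
  cases c <;> cases d <;> simp only [mul] at h <;>
    first | cases h | (split_ifs at h; obtain rfl := Option.some.inj h; simp [mon, add_comm])

variable (hy : P.Free y)
include hy

lemma J_sub_iff {β : Mon σ} (h : β y ≠ 0) : β - va y ∈ P.J ↔ β ∈ P.J := by
  rw [← hy.J_iff, sub_va_add h]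

lemma F_sub_iff {β : Mon σ} (h : β y ≠ 0) : β - va y ∈ P.F ↔ β ∈ P.F := by
  rw [← hy.F_iff, sub_va_add h]

lemma mul_dn {c : Let σ} (hc : c.mon y ≠ 0) (d : Let σ) :
    mul P (dn y c) d = (mul P c d).map (dn y) := by
  have key : ∀ β γ : Mon σ, β y ≠ 0 → β - va y + γ = β + γ - va y := by
    intro β γ h
    have := sub_va_add h
    generalize β - va y = ε at *
    subst this
    rw [add_right_comm, add_tsub_cancel_right]
  have hne : ∀ β γ : Mon σ, β y ≠ 0 → (β + γ) y ≠ 0 := fun β γ h => by simp [h]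
  have key' : ∀ β γ : Mon σ, β y ≠ 0 → γ + (β - va y) = γ + β - va y := by
    intro β γ h
    rw [add_comm, key β γ h, add_comm]
  have hne' : ∀ β γ : Mon σ, β y ≠ 0 → (γ + β) y ≠ 0 := fun β γ h => by simp [h]
  cases c with
  | s β =>
    simp only [mon_s] at hc
    cases d with
    | s γ =>
      simp only [mul, dn, key _ γ hc, J_sub_iff hy (hne _ γ hc)]
      split_ifs <;> simp [dn]
    | h a =>
      simp only [mul, dn, key _ a hc, F_sub_iff hy (hne _ a hc)]
      split_ifs <;> simp [dn]
  | h a =>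
    simp only [mon_h] at hc
    cases d with
    | s γ =>
      simp only [mul, dn, key' _ γ hc, F_sub_iff hy (hne' _ γ hc), F_sub_iff hy hc]
      split_ifs <;> simp [dn]
    | h b => rfl

lemma mul_va_dn {c : Let σ} (hc : c.mon y ≠ 0) (hg : Good P c) :
    mul P (s (va y)) (dn y c) = some c := by
  cases c with
  | s β =>
    simp only [mon_s] at hc
    simp only [dn, mul]
    rw [add_comm, sub_va_add hc, if_neg hg.2]
  | h a =>
    simp only [mon_h] at hc
    simp only [dn, mul]
    rw [add_comm, sub_va_add hc, F_sub_iff hy hc, if_pos ⟨hg, hg⟩]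

lemma mul_va {c : Let σ} (hg : Good P c) :
    ∃ e, mul P (s (va y)) c = some e ∧ e.mon y ≠ 0 ∧ e ≠ s (va y) ∧ dn y e = c := by
  cases c with
  | s β =>
    refine ⟨s (va y + β), if_neg ?_, by simp, ?_, by simp [dn]⟩
    · rw [add_comm, hy.J_iff]
      exact hg.2
    · simpa using hg.1
  | h a =>
    refine ⟨h (va y + a), if_pos ⟨hg, ?_⟩, by simp, by simp, by simp [dn]⟩
    rw [add_comm, hy.F_iff]
    exact hg

end Let

/-- The projection to the empty word. -/
def nilp : Wd k σ →ₗ[k] Wd k σ := wrec (single [] 1) 0 0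

@[simp] lemma nilp_nil : nilp (single [] (1 : k)) = single ([] : List (Let σ)) 1 := wrec_nil ..

@[simp] lemma nilp_cs (c : Let σ) (v : Wd k σ) : nilp (cs c v) = 0 := by simp [nilp]

@[simp] lemma nilp_csO (o : Option (Let σ)) (v : Wd k σ) : nilp (csO o v) = 0 := by
  cases o <;> simp

lemma nilp_D (v : Wd k σ) : nilp (D P v) = 0 := by
  refine word_ext (f := nilp ∘ₗ D P) (g := 0) (fun l => ?_) v
  cases l with
  | nil => simp
  | cons c w =>
    rw [← cs_single]
    cases w with
    | nil => simp
    | cons d w => rw [← cs_single]; simp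

variable (k) (y) in
/-- The homotopy contracting away a free variable. -/
def vh : Wd k σ →ₗ[k] Wd k σ :=
  wrec 0 (fun c => if c.mon y = 0 then (-Let.sg k c) • cs c else 0) (fun c =>
    if c.mon y = 0 then 0 else if c = .s (va y) then 0 else cs (.s (va y)) ∘ₗ cs (.dn y c))

variable (k) (y) in
/-- The projection to words not involving a variable. -/
def v0 : Wd k σ →ₗ[k] Wd k σ :=
  wrec (single [] 1) (fun c => if c.mon y = 0 then cs c else 0) 0

variable (k) (y) in
/-- The projection to words involving a variable only through the last letter. -/
def v1 : Wd k σ →ₗ[k] Wd k σ :=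
  wrec 0 (fun c => if c.mon y = 0 then cs c else 0) fun c => if c = .s (va y) then nilp else 0

variable (y) in
/-- Appending a variable. -/
def apv : Wd k σ →ₗ[k] Wd k σ := wrec (single [.s (va y)] 1) cs 0

variable (y) in
/-- The position of the first letter involving a variable. -/
def vpos : List (Let σ) → ℕ
  | [] => 0
  | c :: w => if c.mon y = 0 then vpos w + 1 else 0

@[simp] lemma vh_nil : vh k y (single [] 1) = 0 := wrec_nil ..
@[simp] lemma v0_nil : v0 k y (single [] 1) = single [] 1 := wrec_nil ..
@[simp] lemma v1_nil : v1 k y (single [] 1) = 0 := wrec_nil ..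
@[simp] lemma apv_nil : apv y (single [] 1) = (single [.s (va y)] 1 : Wd k σ) := wrec_nil ..
@[simp] lemma apv_cs (c : Let σ) (v : Wd k σ) : apv y (cs c v) = cs c (apv y v) := by simp [apv]

section
variable {c : Let σ} (v : Wd k σ)

lemma vh_free (h : c.mon y = 0) : vh k y (cs c v) = -Let.sg k c • cs c (vh k y v) := by
  simp [vh, h]

lemma vh_va : vh k y (cs (.s (va y)) v) = 0 := by simp [vh]

lemma vh_div (h : c.mon y ≠ 0) (h' : c ≠ .s (va y)) :
    vh k y (cs c v) = cs (.s (va y)) (cs (.dn y c) v) := by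
  simp [vh, h, h']

lemma v0_free (h : c.mon y = 0) : v0 k y (cs c v) = cs c (v0 k y v) := by simp [v0, h]

lemma v0_div (h : c.mon y ≠ 0) : v0 k y (cs c v) = 0 := by simp [v0, h]

lemma v1_free (h : c.mon y = 0) : v1 k y (cs c v) = cs c (v1 k y v) := by
  have : c ≠ .s (va y) := by rintro rfl; simp at h
  simp [v1, h, this]

lemma v1_va : v1 k y (cs (.s (va y)) v) = nilp v := by simp [v1]

lemma v1_div (h : c.mon y ≠ 0) (h' : c ≠ .s (va y)) : v1 k y (cs c v) = 0 := by
  simp [v1, h, h']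

end

lemma cs_vpos {c : Let σ} (h : c.mon y ≠ 0) (v : Wd k σ) :
    cs c v ∈ supported k k {l | vpos y l = 0} := by
  refine cs_mem (s := Set.univ) ?_ (by simp)
  intro l _
  simp [vpos, h]

lemma vh_vpos {c : Let σ} (h : c.mon y ≠ 0) (v : Wd k σ) :
    vh k y (cs c v) ∈ supported k k {l | vpos y l = 0} := by
  by_cases h' : c = .s (va y)
  · rw [h', vh_va]
    exact Submodule.zero_mem _
  · rw [vh_div v h h']
    exact cs_vpos (by simp) _

lemma vh_ml_free {c : Let σ} (hc : c.mon y = 0) (l : List (Let σ)) :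
    Let.sg k c • vh k y (ml P c (single l 1)) - ml P c (vh k y (single l (1 : k))) ∈
      supported k k {l | vpos y l = 0} := by
  cases l with
  | nil => simp
  | cons d w =>
    rw [← cs_single, ml_cs]
    by_cases hd : d.mon y = 0
    · rw [vh_free _ hd, map_smul, ml_cs]
      convert Submodule.zero_mem _
      cases h : Let.mul P c d with
      | none => simp
      | some e =>
        have he : e.mon y = 0 := by rw [Let.mon_mul h]; simp [hc, hd]
        rw [csO_some, vh_free _ he, Let.sg_mul P k h, smul_smul, ← sub_smul]
        have : Let.sg k c * -(Let.sg k c * Let.sg k d) - -Let.sg k d = 0 := by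
          linear_combination (-Let.sg k d) * Let.sg_mul_self k c
        rw [this, zero_smul]
    · refine Submodule.sub_mem _ (Submodule.smul_mem _ _ ?_) ?_
      · cases h : Let.mul P c d with
        | none => simp
        | some e =>
          refine vh_vpos ?_ _
          rw [Let.mon_mul h]
          simp [hd]
      · by_cases h' : d = .s (va y)
        · rw [h', vh_va]
          simp
        · rw [vh_div _ hd h', ml_cs]
          cases h : Let.mul P c (.s (va y)) with
          | none => simp
          | some e =>
            refine cs_vpos ?_ _
            rw [Let.mon_mul h]
            simp

lemma vh_ml_div (hy : P.Free y) {c : Let σ} (hc : c.mon y ≠ 0) (hc' : c ≠ .s (va y))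
    (v : Wd k σ) : vh k y (ml P c v) = cs (.s (va y)) (ml P (.dn y c) v) := by
  refine word_ext (f := vh k y ∘ₗ ml P c) (g := cs (.s (va y)) ∘ₗ ml P (.dn y c)) (fun l => ?_) v
  cases l with
  | nil => simp
  | cons d w =>
    rw [← cs_single, LinearMap.comp_apply, LinearMap.comp_apply, ml_cs, ml_cs, Let.mul_dn hy hc]
    cases h : Let.mul P c d with
    | none => simp
    | some e =>
      have hm := Let.mon_mul h
      refine vh_div _ (by rw [hm]; simp [hc]) ?_
      rintro rfl
      cases c with
      | s β =>
        refine hc' ?_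
        rw [Let.mon_s, Let.mon_s] at hm
        have h1 := sub_va_add hc
        rw [Let.mon_s] at h1
        rw [← h1, add_right_comm, eq_comm, add_eq_right, add_eq_zero] at hm
        rw [← h1, hm.1, zero_add]
      | h a =>
        cases d <;> simp [Let.mul] at h

lemma vh_lower (hy : P.Free y) (l : List (Let σ)) (hl : ∀ c ∈ l, Let.Good P c) :
    single l 1 - (D P (vh k y (single l 1)) + vh k y (D P (single l 1)) +
      (v0 k y (single l 1) + apv y (v1 k y (single l (1 : k))))) ∈
      supported k k {l' | vpos y l' < vpos y l} := by
  induction l with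
  | nil => simp
  | cons c w ih =>
    have ih := ih fun c hc => hl c (List.mem_cons_of_mem _ hc)
    simp only [List.mem_cons, forall_eq_or_imp] at hl
    rw [← cs_single]
    by_cases hc : c.mon y = 0
    · have e : cs c (single w 1) - (D P (vh k y (cs c (single w 1))) +
          vh k y (D P (cs c (single w 1))) +
          (v0 k y (cs c (single w 1)) + apv y (v1 k y (cs c (single w (1 : k)))))) =
          cs c (single w 1 - (D P (vh k y (single w 1)) + vh k y (D P (single w 1)) +
            (v0 k y (single w 1) + apv y (v1 k y (single w (1 : k)))))) -
          (Let.sg k c • vh k y (ml P c (single w 1)) - ml P c (vh k y (single w (1 : k)))) := by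
        simp only [vh_free _ hc, v0_free _ hc, v1_free _ hc, D_cs, apv_cs, map_sub, map_smul,
          map_add]
        rcases Let.sg_cases (k := k) c with h | h <;> rw [h] <;> module
      rw [e]
      refine Submodule.sub_mem _ (cs_mem ?_ ih) (supported_mono ?_ (vh_ml_free hc w))
      · intro l' h
        simpa [vpos, hc] using h
      · intro l' h
        rw [Set.mem_ofPred_eq] at h ⊢
        simp [vpos, hc, h]
    · convert Submodule.zero_mem _
      by_cases hc' : c = .s (va y)
      · subst hc'
        rw [v0_div _ hc, v1_va, D_cs, vh_va]
        cases w with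
        | nil => simp
        | cons d w =>
          obtain ⟨e, he, he1, he2, he3⟩ := Let.mul_va hy (hl.2 d (by simp))
          rw [← cs_single, nilp_cs, ml_cs, he, csO_some, map_smul, map_sub, vh_va,
            vh_div _ he1 he2, he3]
          simp [Let.sg]
      · rw [v0_div _ hc, v1_div _ hc hc', D_cs, vh_div _ hc hc', map_smul, map_sub,
          vh_div _ hc hc', vh_ml_div hy hc hc', D_cs, D_cs, ml_cs, Let.mul_va_dn hy hc hl.1]
        have hs : Let.sg k (.s (va y)) = 1 := rfl
        simp only [hs, one_smul, csO_some, Let.sg_dn, map_smul, map_sub, map_zero]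
        rcases Let.sg_cases (k := k) c with h | h <;> rw [h] <;> module

lemma Zok.v1_eq_zero {l : List (Let σ)} (hl : Zok P l) : v1 k y (single l 1) = 0 := by
  induction l with
  | nil => exact hl.elim
  | cons c w ih =>
    rw [← cs_single]
    by_cases hc : c.mon y = 0
    · rw [v1_free _ hc]
      cases c with
      | s β => rw [ih hl.2, map_zero]
      | h a =>
        obtain ⟨-, rfl⟩ := hl
        simp
    · by_cases hc' : c = .s (va y)
      · subst hc'
        rw [v1_va]
        cases w with
        | nil => exact hl.2.elim
        | cons d w => rw [← cs_single, nilp_cs]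
      · rw [v1_div _ hc hc']

variable [Finite σ]

@[simp] lemma ex_va : ex (va y) = single (some y) 1 := by
  ext o
  cases o with
  | none => simp [ex, va]
  | some i =>
    by_cases h : i = y
    · subst h; simp [ex, va]
    · simp [ex, va_of_ne h, Ne.symm h]

lemma ldeg_some (c : Let σ) : ldeg 0 c (some y) = c.mon y := by
  cases c <;> simp [ldeg, zz]

lemma v0_eq_zero {l : List (Let σ)} (hl : wdeg 0 l (some y) ≠ 0) : v0 k y (single l 1) = 0 := by
  induction l with
  | nil => simp at hl
  | cons c w ih =>
    rw [← cs_single]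
    by_cases hc : c.mon y = 0
    · rw [wdeg_cons, Finsupp.add_apply, ldeg_some, hc, zero_add] at hl
      rw [v0_free _ hc, ih hl, map_zero]
    · rw [v0_div _ hc]

lemma wdeg_vh (hy : P.Free y) (l : List (Let σ)) (hl : ∀ c ∈ l, Let.Good P c) :
    vh k y (single l 1) ∈ supported k k {l' | ((∀ c ∈ l', Let.Good P c) ∧ (Zok P l → Zok P l')) ∧
      wdeg 0 l' = wdeg 0 l + zz} := by
  induction l with
  | nil => simp
  | cons c w ih =>
    have hg := hl
    have ih := ih fun c hc => hl c (List.mem_cons_of_mem _ hc)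
    simp only [List.mem_cons, forall_eq_or_imp] at hl
    rw [← cs_single]
    by_cases hc : c.mon y = 0
    · rw [vh_free _ hc]
      cases c with
      | s β =>
        refine Submodule.smul_mem _ _ (cs_mem ?_ ih)
        intro l' h
        refine ⟨⟨List.forall_mem_cons.2 ⟨hl.1, h.1.1⟩, fun hz => ⟨hz.1, h.1.2 hz.2⟩⟩, ?_⟩
        rw [wdeg_cons, wdeg_cons, h.2, add_assoc]
      | h a =>
        by_cases hz : Zok P (Let.h a :: w)
        · obtain ⟨-, rfl⟩ := hz
          simp
        · refine Submodule.smul_mem _ _ (cs_mem ?_ ih)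
          intro l' h
          refine ⟨⟨List.forall_mem_cons.2 ⟨hl.1, h.1.1⟩, fun hz' => absurd hz' hz⟩, ?_⟩
          rw [wdeg_cons, wdeg_cons, h.2, add_assoc]
    · by_cases hc' : c = .s (va y)
      · rw [hc', vh_va]
        exact Submodule.zero_mem _
      · have hne : va y ≠ 0 := fun h => by have := congrFun h y; simp at this
        have hv : Let.Good P (.s (va y)) ∧ Let.Good P (Let.dn y c) ∧
            (Zok P (c :: w) → Zok P (Let.dn y c :: w)) := by
          cases c with
          | s β =>
            have h1 : β - va y ≠ 0 := fun h => hc' (by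
              have := sub_va_add hc
              rw [Let.mon_s, h, zero_add] at this
              rw [this])
            have h2 : β - va y ∉ P.J := by
              rw [Let.J_sub_iff hy (show β y ≠ 0 from hc)]; exact hl.1.2
            have h3 : va y ∉ P.J := fun h => hl.1.2 (by
              have h4 := sub_va_add hc
              rw [Let.mon_s, add_comm] at h4
              rw [← h4]
              exact P.up _ h _)
            exact ⟨⟨hne, h3⟩, ⟨h1, h2⟩, fun hz => ⟨⟨h1, h2⟩, hz.2⟩⟩
          | h a =>
            have h2 : a - va y ∈ P.F := by
              rw [Let.F_sub_iff hy (show a y ≠ 0 from hc)]; exact hl.1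
            have h3 : va y ∉ P.J := fun h => P.disj _ hl.1 (by
              have h4 := sub_va_add hc
              rw [Let.mon_h, add_comm] at h4
              rw [← h4]
              exact P.up _ h _)
            exact ⟨⟨hne, h3⟩, h2, fun hz => ⟨h2, hz.2⟩⟩
        rw [vh_div _ hc hc', cs_single, cs_single]
        refine single_mem_supported k _ ⟨⟨?_, fun hz => ⟨hv.1, hv.2.2 hz⟩⟩, ?_⟩
        · exact List.forall_mem_cons.2 ⟨hv.1, List.forall_mem_cons.2 ⟨hv.2.1, hl.2⟩⟩
        · have : ldeg 0 (.s (va y)) + ldeg 0 (Let.dn y c) = ldeg 0 c + zz := by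
            cases c with
            | s β =>
              have h4 := congrArg ex (sub_va_add hc)
              rw [ex_add] at h4
              simp only [Let.dn, ldeg]
              rw [Let.mon_s] at h4
              rw [← h4]
              abel
            | h a =>
              have h4 := congrArg ex (sub_va_add hc)
              rw [ex_add] at h4
              simp only [Let.dn, ldeg]
              rw [Let.mon_h] at h4
              rw [← h4]
              abel
          rw [wdeg_cons, wdeg_cons, wdeg_cons, ← add_assoc, this]
          abel

lemma cxZ_exact_of_free (hy : P.Free y) {δ : Dg σ} (hδ : δ (some y) ≠ 0) :
    (cxZ k P 0).Exact δ := by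
  refine Cx.exact_of_contraction _ (fun δ => δ (some y) ≠ 0) (vh k y) (vpos y)
    (fun l hl _ => ?_) (fun l hl hd => ?_) δ hδ
  · refine supported_mono ?_ (wdeg_vh hy l (hl.good P))
    exact fun l' h => ⟨h.1.2 hl, h.2⟩
  · have := vh_lower (k := k) hy l (hl.good P)
    rwa [hl.v1_eq_zero, v0_eq_zero hd, map_zero, add_zero, add_zero] at this

lemma coeff_tser_of_free (hy : P.Free y) {δ : Dg σ} (hδ : δ (some y) ≠ 0) :
    MvPowerSeries.coeff δ (tser k P) = 0 := by
  rw [tser, Cx.coeff_series, (cxZ_exact_of_free hy hδ).hdim, Nat.cast_zero]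

end FreeVariable

end MonomialRings

namespace MonomialRings

open Finsupp hiding some

section FreeFactor

variable {k : Type*} [Field k] {σ : Type*} {P : Par σ} {y : σ}

variable (P y) in
/-- Setting a variable to zero. -/
def Par.kill : Par σ where
  J := P.J ∪ {β | β y ≠ 0}
  F := {a | a ∈ P.F ∧ a y = 0}
  up β hβ γ := by
    rcases hβ with h | h
    · exact Or.inl (P.up β h γ)
    · refine Or.inr ?_
      rw [Set.mem_ofPred_eq] at h ⊢
      simp [h]
  disj a ha h := by
    rcases h with h | h
    · exact P.disj a ha.1 h
    · exact h ha.2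
  conv a β γ ha h := by
    refine ⟨P.conv a β γ ha.1 h.1, ?_⟩
    have := h.2
    simp only [Pi.add_apply, Nat.add_eq_zero_iff] at this ⊢
    exact this.2

lemma Let.mul_kill {c d : Let σ} (hc : c.mon y = 0) (hd : d.mon y = 0) :
    mul (P.kill y) c d = mul P c d := by
  cases c <;> cases d <;> simp only [mon_s, mon_h] at hc hd <;>
    simp [mul, Par.kill, hc, hd]

lemma Let.mul_ne_va {c d : Let σ} (hcd : c.mon y ≠ 0 ∧ d ≠ .s 0 ∨ d.mon y ≠ 0 ∧ c ≠ .s 0)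
    {e : Let σ} (h : mul P c d = some e) : e ≠ s (va y) := by
  have key : ∀ β γ : Mon σ, β + γ = va y → β y ≠ 0 → γ = 0 := by
    intro β γ h1 h2
    have h3 := sub_va_add h2
    rw [← h3, add_right_comm, add_eq_right, add_eq_zero] at h1
    exact h1.2
  rintro rfl
  have hm := mon_mul h
  rw [mon_s] at hm
  cases c with
  | h a => cases d <;> simp [mul] at h
  | s β =>
    cases d with
    | h a => simp [mul] at h
    | s γ =>
      rcases hcd with ⟨h1, h2⟩ | ⟨h1, h2⟩
      · exact h2 (by rw [key β γ hm.symm h1])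
      · exact h2 (by rw [key γ β (by rw [add_comm]; exact hm.symm) h1])

lemma v0_ml_free {c : Let σ} (hc : c.mon y = 0) (v : Wd k σ) :
    v0 k y (ml P c v) = ml (P.kill y) c (v0 k y v) := by
  refine word_ext (f := v0 k y ∘ₗ ml P c) (g := ml (P.kill y) c ∘ₗ v0 k y) (fun l => ?_) v
  cases l with
  | nil => simp
  | cons d w =>
    rw [← cs_single, LinearMap.comp_apply, LinearMap.comp_apply, ml_cs]
    by_cases hd : d.mon y = 0
    · rw [v0_free _ hd, ml_cs, Let.mul_kill hc hd]
      cases h : Let.mul P c d with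
      | none => simp
      | some e => exact v0_free _ (by rw [Let.mon_mul h]; simp [hc, hd])
    · rw [v0_div _ hd, map_zero]
      cases h : Let.mul P c d with
      | none => simp
      | some e => exact v0_div _ (by rw [Let.mon_mul h]; simp [hd])

lemma v0_ml_div {c : Let σ} (hc : c.mon y ≠ 0) (v : Wd k σ) : v0 k y (ml P c v) = 0 := by
  refine word_ext (f := v0 k y ∘ₗ ml P c) (g := 0) (fun l => ?_) v
  cases l with
  | nil => simp
  | cons d w =>
    rw [← cs_single, LinearMap.comp_apply, ml_cs]
    cases h : Let.mul P c d with
    | none => simp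
    | some e => exact v0_div _ (by rw [Let.mon_mul h]; simp [hc])

lemma v0_D (v : Wd k σ) : v0 k y (D P v) = D (P.kill y) (v0 k y v) := by
  refine word_ext (f := v0 k y ∘ₗ D P) (g := D (P.kill y) ∘ₗ v0 k y) (fun l => ?_) v
  rw [LinearMap.comp_apply, LinearMap.comp_apply]
  induction l with
  | nil => simp
  | cons c w ih =>
    rw [← cs_single, D_cs]
    by_cases hc : c.mon y = 0
    · rw [v0_free _ hc, D_cs, map_smul, map_sub, v0_free _ hc, ih, v0_ml_free hc]
    · rw [v0_div _ hc, map_smul, map_sub, v0_div _ hc, v0_ml_div hc]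
      simp

lemma ml_nilp (c : Let σ) (v : Wd k σ) : ml P c (nilp v) = 0 := by
  refine word_ext (f := ml P c ∘ₗ nilp) (g := 0) (fun l => ?_) v
  cases l with
  | nil => simp
  | cons d w => rw [← cs_single]; simp

lemma D_nilp (v : Wd k σ) : D P (nilp v) = 0 := by
  refine word_ext (f := D P ∘ₗ nilp) (g := 0) (fun l => ?_) v
  cases l with
  | nil => simp
  | cons d w => rw [← cs_single]; simp

lemma v1_ml_free {c : Let σ} (hc : c.mon y = 0) (hc0 : c ≠ .s 0) (v : Wd k σ) :
    v1 k y (ml P c v) = ml (P.kill y) c (v1 k y v) := by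
  refine word_ext (f := v1 k y ∘ₗ ml P c) (g := ml (P.kill y) c ∘ₗ v1 k y) (fun l => ?_) v
  cases l with
  | nil => simp
  | cons d w =>
    rw [← cs_single, LinearMap.comp_apply, LinearMap.comp_apply, ml_cs]
    by_cases hd : d.mon y = 0
    · rw [v1_free _ hd, ml_cs, Let.mul_kill hc hd]
      cases h : Let.mul P c d with
      | none => simp
      | some e => exact v1_free _ (by rw [Let.mon_mul h]; simp [hc, hd])
    · have e1 : ml (P.kill y) c (v1 k y (cs d (single w 1))) = 0 := by
        by_cases hd' : d = .s (va y)
        · rw [hd', v1_va, ml_nilp]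
        · rw [v1_div _ hd hd', map_zero]
      rw [e1]
      cases h : Let.mul P c d with
      | none => simp
      | some e =>
        exact v1_div _ (by rw [Let.mon_mul h]; simp [hd]) (Let.mul_ne_va (.inr ⟨hd, hc0⟩) h)

lemma v1_ml_div {c : Let σ} (hc : c.mon y ≠ 0) {l : List (Let σ)}
    (hl : ∀ c ∈ l, Let.Good P c) : v1 k y (ml P c (single l 1)) = 0 := by
  cases l with
  | nil => simp
  | cons d w =>
    rw [← cs_single, ml_cs]
    cases h : Let.mul P c d with
    | none => simp
    | some e =>
      refine v1_div _ (by rw [Let.mon_mul h]; simp [hc]) (Let.mul_ne_va (.inl ⟨hc, ?_⟩) h)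
      rintro rfl
      exact (hl _ List.mem_cons_self).1 rfl

lemma v1_D {l : List (Let σ)} (hl : ∀ c ∈ l, Let.Good P c) :
    v1 k y (D P (single l 1)) = D (P.kill y) (v1 k y (single l 1)) := by
  induction l with
  | nil => simp
  | cons c w ih =>
    simp only [List.mem_cons, forall_eq_or_imp] at hl
    rw [← cs_single, D_cs]
    by_cases hc : c.mon y = 0
    · have hc0 : c ≠ .s 0 := by
        rintro rfl
        exact hl.1.1 rfl
      rw [v1_free _ hc, D_cs, map_smul, map_sub, v1_free _ hc, ih hl.2, v1_ml_free hc hc0]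
    · rw [map_smul, map_sub, v1_ml_div hc hl.2]
      by_cases hc' : c = .s (va y)
      · rw [hc', v1_va, v1_va, nilp_D, D_nilp]
        simp
      · rw [v1_div _ hc hc', v1_div _ hc hc']
        simp

lemma v0_vh (v : Wd k σ) : v0 k y (vh k y v) = 0 := by
  refine word_ext (f := v0 k y ∘ₗ vh k y) (g := 0) (fun l => ?_) v
  rw [LinearMap.comp_apply, LinearMap.zero_apply]
  induction l with
  | nil => simp
  | cons c w ih =>
    rw [← cs_single]
    by_cases hc : c.mon y = 0
    · rw [vh_free _ hc, map_smul, v0_free _ hc, ih]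
      simp
    · by_cases hc' : c = .s (va y)
      · rw [hc', vh_va, map_zero]
      · rw [vh_div _ hc hc', v0_div _ (by simp)]

lemma v1_vh (v : Wd k σ) : v1 k y (vh k y v) = 0 := by
  refine word_ext (f := v1 k y ∘ₗ vh k y) (g := 0) (fun l => ?_) v
  rw [LinearMap.comp_apply, LinearMap.zero_apply]
  induction l with
  | nil => simp
  | cons c w ih =>
    rw [← cs_single]
    by_cases hc : c.mon y = 0
    · rw [vh_free _ hc, map_smul, v1_free _ hc, ih]
      simp
    · by_cases hc' : c = .s (va y)
      · rw [hc', vh_va, map_zero]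
      · rw [vh_div _ hc hc', v1_va, nilp_cs]

lemma free_word {l : List (Let σ)} (hl : ∀ c ∈ l, c.mon y = 0) :
    v0 k y (single l 1) = single l 1 ∧ v1 k y (single l 1) = 0 ∧
      v0 k y (apv y (single l 1)) = 0 ∧ v1 k y (apv y (single l 1)) = single l 1 := by
  induction l with
  | nil =>
    refine ⟨by simp, by simp, ?_, ?_⟩
    · rw [apv_nil, ← cs_single, v0_div _ (by simp)]
    · rw [apv_nil, ← cs_single, v1_va, nilp_nil]
  | cons c w ih =>
    simp only [List.mem_cons, forall_eq_or_imp] at hl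
    obtain ⟨h1, h2, h3, h4⟩ := ih hl.2
    rw [← cs_single, apv_cs, v0_free _ hl.1, v0_free _ hl.1, v1_free _ hl.1, v1_free _ hl.1,
      h1, h2, h3, h4]
    simp

lemma nilp_mem (w : List (Let σ)) :
    nilp (single w (1 : k)) ∈ supported k k {l' | l' = [] ∧ w = []} := by
  cases w with
  | nil =>
    rw [nilp_nil]
    exact single_mem_supported k _ ⟨rfl, rfl⟩
  | cons c w =>
    rw [← cs_single, nilp_cs]
    exact Submodule.zero_mem _

variable (P) in
/-- Words of ring letters. -/
def Sok (l : List (Let σ)) : Prop := (∀ c ∈ l, Let.Good P c) ∧ ¬ ∃ a, Let.h a ∈ l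

lemma Sok.cons {c : Let σ} {l : List (Let σ)} :
    Sok P (c :: l) ↔ (∃ β, c = .s β ∧ β ≠ 0 ∧ β ∉ P.J) ∧ Sok P l := by
  cases c with
  | s β => simp [Sok, Let.Good, and_assoc]
  | h a =>
    simp only [Sok, List.mem_cons, Let.h.injEq, exists_or, exists_eq, true_or, not_true_eq_false,
      and_false, reduceCtorEq, false_and, exists_false]

lemma Sok.kill {l : List (Let σ)} : Sok (P.kill y) l ↔ Sok P l ∧ ∀ c ∈ l, c.mon y = 0 := by
  induction l with
  | nil => simp [Sok]
  | cons c l ih =>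
    rw [Sok.cons, Sok.cons, ih]
    simp only [Par.kill, Set.mem_union, Set.mem_ofPred_eq, not_or, not_not, List.mem_cons,
      forall_eq_or_imp]
    constructor
    · rintro ⟨⟨β, rfl, h1, h2, h3⟩, h4, h5⟩
      exact ⟨⟨⟨β, rfl, h1, h2⟩, h4⟩, h3, h5⟩
    · rintro ⟨⟨⟨β, rfl, h1, h2⟩, h4⟩, h3, h5⟩
      exact ⟨⟨β, rfl, h1, h2, h3⟩, h4, h5⟩

variable (k y) in
/-- Splitting a word by its last letter. -/
def secB : (List (Let σ) × Bool →₀ k) →ₗ[k] Wd k σ :=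
  Finsupp.linearCombination k fun p => if p.2 then apv y (single p.1 1) else single p.1 1

lemma secB_single (l : List (Let σ)) (i : Bool) :
    secB k y (single (l, i) 1) = if i then apv y (single l 1) else single l 1 := by
  simp [secB]

lemma secB_false (v : Wd k σ) : secB k y (tm v (single false 1)) = v := by
  refine word_ext (f := secB k y ∘ₗ tm.flip (single false 1)) (g := LinearMap.id) (fun l => ?_) v
  rw [LinearMap.comp_apply, LinearMap.flip_apply, tm_single, mul_one, secB_single]
  simp

lemma secB_true (v : Wd k σ) : secB k y (tm v (single true 1)) = apv y v := by
  refine word_ext (f := secB k y ∘ₗ tm.flip (single true 1)) (g := apv y) (fun l => ?_) v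
  rw [LinearMap.comp_apply, LinearMap.flip_apply, tm_single, mul_one, secB_single]
  simp

variable [Finite σ]

lemma v0_mem {l : List (Let σ)} (hl : Sok P l) :
    v0 k y (single l 1) ∈ supported k k {l' | Sok (P.kill y) l' ∧ wdeg 0 l' = wdeg 0 l} := by
  induction l with
  | nil =>
    rw [v0_nil]
    exact single_mem_supported k _ ⟨Sok.kill.2 ⟨hl, by simp⟩, rfl⟩
  | cons c w ih =>
    have hw := (Sok.cons.1 hl).2
    rw [← cs_single]
    by_cases hc : c.mon y = 0
    · rw [v0_free _ hc]
      refine cs_mem ?_ (ih hw)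
      intro l' h
      obtain ⟨h1, h2⟩ := Sok.kill.1 h.1
      exact ⟨Sok.kill.2 ⟨Sok.cons.2 ⟨(Sok.cons.1 hl).1, h1⟩, List.forall_mem_cons.2 ⟨hc, h2⟩⟩,
        by rw [wdeg_cons, wdeg_cons, h.2]⟩
    · rw [v0_div _ hc]
      exact Submodule.zero_mem _

lemma v1_mem {l : List (Let σ)} (hl : Sok P l) :
    v1 k y (single l 1) ∈ supported k k
      {l' | Sok (P.kill y) l' ∧ wdeg 0 l' + (ex (va y) + zz) = wdeg 0 l} := by
  induction l with
  | nil => simp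
  | cons c w ih =>
    have hw := (Sok.cons.1 hl).2
    rw [← cs_single]
    by_cases hc : c.mon y = 0
    · rw [v1_free _ hc]
      refine cs_mem ?_ (ih hw)
      intro l' h
      obtain ⟨h1, h2⟩ := Sok.kill.1 h.1
      exact ⟨Sok.kill.2 ⟨Sok.cons.2 ⟨(Sok.cons.1 hl).1, h1⟩, List.forall_mem_cons.2 ⟨hc, h2⟩⟩,
        by rw [wdeg_cons, wdeg_cons, ← h.2, add_assoc]⟩
    · by_cases hc' : c = .s (va y)
      · rw [hc', v1_va]
        refine supported_mono ?_ (nilp_mem w)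
        rintro l' ⟨rfl, rfl⟩
        refine ⟨Sok.kill.2 ⟨⟨by simp, by simp⟩, by simp⟩, ?_⟩
        rw [wdeg_cons, ldeg, wdeg_nil]
        abel
      · rw [v1_div _ hc hc']
        exact Submodule.zero_mem _

lemma apv_mem (h0 : va y ∉ P.J) {l : List (Let σ)} (hl : Sok P l) :
    apv y (single l (1 : k)) ∈ supported k k
      {l' | Sok P l' ∧ wdeg 0 l' = wdeg 0 l + (ex (va y) + zz)} := by
  induction l with
  | nil =>
    rw [apv_nil]
    refine single_mem_supported k _ ⟨Sok.cons.2 ⟨⟨_, rfl, fun h => ?_, h0⟩, hl⟩, ?_⟩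
    · simpa using congrFun h y
    · rw [wdeg_cons, ldeg, wdeg_nil]
      abel
  | cons c w ih =>
    have hw := (Sok.cons.1 hl).2
    rw [← cs_single, apv_cs]
    refine cs_mem ?_ (ih hw)
    exact fun l' h => ⟨Sok.cons.2 ⟨(Sok.cons.1 hl).1, h.1⟩,
      by rw [wdeg_cons, wdeg_cons, h.2, add_assoc]⟩

omit [Finite σ] in
lemma vh_nohat {l : List (Let σ)} (hl : ¬ ∃ a, Let.h a ∈ l) :
    vh k y (single l 1) ∈ supported k k {l' | ¬ ∃ a, Let.h a ∈ l'} := by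
  induction l with
  | nil => simp
  | cons c w ih =>
    simp only [List.mem_cons, exists_or, not_or] at hl
    obtain ⟨hl1, hl2⟩ := hl
    cases c with
    | h a => exact absurd ⟨a, rfl⟩ hl1
    | s β =>
      rw [← cs_single]
      by_cases hc : (Let.s β).mon y = 0
      · rw [vh_free _ hc]
        refine Submodule.smul_mem _ _ (cs_mem ?_ (ih hl2))
        intro l' h
        rw [Set.mem_ofPred_eq] at h ⊢
        simpa using h
      · by_cases hc' : Let.s β = .s (va y)
        · rw [hc', vh_va]
          exact Submodule.zero_mem _
        · rw [vh_div _ hc hc', cs_single, cs_single]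
          refine single_mem_supported k _ ?_
          rw [Set.mem_ofPred_eq]
          simpa [Let.dn] using hl2

variable (k) in
/-- The complex of a ring with a free variable, up to homotopy. -/
def freeQI (hy : P.Free y) (h0 : (0 : Mon σ) ∉ P.J) : Cx.QI (cxS k P 0)
    ((cxS k (P.kill y) 0).prod (Cx.ofBasis k fun i : Bool => if i then ex (va y) + zz else 0)) where
  f := tm.flip (single false 1) ∘ₗ v0 k y + tm.flip (single true 1) ∘ₗ v1 k y
  sec := secB k y
  h := vh k y
  μ := vpos y
  f_mem l hl := by
    refine Submodule.add_mem _ ?_ ?_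
    · refine supported_mono ?_ (tm_mem (v0_mem hl)
        (single_mem_supported k (1 : k) (Set.mem_singleton false)))
      rintro ⟨l', i⟩ ⟨h1, rfl⟩
      exact ⟨⟨h1.1, trivial⟩, (add_zero _).trans h1.2⟩
    · refine supported_mono ?_ (tm_mem (v1_mem hl)
        (single_mem_supported k (1 : k) (Set.mem_singleton true)))
      rintro ⟨l', i⟩ ⟨h1, rfl⟩
      exact ⟨⟨h1.1, trivial⟩, h1.2⟩
  f_d l hl := by
    have h1 := v0_D (P := P) (y := y) (single l (1 : k))
    have h2 := v1_D (k := k) (y := y) hl.1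
    change tm (v0 k y (D P (single l 1))) (single false 1) +
      tm (v1 k y (D P (single l 1))) (single true 1) = Cx.prodD _ _
        (tm (v0 k y (single l 1)) (single false 1) + tm (v1 k y (single l 1)) (single true 1))
    rw [h1, h2, Cx.prodD, map_add, LinearMap.add_apply, LinearMap.add_apply, tens_tm, tens_tm,
      tens_tm, tens_tm]
    simp only [Cx.ofBasis, LinearMap.zero_apply, map_zero, add_zero]
    rfl
  sec_mem := by
    rintro ⟨l, i⟩ ⟨hl, -⟩
    have hl' : Sok P l := (Sok.kill.1 hl).1
    rw [secB_single]
    cases i with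
    | false => exact single_mem_supported k _ ⟨hl', (add_zero _).symm⟩
    | true =>
      exact apv_mem (fun h => h0 ((hy.J_iff 0).1 (by rwa [zero_add]))) hl'
  f_sec := by
    rintro ⟨l, i⟩ ⟨hl, -⟩
    obtain ⟨h1, h2, h3, h4⟩ := free_word (k := k) (Sok.kill.1 hl).2
    rw [secB_single, LinearMap.add_apply, LinearMap.comp_apply, LinearMap.comp_apply]
    cases i with
    | false => simp [h1, h2, tm_single]
    | true => simp [h3, h4, tm_single]
  h_mem l hl := by
    have h1 := wdeg_vh (k := k) hy l hl.1
    have h2 := vh_nohat (k := k) (y := y) hl.2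
    rw [mem_supported] at h1 h2
    refine (mem_supported _ _).2 fun l' hl' => ?_
    have h3 := h1 hl'
    exact ⟨⟨h3.1.1, h2 hl'⟩, h3.2⟩
  f_h l _ := by
    rw [LinearMap.add_apply, LinearMap.comp_apply, LinearMap.comp_apply, v0_vh, v1_vh]
    simp
  lower l hl := by
    have := vh_lower (k := k) hy l hl.1
    rw [LinearMap.add_apply, LinearMap.comp_apply, LinearMap.comp_apply, LinearMap.flip_apply,
      LinearMap.flip_apply, map_add, secB_false, secB_true]
    exact this

omit [Finite σ] in
lemma ofBasis_bool_series {e : Dg σ} (he : e ≠ 0) :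
    (Cx.ofBasis k fun i : Bool => if i then e else 0).series = 1 + MvPowerSeries.monomial e 1 := by
  ext δ
  rw [Cx.coeff_series, Cx.ofBasis_hdim _ _ (Set.toFinite _), map_add, MvPowerSeries.coeff_one,
    MvPowerSeries.coeff_monomial]
  by_cases h0 : δ = 0
  · have : {i : Bool | (if i then e else 0) = δ} = {false} := by
      ext i
      cases i <;> simp [h0, he]
    rw [this, if_pos h0, h0, if_neg he.symm]
    simp
  · by_cases h1 : δ = e
    · have : {i : Bool | (if i then e else 0) = δ} = {true} := by
        ext i
        cases i <;> simp [h1, he.symm]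
      rw [this, if_neg h0, if_pos h1]
      simp
    · have : {i : Bool | (if i then e else 0) = δ} = ∅ := by
        ext i
        cases i <;> simp [Ne.symm h0, Ne.symm h1]
      rw [this, if_neg h0, if_neg h1]
      simp

/-- The Poincaré series of a ring with a free variable. -/
theorem pser_free (hy : P.Free y) (h0 : (0 : Mon σ) ∉ P.J) :
    pser k P.J = pser k (P.kill y).J *
      (1 + MvPowerSeries.X (some y) * MvPowerSeries.X none) := by
  have hne : ex (va y) + zz ≠ (0 : Dg σ) := fun h => by
    simpa [zz] using DFunLike.congr_fun h none
  have h1 := ofBasis_bool_series (k := k) hne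
  rw [← cxS_series P 0, ← cxS_series (P.kill y) 0, MvPowerSeries.X, MvPowerSeries.X,
    MvPowerSeries.monomial_mul_monomial, ← ex_va, one_mul]
  change _ = _ * (1 + MvPowerSeries.monomial (ex (va y) + zz) 1)
  rw [← h1, ← Cx.series_prod (cxS_locFin _ _) fun δ => Set.toFinite _]
  ext δ
  rw [Cx.coeff_series, Cx.coeff_series, (freeQI k hy h0).hdim_eq]

end FreeFactor

end MonomialRings

namespace MonomialRings

open Finsupp hiding some

section Transfer

variable {k : Type*} [Field k] {σ τ : Type*}

section Embedding

variable {E : Mon σ →+ Mon τ} (hE : Function.Injective E) {J : Set (Mon σ)} {K : Set (Mon τ)}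
  (hK : ∀ β, E β ∈ K ↔ β ∈ J)

lemma getD_map_hom (l : List (Mon σ)) (j : ℕ) : (l.map E).getD j 0 = E (l.getD j 0) := by
  rw [← map_zero E, List.getD_map]

lemma mergeAt_map (l : List (Mon σ)) (j : ℕ) : mergeAt (l.map E) j = (mergeAt l j).map E := by
  simp only [mergeAt, getD_map_hom, List.map_append, List.map_take, List.map_drop, List.map_cons,
    List.map_nil, map_add]

include hK in
lemma barAux_map (l : List (Mon σ)) :
    barAux k K (l.map E) = lmapDomain k k (List.map E) (barAux k J l) := by
  unfold barAux
  rw [map_sum, List.length_map]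
  refine Finset.sum_congr rfl fun j _ => ?_
  rw [getD_map_hom, getD_map_hom, ← map_add, hK, mergeAt_map]
  split_ifs
  · simp
  · rw [lmapDomain_apply, mapDomain_smul, mapDomain_single]

include hK in
lemma barD_map (v : List (Mon σ) →₀ k) :
    barD k K (lmapDomain k k (List.map E) v) = lmapDomain k k (List.map E) (barD k J v) := by
  refine lin_eq (s := Set.univ) (f := barD k K ∘ₗ lmapDomain k k (List.map E))
    (g := lmapDomain k k (List.map E) ∘ₗ barD k J) (fun l _ => ?_) (by simp)
  rw [LinearMap.comp_apply, LinearMap.comp_apply, lmapDomain_apply, mapDomain_single]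
  simp [barD, barAux_map hK]

include hE hK in
lemma barSub_map {α : Mon σ} (hα : ∀ β ≤ E α, β ∈ Set.range E) (i : ℕ) :
    barSub k K i (E α) = (barSub k J i α).map (lmapDomain k k (List.map E)) := by
  have e : ∀ {τ : Type _} (K : Set (Mon τ)) (α), barSub k K i α = supported k k (barBasis K i α) :=
    fun K α => by rw [supported_eq_span_single]; rfl
  have e' : barSub k K i (E α) = supported k k (barBasis K i (E α)) := by
    rw [supported_eq_span_single]; rfl
  rw [e J, e', lmapDomain_supported]
  congr 1
  ext l
  constructor
  · rintro ⟨h1, h2, h3⟩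
    have : ∃ l', List.map E l' = l := by
      have : ∀ β ∈ l, ∃ γ, E γ = β := fun β hβ => hα β (by
        rw [← h2]; exact List.single_le_sum (fun _ _ => zero_le) _ hβ)
      clear h1 h2 h3
      induction l with
      | nil => exact ⟨[], rfl⟩
      | cons β l ih =>
        simp only [List.mem_cons, forall_eq_or_imp] at this
        obtain ⟨γ, rfl⟩ := this.1
        obtain ⟨l', rfl⟩ := ih this.2
        exact ⟨γ :: l', rfl⟩
    obtain ⟨l, rfl⟩ := this
    refine ⟨l, ⟨by simpa using h1, hE ?_, fun β hβ => ?_⟩, rfl⟩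
    · rw [map_list_sum, h2]
    · obtain ⟨h4, h5⟩ := h3 (E β) (List.mem_map_of_mem hβ)
      exact ⟨fun h => h4 (by rw [h, map_zero]), fun h => h5 ((hK β).2 h)⟩
  · rintro ⟨l, ⟨h1, h2, h3⟩, rfl⟩
    refine ⟨by simpa using h1, by rw [← h2, map_list_sum], fun β hβ => ?_⟩
    obtain ⟨γ, hγ, rfl⟩ := List.mem_map.1 hβ
    exact ⟨fun h => (h3 γ hγ).1 (hE (by rw [h, map_zero])), fun h => (h3 γ hγ).2 ((hK γ).1 h)⟩

include hE hK in
lemma torDim_map {α : Mon σ} (hα : ∀ β ≤ E α, β ∈ Set.range E) (i : ℕ) :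
    torDim k K i (E α) = torDim k J i α := by
  have hT : Function.Injective (lmapDomain k k (List.map E)) :=
    mapDomain_injective (List.map_injective_iff.2 hE)
  have hZ : barSub k K i (E α) ⊓ LinearMap.ker (barD k K) =
      (barSub k J i α ⊓ LinearMap.ker (barD k J)).map (lmapDomain k k (List.map E)) := by
    rw [barSub_map hE hK hα]
    ext v
    simp only [Submodule.mem_map, Submodule.mem_inf, LinearMap.mem_ker]
    constructor
    · rintro ⟨⟨u, hu, rfl⟩, h⟩
      rw [barD_map hK] at h
      exact ⟨u, ⟨hu, hT (by rw [h, map_zero])⟩, rfl⟩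
    · rintro ⟨u, ⟨hu, h⟩, rfl⟩
      exact ⟨⟨u, hu, rfl⟩, by rw [barD_map hK, h, map_zero]⟩
  have hB : (barSub k K (i + 1) (E α)).map (barD k K) =
      ((barSub k J (i + 1) α).map (barD k J)).map (lmapDomain k k (List.map E)) := by
    rw [barSub_map hE hK hα, ← Submodule.map_comp, ← Submodule.map_comp]
    congr 1
    ext v : 1
    exact LinearMap.ext fun a => barD_map hK _
  unfold torDim
  rw [hZ, hB, ← (Submodule.equivMapOfInjective _ hT _).finrank_eq,
    ← (Submodule.equivMapOfInjective _ hT _).finrank_eq]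

end Embedding

lemma barSub_eq_bot {J : Set (Mon σ)} {i : ℕ} {α : Mon σ} (h : barBasis J i α = ∅) :
    barSub k J i α = ⊥ := by
  rw [barSub, h, Set.image_empty, Submodule.span_empty]

lemma torDim_eq_zero {J : Set (Mon σ)} {i : ℕ} {α : Mon σ} (h : barBasis J i α = ∅) :
    torDim k J i α = 0 := by
  rw [torDim, barSub_eq_bot h, bot_inf_eq, finrank_bot, Nat.zero_sub]

/-- Extension of a monomial by a new variable. -/
def exm : Mon σ →+ Mon (Option σ) where
  toFun β o := o.elim 0 β
  map_zero' := by ext o; cases o <;> rfl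
  map_add' β γ := by ext o; cases o <;> rfl

@[simp] lemma exm_none (β : Mon σ) : exm β none = 0 := rfl
@[simp] lemma exm_some (β : Mon σ) (i : σ) : exm β (some i) = β i := rfl

lemma exm_injective : Function.Injective (exm (σ := σ)) := fun β γ h => by
  funext i
  exact congrFun h (some i)

lemma pser_exm [Finite σ] {J : Set (Mon σ)} {K : Set (Mon (Option σ))} (hK : ∀ β, exm β ∈ K ↔ β ∈ J)
    (hK' : ∀ β, β none ≠ 0 → β ∈ K) :
    pser k K = MvPowerSeries.rename (Option.map some) (pser k J) := by
  have hinj : Function.Injective (Option.map (some (α := σ))) :=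
    Option.map_injective (Option.some_injective σ)
  ext δ
  by_cases h0 : δ (some none) = 0
  · have hα : (fun i => δ (some i)) = exm fun i => δ (some (some i)) := by
      funext o
      cases o with
      | none => exact h0
      | some i => rfl
    set δ' : Dg σ := Finsupp.comapDomain (Option.map some) δ hinj.injOn
    have hδ : δ = embDomain ⟨Option.map some, hinj⟩ δ' := by
      rw [embDomain_eq_mapDomain]
      refine (mapDomain_comapDomain _ hinj _ ?_).symm
      intro o ho
      rcases o with - | - | i
      · exact ⟨none, rfl⟩
      · exact absurd h0 (mem_support_iff.1 ho)
      · exact ⟨some i, rfl⟩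
    have h1 : MvPowerSeries.coeff δ (MvPowerSeries.rename (Option.map some) (pser k J)) =
        MvPowerSeries.coeff δ' (pser k J) := by
      rw [hδ]
      exact MvPowerSeries.coeff_embDomain_rename ⟨Option.map some, hinj⟩ _ _
    rw [h1]
    change ((torDim k K (δ none) fun i => δ (some i) : ℕ) : ℤ) = (torDim k J (δ' none) _ : ℕ)
    rw [hα, torDim_map exm_injective hK]
    · rfl
    · intro β hβ
      refine ⟨fun i => β (some i), funext fun o => ?_⟩
      cases o with
      | none => exact (Nat.le_zero.1 (hβ none)).symm
      | some i => rfl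
  · rw [MvPowerSeries.coeff_rename_eq_zero]
    · change ((torDim k K (δ none) fun i => δ (some i) : ℕ) : ℤ) = 0
      rw [torDim_eq_zero, Nat.cast_zero]
      rw [Set.eq_empty_iff_forall_notMem]
      rintro l ⟨-, hl, h⟩
      refine h0 ?_
      have : ∀ β ∈ l, β none = 0 := fun β hβ => by
        by_contra h'
        exact (h β hβ).2 (hK' β h')
      have h2 := congrFun hl none
      rw [← h2]
      clear hl h2 h
      induction l with
      | nil => rfl
      | cons β l ih =>
        simp only [List.mem_cons, forall_eq_or_imp] at this
        simp [this.1, ih this.2]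
    · rintro ⟨δ', rfl⟩
      refine h0 (mapDomain_of_notMem_range _ _ ?_)
      rintro ⟨o, ho⟩
      cases o <;> simp at ho

/-- The ring with a given monomial ideal, and the zero module. -/
def Par.ofIdeal (J : Set (Mon σ)) (up : ∀ β ∈ J, ∀ γ, β + γ ∈ J) : Par σ where
  J := J
  F := ∅
  up := up
  disj := by simp
  conv := by simp

lemma pser_option [Finite σ] {J : Set (Mon σ)} (up : ∀ β ∈ J, ∀ γ, β + γ ∈ J) (h0 : 0 ∉ J) :
    pser k {β : Mon (Option σ) | (fun i => β (some i)) ∈ J} =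
      MvPowerSeries.rename (Option.map some) (pser k J) *
        (1 + MvPowerSeries.X (some none) * MvPowerSeries.X none) := by
  have h := pser_free (k := k) (P := Par.ofIdeal {β : Mon (Option σ) | (fun i => β (some i)) ∈ J}
    fun β hβ γ => up _ hβ _) (y := none) ⟨fun β => ?_, fun a => by simp [Par.ofIdeal]⟩ h0
  · refine h.trans ?_
    congr 1
    refine pser_exm (fun β => ?_) fun β hβ => Or.inr hβ
    simp [Par.kill, Par.ofIdeal]
  · simp [Par.ofIdeal, va]

lemma barBasis_ne_zero (i : ℕ) (α : Mon σ) :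
    barBasis {β : Mon σ | β ≠ 0} i α = {l | l = [] ∧ i = 0 ∧ α = 0} := by
  ext l
  constructor
  · rintro ⟨h1, h2, h3⟩
    cases l with
    | nil => exact ⟨rfl, h1.symm, h2.symm⟩
    | cons β l => exact absurd (h3 β List.mem_cons_self).1 (h3 β List.mem_cons_self).2
  · rintro ⟨rfl, rfl, rfl⟩
    exact ⟨rfl, rfl, by simp⟩

lemma pser_ne_zero : pser k {β : Mon σ | β ≠ 0} = 1 := by
  ext δ
  rw [MvPowerSeries.coeff_one]
  change ((torDim k {β : Mon σ | β ≠ 0} (δ none) fun i => δ (some i) : ℕ) : ℤ) = _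
  split_ifs with h
  · subst h
    change ((torDim k {β : Mon σ | β ≠ 0} 0 0 : ℕ) : ℤ) = 1
    have h1 : barSub k {β : Mon σ | β ≠ 0} 0 0 = k ∙ single [] 1 := by
      rw [barSub, barBasis_ne_zero]
      simp
    have h2 : k ∙ single ([] : List (Mon σ)) (1 : k) ≤
        LinearMap.ker (barD k {β : Mon σ | β ≠ 0}) := by
      rw [Submodule.span_singleton_le_iff_mem, LinearMap.mem_ker]
      simp [barD, barAux]
    rw [torDim, h1, inf_eq_left.2 h2, finrank_span_singleton (by simp),
      barSub_eq_bot (by rw [barBasis_ne_zero]; simp), Submodule.map_bot, finrank_bot]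
    rfl
  · rw [torDim_eq_zero, Nat.cast_zero]
    rw [barBasis_ne_zero, Set.eq_empty_iff_forall_notMem]
    rintro l ⟨-, h1, h2⟩
    refine h ?_
    ext o
    cases o with
    | none => exact h1
    | some i => exact congrFun h2 i

/-- The Poincaré series of a polynomial ring. -/
lemma pser_empty [Fintype σ] : pser k (∅ : Set (Mon σ)) =
    ∏ i : σ, (1 + MvPowerSeries.X (some i) * MvPowerSeries.X none) := by
  have key : ∀ S : Finset σ, pser k (∅ : Set (Mon σ)) = pser k {β : Mon σ | ∃ i ∈ S, β i ≠ 0} *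
      ∏ i ∈ S, (1 + MvPowerSeries.X (some i) * MvPowerSeries.X none) := by
    intro S
    induction S using Finset.induction_on with
    | empty => simp
    | insert y S hy ih =>
      rw [ih, Finset.prod_insert hy, ← mul_assoc]
      congr 1
      have h := pser_free (k := k) (P := Par.ofIdeal {β : Mon σ | ∃ i ∈ S, β i ≠ 0} (by
        rintro β ⟨i, hi, h⟩ γ
        exact ⟨i, hi, by simp [h]⟩)) (y := y)
        ⟨fun β => ?_, fun a => by simp [Par.ofIdeal]⟩ (by simp [Par.ofIdeal])
      · refine h.trans ?_
        congr 2
        ext β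
        simp [Par.kill, Par.ofIdeal, or_comm]
      · refine exists_congr fun i => and_congr_right fun hi => ?_
        have : i ≠ y := fun h => hy (h ▸ hi)
        simp [va_of_ne this]
  have : {β : Mon σ | ∃ i ∈ Finset.univ, β i ≠ 0} = {β | β ≠ 0} := by
    ext β
    simp [funext_iff]
  rw [key Finset.univ, this, pser_ne_zero, one_mul]

end Transfer

end MonomialRings

namespace MonomialRings

open Finsupp hiding some

namespace Cx

variable {k : Type*} [Field k] {σ X : Type*}

/-- The complex `C` is an extension of `C1` by its subcomplex `C2`. -/
structure Ext (C C1 C2 : Cx k σ X) : Prop where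
  ok_eq : C.ok = C1.ok ∪ C2.ok
  disj : Disjoint C1.ok C2.ok
  deg1 : C1.deg = C.deg
  deg2 : C2.deg = C.deg
  d1 : ∀ x ∈ C1.ok, C.d (single x 1) - C1.d (single x 1) ∈ supported k k C2.ok
  d2 : ∀ x ∈ C2.ok, C.d (single x 1) = C2.d (single x 1)

namespace Ext

variable {C C1 C2 : Cx k σ X} (h : Ext C C1 C2) {δ : Dg σ} {v : X →₀ k}
include h

lemma gr_le1 : C1.gr δ ≤ C.gr δ :=
  supported_mono fun _ hx => ⟨h.ok_eq ▸ Or.inl hx.1, h.deg1 ▸ hx.2⟩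

lemma gr_le2 : C2.gr δ ≤ C.gr δ :=
  supported_mono fun _ hx => ⟨h.ok_eq ▸ Or.inr hx.1, h.deg2 ▸ hx.2⟩

lemma gr_le_sup : C.gr δ ≤ C1.gr δ ⊔ C2.gr δ := by
  unfold gr
  rw [← supported_union]
  refine supported_mono fun x hx => ?_
  rw [h.ok_eq] at hx
  rcases hx with ⟨hx | hx, hd⟩
  · exact Or.inl ⟨hx, h.deg1 ▸ hd⟩
  · exact Or.inr ⟨hx, h.deg2 ▸ hd⟩

lemma mem_gr2 (hv : v ∈ C.gr δ) (hv' : v ∈ supported k k C2.ok) : v ∈ C2.gr δ := by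
  have : v ∈ supported k k C2.ok ⊓ C.gr δ := ⟨hv', hv⟩
  unfold gr at this
  rw [← supported_inter] at this
  refine supported_mono ?_ this
  exact fun x hx => ⟨hx.1, h.deg2 ▸ hx.2.2⟩

lemma d1' (hv : v ∈ C1.gr δ) : C.d v - C1.d v ∈ supported k k C2.ok :=
  lin_mem (f := C.d - C1.d) (fun x hx => h.d1 x hx.1) hv

lemma d2' (hv : v ∈ C2.gr δ) : C.d v = C2.d v := lin_eq (fun x hx => h.d2 x hx.1) hv

lemma eq_zero (h1 : v ∈ supported k k C1.ok) (h2 : v ∈ supported k k C2.ok) : v = 0 :=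
  Submodule.disjoint_def.1 (disjoint_supported_supported h.disj) v h1 h2

omit h in
lemma gr_le_ok {C : Cx k σ X} : C.gr δ ≤ supported k k C.ok := supported_mono fun _ hx => hx.1

omit h in
lemma gm_le_ok {C : Cx k σ X} : C.gm δ ≤ supported k k C.ok := supported_mono fun _ hx => hx.1

lemma exact (h1 : C1.Exact δ) (h2 : C2.Exact δ) : C.Exact δ := by
  intro v hv hd
  obtain ⟨v1, hv1, v2, hv2, rfl⟩ := Submodule.mem_sup.1 (h.gr_le_sup hv)
  have e1 : C1.d v1 = 0 := by
    refine h.eq_zero (gm_le_ok (C1.d_gr hv1)) ?_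
    rw [← neg_mem_iff, show -C1.d v1 = C.d v1 - C1.d v1 + C2.d v2 by
      rw [map_add, h.d2' hv2] at hd
      rw [sub_add_eq_add_sub, hd, zero_sub]]
    exact Submodule.add_mem _ (h.d1' hv1) (gm_le_ok (C2.d_gr hv2))
  obtain ⟨w1, hw1, rfl⟩ := h1 v1 hv1 e1
  have hu : C1.d w1 + v2 - C.d w1 ∈ C2.gr δ := by
    refine h.mem_gr2 (Submodule.sub_mem _ hv (C.d_gr' (h.gr_le1 hw1))) ?_
    rw [show C1.d w1 + v2 - C.d w1 = v2 - (C.d w1 - C1.d w1) by abel]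
    exact Submodule.sub_mem _ (gr_le_ok hv2) (h.d1' hw1)
  obtain ⟨w2, hw2, e⟩ := h2 _ hu (by rw [← h.d2' hu, map_sub, hd, C.d_d (h.gr_le1 hw1), sub_zero])
  refine ⟨w1 + w2, Submodule.add_mem _ (h.gr_le1 hw1) (h.gr_le2 hw2), ?_⟩
  rw [map_add, h.d2' hw2, e]
  abel

lemma exact_quotient (hC : C.Exact δ) (h2 : ∀ δ', δ = δ' + zz → C2.Exact δ') : C1.Exact δ := by
  intro v hv hd
  have hm : C.d v ∈ supported k k C2.ok := by
    have := h.d1' hv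
    rwa [hd, sub_zero] at this
  obtain ⟨u, hu, e⟩ : ∃ u ∈ C2.gr δ, C2.d u = C.d v := by
    rcases C.gm_eq_bot_or δ with hb | ⟨δ', rfl⟩
    · have := C.d_gr (h.gr_le1 hv)
      rw [hb, Submodule.mem_bot] at this
      exact ⟨0, Submodule.zero_mem _, by rw [map_zero, this]⟩
    · have hg := h.mem_gr2 (C.d_gr' (h.gr_le1 hv)) hm
      exact h2 δ' rfl _ hg (by rw [← h.d2' hg, C.d_d (h.gr_le1 hv)])
  obtain ⟨w, hw, e'⟩ := hC (v - u) (Submodule.sub_mem _ (h.gr_le1 hv) (h.gr_le2 hu))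
    (by rw [map_sub, h.d2' hu, e, sub_self])
  obtain ⟨w1, hw1, w2, hw2, rfl⟩ := Submodule.mem_sup.1 (h.gr_le_sup hw)
  refine ⟨w1, hw1, sub_eq_zero.1 (h.eq_zero (Submodule.sub_mem _ (gr_le_ok (C1.d_gr' hw1))
    (gr_le_ok hv)) ?_)⟩
  rw [map_add, h.d2' hw2, ← sub_eq_zero] at e'
  rw [show C1.d w1 - v = -(C.d w1 - C1.d w1) - C2.d w2 - u + (C.d w1 + C2.d w2 - (v - u)) by abel,
    e', add_zero]
  exact Submodule.sub_mem _ (Submodule.sub_mem _ (Submodule.neg_mem _ (h.d1' hw1))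
    (gr_le_ok (C2.d_gr' hw2))) (gr_le_ok hu)

end Ext

end Cx

section Modules

variable {k : Type*} [Field k] {σ : Type*} {P P1 P2 : Par σ}

/-- The module of `P` is an extension of the one of `P1` by the one of `P2`. -/
structure Par.Ext (P P1 P2 : Par σ) : Prop where
  J1 : P1.J = P.J
  J2 : P2.J = P.J
  F_iff : ∀ a, a ∈ P.F ↔ a ∈ P1.F ∨ a ∈ P2.F
  disj : ∀ a ∈ P1.F, a ∉ P2.F
  up : ∀ a ∈ P2.F, ∀ β, β + a ∈ P.F → β + a ∈ P2.F

namespace Par.Ext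

variable (h : P.Ext P1 P2)
include h

lemma zok_iff (l : List (Let σ)) : Zok P l ↔ Zok P1 l ∨ Zok P2 l := by
  induction l with
  | nil => simp [Zok]
  | cons c w ih =>
    cases c with
    | s β => simp only [Zok, h.J1, h.J2, ih]; tauto
    | h a => simp only [Zok, h.F_iff]; tauto

lemma zok_disj (l : List (Let σ)) : Zok P1 l → ¬ Zok P2 l := by
  induction l with
  | nil => simp [Zok]
  | cons c w ih =>
    cases c with
    | s β => exact fun h1 h2 => ih h1.2 h2.2
    | h a => exact fun h1 h2 => h.disj a h1.1 h2.1

lemma D_sub (l : List (Let σ)) (hl : Zok P2 l) :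
    D P (single l (1 : k)) = D P2 (single l 1) := by
  induction l with
  | nil => simp
  | cons c w ih =>
    cases c with
    | h a =>
      obtain ⟨-, rfl⟩ := hl
      rw [← cs_single]
      simp
    | s β =>
      rw [← cs_single, D_cs, D_cs, ih hl.2]
      congr 2
      cases w with
      | nil => simp
      | cons d w =>
        rw [← cs_single, ml_cs, ml_cs]
        congr 2
        cases d with
        | s γ => simp only [Let.mul, h.J2]
        | h a =>
          have ha : a ∈ P2.F := hl.2.1
          have : β + a ∈ P.F ↔ β + a ∈ P2.F := ⟨h.up a ha β, fun hb => (h.F_iff _).2 (.inr hb)⟩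
          simp only [Let.mul, ha, (h.F_iff a).2 (.inr ha), this]

lemma D_quot (l : List (Let σ)) (hl : Zok P1 l) :
    D P (single l (1 : k)) - D P1 (single l 1) ∈ supported k k {l | Zok P2 l} := by
  induction l with
  | nil => simp
  | cons c w ih =>
    cases c with
    | h a =>
      obtain ⟨-, rfl⟩ := hl
      rw [← cs_single]
      simp
    | s β =>
      have e : D P (single (.s β :: w) (1 : k)) - D P1 (single (.s β :: w) 1) =
          (ml P (.s β) (single w 1) - ml P1 (.s β) (single w 1)) -
            cs (.s β) (D P (single w 1) - D P1 (single w 1)) := by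
        rw [← cs_single, D_cs, D_cs, map_sub]
        simp only [Let.sg]
        module
      rw [e]
      refine Submodule.sub_mem _ ?_ (cs_mem ?_ (ih hl.2))
      · cases w with
        | nil => simp
        | cons d w =>
          rw [← cs_single, ml_cs, ml_cs]
          cases d with
          | s γ => simp only [Let.mul, h.J1, sub_self, Submodule.zero_mem]
          | h a =>
            obtain ⟨ha, rfl⟩ := hl.2
            simp only [Let.mul, ha, (h.F_iff a).2 (.inl ha), h.F_iff (β + a), true_and]
            by_cases h1 : β + a ∈ P1.F
            · simp [h1]
            · by_cases h2 : β + a ∈ P2.F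
              · rw [if_pos (.inr h2), if_neg h1, csO_none, LinearMap.zero_apply, sub_zero,
                  csO_some, cs_single]
                exact single_mem_supported k _ ⟨h2, rfl⟩
              · simp [h1, h2]
      · intro l' hl'
        exact ⟨⟨hl.1.1, by rw [h.J2, ← h.J1]; exact hl.1.2⟩, hl'⟩

lemma cxZ [Finite σ] (e0 : Dg σ) :
    Cx.Ext (cxZ k P e0) (cxZ k P1 e0) (cxZ k P2 e0) where
  ok_eq := Set.ext h.zok_iff
  disj := Set.disjoint_left.2 h.zok_disj
  deg1 := rfl
  deg2 := rfl
  d1 := h.D_quot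
  d2 := h.D_sub

end Par.Ext

section Shift

variable {Q : Par σ} {u : Mon σ} (hJ : Q.J = P.J) (hF : P.F = Set.image (u + ·) Q.F)

/-- Translating the module letters. -/
def Let.shift (u : Mon σ) : Let σ → Let σ
  | s β => s β
  | h a => h (u + a)

lemma Let.shift_injective (u : Mon σ) : Function.Injective (Let.shift u) := by
  intro c d h
  cases c <;> cases d <;> simp_all [Let.shift]

/-- Translating the module letters of a word. -/
def shW (k : Type*) [Field k] (u : Mon σ) : Wd k σ →ₗ[k] Wd k σ :=
  lmapDomain k k (List.map (Let.shift u))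

@[simp] lemma shW_nil : shW k u (single [] 1) = single [] 1 := by simp [shW]

@[simp] lemma shW_cs (c : Let σ) (v : Wd k σ) :
    shW k u (cs c v) = cs (c.shift u) (shW k u v) := by
  refine word_ext (f := shW k u ∘ₗ cs c) (g := cs (c.shift u) ∘ₗ shW k u) (fun l => ?_) v
  simp only [LinearMap.comp_apply, cs_single, shW, lmapDomain_apply, mapDomain_single, List.map]

include hJ hF in
lemma Let.mul_shift (c d : Let σ) :
    mul P (c.shift u) (d.shift u) = (mul Q c d).map (shift u) := by
  have hm : ∀ a, u + a ∈ P.F ↔ a ∈ Q.F := fun a => by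
    rw [hF, (add_right_injective u).mem_set_image]
  have e : ∀ β a, β + (u + a) = u + (β + a) := fun β a => add_left_comm _ _ _
  cases c <;> cases d <;> simp only [shift, mul, hm, e, hJ] <;> first | rfl | (split_ifs <;> rfl)

include hJ hF in
lemma D_shW (v : Wd k σ) : D P (shW k u v) = shW k u (D Q v) := by
  refine word_ext (f := D P ∘ₗ shW k u) (g := shW k u ∘ₗ D Q) (fun l => ?_) v
  rw [LinearMap.comp_apply, LinearMap.comp_apply]
  induction l with
  | nil => simp
  | cons c w ih =>
    have hs : Let.sg k (c.shift u) = Let.sg k c := by cases c <;> rfl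
    rw [← cs_single, shW_cs, D_cs, D_cs, map_smul, map_sub, shW_cs, ih, hs]
    congr 2
    cases w with
    | nil => simp
    | cons d w =>
      rw [← cs_single, shW_cs, ml_cs, ml_cs, Let.mul_shift hJ hF]
      cases Let.mul Q c d <;> simp

include hJ hF in
lemma zok_shift (l : List (Let σ)) : Zok P l ↔ ∃ l', Zok Q l' ∧ l'.map (Let.shift u) = l := by
  induction l with
  | nil => simp [Zok]
  | cons c w ih =>
    simp only [List.map_eq_cons_iff]
    cases c with
    | s β =>
      simp only [Zok, ih]
      constructor
      · rintro ⟨hβ, l', hl', rfl⟩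
        exact ⟨.s β :: l', ⟨hJ ▸ hβ, hl'⟩, .s β, l', rfl, rfl, rfl⟩
      · rintro ⟨_, hz, d, l', rfl, hd, rfl⟩
        cases d with
        | h a => cases hd
        | s γ => cases hd; exact ⟨hJ ▸ hz.1, l', hz.2, rfl⟩
    | h a =>
      simp only [Zok, hF]
      constructor
      · rintro ⟨⟨a, ha, rfl⟩, rfl⟩
        exact ⟨[.h a], ⟨ha, rfl⟩, .h a, [], rfl, rfl, rfl⟩
      · rintro ⟨_, hz, d, l', rfl, hd, rfl⟩
        cases d with
        | s γ => cases hd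
        | h b => cases hd; exact ⟨⟨b, hz.1, rfl⟩, by rw [hz.2]; rfl⟩

variable [Finite σ]

lemma Zok.wdeg_shift {l : List (Let σ)} (hl : Zok Q l) :
    wdeg 0 (l.map (Let.shift u)) = wdeg 0 l + ex u := by
  induction l with
  | nil => exact hl.elim
  | cons c w ih =>
    cases c with
    | s β =>
      rw [List.map_cons, wdeg_cons, wdeg_cons, ih hl.2, add_assoc]
      rfl
    | h a =>
      obtain ⟨-, rfl⟩ := hl
      simp [Let.shift, ldeg, ex_add, add_comm]

include hJ hF in
lemma cxZ_exact_shift {δ : Dg σ} (h : ∀ δ', δ = δ' + ex u → (cxZ k Q 0).Exact δ') :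
    (cxZ k P 0).Exact δ := by
  intro v hv hd
  by_cases hδ : ∃ δ', δ = δ' + ex u
  · obtain ⟨δ', rfl⟩ := hδ
    have hgr : ∀ δ, (cxZ k P 0).gr (δ + ex u) = ((cxZ k Q 0).gr δ).map (shW k u) := fun δ => by
      rw [shW, Cx.gr, Cx.gr, lmapDomain_supported]
      congr 1
      ext l
      constructor
      · rintro ⟨h1, h2⟩
        obtain ⟨l', hl', rfl⟩ := (zok_shift hJ hF l).1 h1
        refine ⟨l', ⟨hl', ?_⟩, rfl⟩
        exact add_right_cancel (hl'.wdeg_shift.symm.trans h2)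
      · rintro ⟨l', ⟨h1, h2⟩, rfl⟩
        exact ⟨(zok_shift hJ hF _).2 ⟨l', h1, rfl⟩, (Zok.wdeg_shift h1).trans (congrArg (· + _) h2)⟩
    have hv' := hv
    rw [hgr] at hv'
    obtain ⟨v', hv', rfl⟩ := hv'
    change D P (shW k u v') = 0 at hd
    rw [D_shW hJ hF] at hd
    have hinj : Function.Injective (shW k u) :=
      mapDomain_injective (List.map_injective_iff.2 (Let.shift_injective u))
    obtain ⟨w, hw, hw'⟩ := h δ' rfl v' hv' (hinj (hd.trans (map_zero _).symm))
    refine ⟨shW k u w, ?_, ?_⟩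
    · rw [add_right_comm, hgr]
      exact ⟨w, hw, rfl⟩
    · exact (D_shW hJ hF w).trans (congrArg _ hw')
  · refine ⟨0, Submodule.zero_mem _, ?_⟩
    have hv' : (cxZ k P 0).gr δ ≤ supported k k ∅ := supported_mono fun l hl => by
      obtain ⟨l', hl', rfl⟩ := (zok_shift hJ hF l).1 hl.1
      exact hδ ⟨_, hl.2.symm.trans hl'.wdeg_shift⟩
    have : v = 0 := by simpa using hv' hv
    rw [this, map_zero]

end Shift

section Augmentation

variable (k) in
/-- The contraction of the bar resolution. -/
def ctr : Wd k σ →ₗ[k] Wd k σ :=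
  wrec 0 (fun c => (-1 : k) • cs c) (fun c => match c with
    | .s _ => 0
    | .h a => if a = 0 then 0 else cs (.s a) ∘ₗ cs (.h 0))

@[simp] lemma ctr_s (β : Mon σ) (v : Wd k σ) : ctr k (cs (.s β) v) = -cs (.s β) (ctr k v) := by
  simp [ctr]

@[simp] lemma ctr_h (a : Mon σ) : ctr k (cs (.h a) (single [] (1 : k))) =
    if a = 0 then 0 else cs (.s a) (cs (.h 0) (single [] 1)) := by
  simp only [ctr, wrec_cs, wrec_nil, map_zero, zero_add]
  split_ifs <;> rfl

variable (hF : P.F = P.Jᶜ)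
include hF

omit hF in
lemma ml_ctr (β γ : Mon σ) (v : Wd k σ) :
    ctr k (csO (Let.mul P (.s β) (.s γ)) v) = -csO (Let.mul P (.s β) (.s γ)) (ctr k v) := by
  simp only [Let.mul]
  split_ifs <;> simp

lemma ctr_homotopy (l : List (Let σ)) (hl : Zok P l) :
    D P (ctr k (single l 1)) + ctr k (D P (single l 1)) =
      single l 1 - if l = [.h 0] then single l 1 else 0 := by
  have h0 : ∀ a, a ∉ P.J → (0 : Mon σ) ∉ P.J := fun a ha h => ha (by simpa using P.up 0 h a)
  have hm : ∀ a, a ∈ P.F ↔ a ∉ P.J := fun a => by rw [hF]; rfl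
  induction l with
  | nil => exact hl.elim
  | cons c w ih =>
    cases c with
    | h a =>
      obtain ⟨ha, rfl⟩ := hl
      rw [← cs_single]
      by_cases ha0 : a = 0
      · subst ha0; simp
      · have h1 : a ∉ P.J := (hm a).1 ha
        simp [ha0, Let.sg, Let.mul, hm, h0 a h1, h1]
    | s β =>
      have ih := ih hl.2
      have e : D P (ctr k (cs (.s β) (single w 1))) + ctr k (D P (cs (.s β) (single w 1))) =
          ctr k (ml P (.s β) (single w 1)) - ml P (.s β) (ctr k (single w 1)) +
            cs (.s β) (D P (ctr k (single w 1)) + ctr k (D P (single w 1))) := by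
        simp only [ctr_s, D_cs, map_neg, map_sub, map_add, Let.sg, one_smul]
        abel
      rw [← cs_single, e, ih, map_sub, if_neg (c := Let.s β :: w = [Let.h 0]) (by simp), sub_zero]
      cases w with
      | nil => exact hl.2.elim
      | cons d w =>
        cases d with
        | s γ =>
          rw [if_neg (by simp), ← cs_single]
          simp [ml_ctr]
        | h a =>
          obtain ⟨ha, rfl⟩ := hl.2
          have h1 : a ∉ P.J := (hm a).1 ha
          have hβ := hl.1
          rw [← cs_single]
          by_cases ha0 : a = 0
          · subst ha0
            simp [Let.mul, hm, h1, hβ.1, hβ.2]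
          · by_cases hb : β + a ∈ P.J <;> simp [Let.mul, hm, h1, hb, ha0]

lemma cxZ_exact_aug [Finite σ] {δ : Dg σ} (hδ : δ ≠ 0) : (cxZ k P 0).Exact δ := by
  refine Cx.exact_of_contraction _ (· ≠ 0) (ctr k) (fun _ => 0) ?_ ?_ δ hδ
  · intro l hl hne
    clear hne
    change Zok P l at hl
    change ctr k (single l 1) ∈ supported k k {l' | Zok P l' ∧ wdeg 0 l' = wdeg 0 l + zz}
    induction l with
    | nil => exact hl.elim
    | cons c w ih =>
      cases c with
      | h a =>
        obtain ⟨ha, rfl⟩ := hl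
        rw [← cs_single, ctr_h]
        split_ifs with h0
        · exact Submodule.zero_mem _
        · rw [cs_single, cs_single]
          have h1 : a ∉ P.J := by rw [hF] at ha; exact ha
          refine single_mem_supported k _ ⟨⟨⟨h0, h1⟩, ?_, rfl⟩, by simp [ldeg]⟩
          rw [hF]
          exact fun h => h1 (by simpa using P.up 0 h a)
      | s β =>
        rw [← cs_single, ctr_s]
        refine Submodule.neg_mem _ (cs_mem ?_ (ih hl.2))
        intro l' h'
        exact ⟨⟨hl.1, h'.1⟩, by rw [wdeg_cons, wdeg_cons, h'.2, add_assoc]⟩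
  · intro l hl hne
    change _ - (D P (ctr k _) + ctr k (D P _)) ∈ _
    rw [ctr_homotopy hF l hl, sub_sub_cancel, if_neg]
    · exact Submodule.zero_mem _
    · rintro rfl
      exact hne (by simp [cxZ, wordCx, ldeg])

end Augmentation

end Modules

end MonomialRings

namespace MonomialRings

open Finsupp hiding some

section Subquotients

variable {k : Type*} [Field k] {σ : Type*}

/-- A set of monomials closed under multiplication by monomials. -/
def Up (J : Set (Mon σ)) : Prop := ∀ β ∈ J, ∀ γ, β + γ ∈ J

lemma up_univ : Up (Set.univ : Set (Mon σ)) := fun _ _ _ => trivial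

lemma upperSet_up (M : Finset (Mon σ)) : Up (upperSet M) := fun _ ⟨m, hm, h⟩ _ =>
  ⟨m, hm, h.trans le_self_add⟩

lemma Up.union {J K : Set (Mon σ)} (hJ : Up J) (hK : Up K) : Up (J ∪ K) := fun β h γ =>
  h.imp (fun h => hJ β h γ) (fun h => hK β h γ)

lemma Up.add_left {J : Set (Mon σ)} (hJ : Up J) {β : Mon σ} (h : β ∈ J) (γ : Mon σ) :
    γ + β ∈ J := by
  rw [add_comm]; exact hJ β h γ

lemma Up.translate {J : Set (Mon σ)} (hJ : Up J) (u : Mon σ) : Up {β | u + β ∈ J} := fun β h γ => by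
  change u + (β + γ) ∈ J
  rw [← add_assoc]; exact hJ _ h γ

/-- The subquotient `K / L` of monomial ideals, over the quotient ring by `J`. -/
def Par.md (J L K : Set (Mon σ)) (hJ : Up J) (hL : Up L) (hK : Up K) (hJL : J ⊆ L) : Par σ where
  J := J
  F := K \ L
  up := hJ
  disj _ ha h := ha.2 (hJL h)
  conv _ β γ ha h := ⟨hK.add_left ha.1 β, fun hb => h.2 (hL.add_left hb γ)⟩

variable [Finite σ] {J K L : Set (Mon σ)} {δ : Dg σ}

lemma cxZ_exact_of_empty {P : Par σ} (h : P.F = ∅) : (cxZ k P 0).Exact δ := by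
  have : ∀ l, ¬ Zok P l := fun l => by
    induction l with
    | nil => exact id
    | cons c w ih =>
      cases c with
      | s β => exact fun hl => ih hl.2
      | h a => exact fun hl => by simpa [h] using hl.1
  intro v hv _
  refine ⟨0, Submodule.zero_mem _, ?_⟩
  have hv' : (cxZ k P 0).gr δ ≤ supported k k ∅ := supported_mono fun l hl => this l hl.1
  have : v = 0 := by simpa using hv' hv
  rw [this, map_zero]

variable (k) in
/-- Exactness of the bar resolution of `K / L` over the quotient ring by `J`. -/
def MdExact (J L K : Set (Mon σ)) (δ : Dg σ) : Prop :=
  ∀ P : Par σ, P.J = J → P.F = K \ L → (cxZ k P 0).Exact δ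

omit [Finite σ] in
lemma md_ext (hJ : Up J) (hL : Up L) (hK : Up K) (hJL : J ⊆ L) (hLK : L ⊆ K) :
    (Par.md J J K hJ hJ hK subset_rfl).Ext (.md J L K hJ hL hK hJL)
      (.md J J L hJ hJ hL subset_rfl) where
  J1 := rfl
  J2 := rfl
  F_iff a := by
    change a ∈ K ∧ a ∉ J ↔ (a ∈ K ∧ a ∉ L) ∨ (a ∈ L ∧ a ∉ J)
    have := @hJL a
    have := @hLK a
    tauto
  disj _ h h' := h.2 h'.1
  up _ ha β hb := ⟨hL.add_left ha.1 β, hb.2⟩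

omit [Finite σ] in
lemma md_eq {P : Par σ} (hJ : Up J) (hL : Up L) (hK : Up K) (hJL : J ⊆ L) (h1 : P.J = J)
    (h2 : P.F = K \ L) : P = .md J L K hJ hL hK hJL := by
  cases P
  subst h1 h2
  rfl

lemma MdExact.extension (hJ : Up J) (hL : Up L) (hK : Up K) (hJL : J ⊆ L) (hLK : L ⊆ K)
    (h1 : MdExact k J L K δ) (h2 : MdExact k J J L δ) : MdExact k J J K δ := by
  intro P hP hP'
  rw [md_eq hJ hJ hK subset_rfl hP hP']
  exact ((md_ext hJ hL hK hJL hLK).cxZ 0).exact (h1 _ rfl rfl) (h2 _ rfl rfl)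

lemma MdExact.univ (hJ : Up J) (hL : Up L) (hJL : J ⊆ L) (hδ : δ ≠ 0)
    (h : ∀ δ', δ = δ' + zz → MdExact k J J L δ') : MdExact k J L Set.univ δ := by
  intro P hP hP'
  rw [md_eq hJ hL up_univ hJL hP hP']
  exact ((md_ext hJ hL up_univ hJL (Set.subset_univ L)).cxZ 0).exact_quotient
    (cxZ_exact_aug (Set.compl_eq_univ_sdiff _).symm hδ) fun δ' h' => h δ' h' _ rfl rfl

lemma MdExact.cyclic (hJ : Up J) (hL : Up L) (hJL : J ⊆ L) {u : Mon σ}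
    (hu : ∀ β, β ∈ K ↔ β ∈ L ∨ u ≤ β)
    (h : ∀ δ', δ = δ' + ex u → MdExact k J {β | u + β ∈ L} Set.univ δ') : MdExact k J L K δ := by
  intro P hP hP'
  let Q : Par σ := .md J {β | u + β ∈ L} Set.univ hJ (hL.translate u) up_univ
    fun _ hβ => hL.add_left (hJL hβ) u
  refine cxZ_exact_shift (Q := Q) hP.symm (u := u) ?_ fun δ' h' => h δ' h' _ rfl rfl
  ext β
  rw [hP']
  change β ∈ K ∧ β ∉ L ↔ ∃ γ, (γ ∈ Set.univ ∧ u + γ ∉ L) ∧ u + γ = β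
  rw [hu]
  constructor
  · rintro ⟨h1, h2⟩
    obtain ⟨γ, rfl⟩ := exists_add_of_le (h1.resolve_left h2)
    exact ⟨γ, ⟨trivial, h2⟩, rfl⟩
  · rintro ⟨γ, ⟨-, h2⟩, rfl⟩
    exact ⟨.inr le_self_add, h2⟩

omit [Finite σ] in
/-- The set of generators of a colon ideal. -/
lemma translate_upperSet (M U : Finset (Mon σ)) (u : Mon σ) :
    {β | u + β ∈ upperSet M ∪ upperSet U} = upperSet M ∪
      upperSet (U.image (· - u) ∪ (M.filter (NCF u)).image (· - u)) := by
  ext β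
  simp only [upperSet, Set.mem_union, Set.mem_ofPred_eq, Finset.mem_union, Finset.mem_image,
    Finset.mem_filter]
  constructor
  · rintro (⟨m, hm, h⟩ | ⟨m, hm, h⟩)
    · by_cases hn : NCF u m
      · exact .inr ⟨m - u, .inr ⟨m, ⟨hm, hn⟩, rfl⟩, tsub_le_iff_left.2 h⟩
      · refine .inl ⟨m, hm, fun i => ?_⟩
        by_cases hi : m i = 0
        · rw [hi]; exact Nat.zero_le _
        · have : u i = 0 := by by_contra hu; exact hn ⟨i, hu, hi⟩
          have := h i
          rwa [Pi.add_apply, ‹u i = 0›, zero_add] at this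
    · exact .inr ⟨m - u, .inl ⟨m, hm, rfl⟩, tsub_le_iff_left.2 h⟩
  · rintro (⟨m, hm, h⟩ | ⟨_, ⟨m, hm, rfl⟩ | ⟨m, hm, rfl⟩, h⟩)
    · exact .inl ⟨m, hm, h.trans le_add_self⟩
    · exact .inr ⟨m, hm, tsub_le_iff_left.1 h⟩
    · exact .inl ⟨m, hm.1, tsub_le_iff_left.1 h⟩

lemma ex_le_iff {u : Mon σ} : ex u ≤ δ ↔ ∀ i, u i ≤ δ (some i) := by
  rw [Finsupp.le_def]
  exact ⟨fun h i => h (some i), fun h o => by cases o with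
    | none => exact Nat.zero_le _
    | some i => exact h i⟩

variable (k) in
lemma md_not_exact (M U : Finset (Mon σ)) (δ : Dg σ) (hsq : ∀ i, δ (some i) ≤ 1)
    (hne : ¬ MdExact k (upperSet M) (upperSet M) (upperSet M ∪ upperSet U) δ) :
    ∃ U0 ⊆ U, U0.Nonempty ∧ ∃ S0 ⊆ M, (∀ u ∈ U0, ex u ≤ δ) ∧ (∀ s ∈ S0, ex s ≤ δ) ∧
      δ none + 1 ≤ U0.card + S0.card := by
  induction hn : δ.degree using Nat.strong_induction_on generalizing δ U with
  | _ n ih =>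
  induction U using Finset.induction_on with
  | empty =>
    refine absurd (fun P _ hP => cxZ_exact_of_empty ?_) hne
    simp [hP, upperSet]
  | insert u U hu ihU =>
    by_cases hex : MdExact k (upperSet M) (upperSet M) (upperSet M ∪ upperSet U) δ
    swap
    · obtain ⟨U0, h1, h2, S0, h3⟩ := ihU hex
      exact ⟨U0, h1.trans (Finset.subset_insert _ _), h2, S0, h3⟩
    have hins : ∀ β, β ∈ upperSet M ∪ upperSet (insert u U) ↔
        β ∈ upperSet M ∪ upperSet U ∨ u ≤ β := fun β => by
      simp only [upperSet, Set.mem_union, Set.mem_ofPred_eq, Finset.mem_insert,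
        exists_eq_or_imp]
      exact ⟨fun h => by rcases h with h | h | h <;> simp [h], fun h => by
        rcases h with (h | h) | h <;> simp [h]⟩
    have hM := upperSet_up M
    have hMU := hM.union (upperSet_up U)
    obtain ⟨δ', hδ', hne'⟩ : ∃ δ', δ = δ' + ex u ∧ ¬ MdExact k (upperSet M)
        {β | u + β ∈ upperSet M ∪ upperSet U} Set.univ δ' := by
      by_contra! hc
      exact hne (.extension hM hMU (hM.union (upperSet_up _)) Set.subset_union_left
        (fun β hβ => (hins β).2 (.inl hβ)) (.cyclic hM hMU Set.subset_union_left hins hc) hex)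
    by_cases h0 : δ' = 0
    · subst h0
      rw [zero_add] at hδ'
      subst hδ'
      exact ⟨{u}, by simp, by simp, ∅, by simp⟩
    obtain ⟨ε, rfl, hε⟩ : ∃ ε, δ' = ε + zz ∧ ¬ MdExact k (upperSet M) (upperSet M)
        {β | u + β ∈ upperSet M ∪ upperSet U} ε := by
      by_contra! hc
      exact hne' (.univ hM (hMU.translate u)
        (fun β hβ => Or.inl (hM.add_left hβ u)) h0 hc)
    rw [translate_upperSet] at hε
    have hle : ∀ i, ε (some i) + u i = δ (some i) := fun i => by rw [hδ']; simp [zz]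
    obtain ⟨U0, hU0, hU0n, S0, hS0, hU, hS, hcard⟩ := ih ε.degree
      (by rw [← hn, hδ', map_add, map_add]; simp [zz, Finsupp.degree_single]; omega) _ ε
      (fun i => (Nat.le_add_right _ _).trans ((hle i).trans_le (hsq i))) hε rfl
    have hUle : ∀ m : Mon σ, m - u ∈ U0 → ex m ≤ δ := fun m hm => by
      refine ex_le_iff.2 fun i => ?_
      have := ex_le_iff.1 (hU _ hm) i
      rw [Pi.sub_apply] at this
      have := hle i
      omega
    refine ⟨insert u (U.filter fun v => v - u ∈ U0),
      Finset.insert_subset_insert _ (Finset.filter_subset _ _), Finset.insert_nonempty _ _,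
      S0 ∪ M.filter fun s => NCF u s ∧ s - u ∈ U0,
      Finset.union_subset hS0 (Finset.filter_subset _ _), ?_, ?_, ?_⟩
    · simp only [Finset.mem_insert, Finset.mem_filter, forall_eq_or_imp]
      exact ⟨hδ' ▸ le_add_self, fun v hv => hUle v hv.2⟩
    · simp only [Finset.mem_union, Finset.mem_filter]
      rintro s (hs | ⟨-, -, hs⟩)
      · refine (hS s hs).trans ?_
        rw [hδ', add_assoc]
        exact le_self_add
      · exact hUle s hs
    · rw [Finset.card_insert_of_notMem (by simp [hu]), Finset.card_union_of_disjoint]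
      · have h1 : U0 ⊆ (U.filter fun v => v - u ∈ U0).image (· - u) ∪
            (M.filter fun s => NCF u s ∧ s - u ∈ U0).image (· - u) := fun v hv => by
          have := hU0 hv
          simp only [Finset.mem_union, Finset.mem_image, Finset.mem_filter] at this ⊢
          rcases this with ⟨w, h1, rfl⟩ | ⟨w, ⟨h1, h2⟩, rfl⟩
          · exact .inl ⟨w, ⟨h1, hv⟩, rfl⟩
          · exact .inr ⟨w, ⟨h1, h2, hv⟩, rfl⟩
        have h2 := (Finset.card_le_card h1).trans ((Finset.card_union_le _ _).trans
          (Nat.add_le_add Finset.card_image_le Finset.card_image_le))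
        have h3 : δ none = ε none + 1 := by rw [hδ']; simp [zz]
        omega
      · refine Finset.disjoint_left.2 fun s h1 h2 => ?_
        obtain ⟨i, hi, hi'⟩ := (Finset.mem_filter.1 h2).2.1
        have := ex_le_iff.1 (hS s h1) i
        have := hle i
        have := hsq i
        omega

end Subquotients

end MonomialRings

namespace MonomialRings

open Finsupp hiding some

section Denominators

variable (k : Type*) [Field k] {σ : Type*}

/-- The subquotient attached to two sets of generators. -/
def Par.gen (M V : Finset (Mon σ)) : Par σ :=
  .md (upperSet M) (upperSet M) (upperSet M ∪ upperSet V) (upperSet_up M) (upperSet_up M)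
    ((upperSet_up M).union (upperSet_up V)) subset_rfl

variable {M V : Finset (Mon σ)} {y : σ}

lemma upperSet_add_va (h : ∀ m ∈ M, m y = 0) (β : Mon σ) :
    β + va y ∈ upperSet M ↔ β ∈ upperSet M := by
  refine ⟨fun ⟨m, hm, hle⟩ => ⟨m, hm, fun i => ?_⟩, fun hβ => upperSet_up M β hβ _⟩
  by_cases hi : i = y
  · rw [hi, h m hm]; exact Nat.zero_le _
  · simpa [va_of_ne hi] using hle i

lemma Par.gen_free (hM : ∀ m ∈ M, m y = 0) (hV : ∀ v ∈ V, v y = 0) : (Par.gen M V).Free y where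
  J_iff := upperSet_add_va hM
  F_iff a := by
    change (_ ∨ _) ∧ _ ↔ (_ ∨ _) ∧ _
    simp only [upperSet_add_va hM, upperSet_add_va hV]

lemma Par.gen_mult (hM : ∀ m ∈ M, ¬ m ≤ va y) (hV : ∀ v ∈ V, v ≠ 0)
    (h : ∀ m ∈ M, ∀ v ∈ V, m y ≤ v y) : (Par.gen M V).Mult (va y) where
  ne h0 := by simpa using congrFun h0 y
  notMem := fun ⟨m, hm, hle⟩ => hM m hm hle
  ann := by
    rintro a ⟨ha | ⟨v, hv, hva⟩, ha'⟩ ⟨m, hm, hle⟩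
    · exact ha' ha
    · refine ha' ⟨m, hm, fun i => ?_⟩
      by_cases hi : i = y
      · rw [hi]; exact (h m hm v hv).trans (hva y)
      · simpa [va_of_ne hi] using hle i
  ideal a ha β hb := ⟨((upperSet_up M).union (upperSet_up V)).add_left ha.1 β, hb⟩
  ne_zero := by
    rintro a ⟨⟨m, hm, hle⟩ | ⟨v, hv, hle⟩, -⟩ rfl
    · exact hM m hm (hle.trans fun _ => Nat.zero_le _)
    · exact hV v hv (le_antisymm hle fun _ => Nat.zero_le _)

variable [DecidableEq (Mon σ)]

lemma Par.gen_quo (h : (Par.gen M V).Mult (va y)) :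
    h.quo.J = upperSet (M ∪ V.image (· + va y)) := by
  ext β
  change β ∈ upperSet M ∨ β ∈ (va y + ·) '' ((upperSet M ∪ upperSet V) \ upperSet M) ↔ _
  constructor
  · rintro (⟨m, hm, hle⟩ | ⟨a, ⟨⟨m, hm, hle⟩ | ⟨v, hv, hle⟩, ha⟩, rfl⟩)
    · exact ⟨m, Finset.mem_union_left _ hm, hle⟩
    · exact ⟨m, Finset.mem_union_left _ hm, hle.trans le_add_self⟩
    · refine ⟨v + va y, Finset.mem_union_right _ (Finset.mem_image_of_mem _ hv), ?_⟩
      change _ ≤ va y + a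
      rw [add_comm]
      exact add_le_add_right hle _
  · rintro ⟨m, hm, hle⟩
    rcases Finset.mem_union.1 hm with hm | hm
    · exact .inl ⟨m, hm, hle⟩
    · obtain ⟨v, hv, rfl⟩ := Finset.mem_image.1 hm
      obtain ⟨γ, rfl⟩ := exists_add_of_le hle
      by_cases hγ : v + γ ∈ upperSet M
      · left
        rw [add_right_comm]
        exact upperSet_up M _ hγ _
      · exact .inr ⟨v + γ, ⟨.inr ⟨v, hv, le_self_add⟩, hγ⟩, by
          change va y + (v + γ) = _; abel⟩

variable (M y) in
/-- The set of generators not divisible by a variable, and the remaining ones. -/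
lemma split_generators (e : ℕ) (he : e ≠ 0) (hM : ∀ m ∈ M, m y ≤ e) :
    (M.filter (· y < e)) ∪ ((M.filter (· y = e)).image (· - va y)).image (· + va y) = M := by
  ext m
  simp only [Finset.mem_union, Finset.mem_filter, Finset.mem_image]
  constructor
  · rintro (h | ⟨_, ⟨m, h, rfl⟩, rfl⟩)
    · exact h.1
    · rw [sub_va_add (by omega)]
      exact h.1
  · intro hm
    rcases (hM m hm).lt_or_eq with h | h
    · exact .inl ⟨hm, h⟩
    · exact .inr ⟨_, ⟨m, ⟨hm, h⟩, rfl⟩, sub_va_add (by omega)⟩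

variable {k} [Finite σ]

omit [DecidableEq (Mon σ)] [Finite σ] in
lemma coeff_mul_one_sub {b T : MvPowerSeries (Option σ) ℤ} {e δ : Dg σ}
    (h : MvPowerSeries.coeff δ (b * (1 - MvPowerSeries.monomial e 1 * T)) ≠ 0) :
    MvPowerSeries.coeff δ b ≠ 0 ∨ ∃ δ1 δ2, δ = δ1 + (e + δ2) ∧ MvPowerSeries.coeff δ1 b ≠ 0 ∧
      MvPowerSeries.coeff δ2 T ≠ 0 := by
  by_cases h0 : MvPowerSeries.coeff δ b = 0
  swap
  · exact .inl h0
  right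
  rw [mul_sub, mul_one, map_sub, h0, zero_sub, neg_ne_zero, MvPowerSeries.coeff_mul] at h
  obtain ⟨⟨δ1, ε⟩, hp, hne⟩ := Finset.exists_ne_zero_of_sum_ne_zero h
  rw [MvPowerSeries.coeff_monomial_mul] at hne
  split_ifs at hne with hle
  · obtain ⟨δ2, rfl⟩ := exists_add_of_le hle
    refine ⟨δ1, δ2, (Finset.HasAntidiagonal.mem_antidiagonal.1 hp).symm,
      left_ne_zero_of_mul hne, ?_⟩
    have := right_ne_zero_of_mul hne
    rwa [one_mul, add_tsub_cancel_left] at this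
  · simp at hne

omit [DecidableEq (Mon σ)] in
lemma not_exact_of_coeff_tser {P : Par σ} {δ : Dg σ} (h : MvPowerSeries.coeff δ (tser k P) ≠ 0) :
    ¬ (cxZ k P 0).Exact δ := fun he => h (by
  rw [tser, Cx.coeff_series, he.hdim, Nat.cast_zero])

/-- The expected bound for the multidegrees of the denominator. -/
def DegBound (M : Finset (Mon σ)) (δ : Dg σ) : Prop :=
  ∃ S ⊆ M, ∃ D ⊆ M, Discrete D ∧ (∀ m ∈ S, ex m ≤ δ) ∧ (∀ m ∈ D, ex m ≤ δ) ∧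
    δ none ≤ S.card + D.card

lemma DegBound.extend {U : Finset (Mon σ)} {δ1 δ2 : Dg σ}
    (hM : ∀ m ∈ M, m ≠ 0) (hMy : ∀ m ∈ M, m y = 0)
    (hsq : ∀ i, (δ1 + (sh2 (va y) + δ2)) (some i) ≤ 1) (h1 : DegBound M δ1)
    (hU : U ⊆ V) (hUn : U.Nonempty) {S : Finset (Mon σ)} (hS : S ⊆ M)
    (hUle : ∀ u ∈ U, ex u ≤ δ2) (hSle : ∀ s ∈ S, ex s ≤ δ2) (hc : δ2 none + 1 ≤ U.card + S.card) :
    DegBound (M ∪ V.image (· + va y)) (δ1 + (sh2 (va y) + δ2)) := by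
  obtain ⟨S1, hS1, D1, hD1, hdisc, hS1le, hD1le, hc1⟩ := h1
  obtain ⟨u, hu⟩ := hUn
  have hUy : ∀ v : Mon σ, v + va y ∉ M := fun v hv => by simpa using hMy _ hv
  have hle2 : ∀ v ∈ U, ex (v + va y) ≤ δ1 + (sh2 (va y) + δ2) := fun v hv => by
    rw [ex_add, sh2]
    have := hUle v hv
    exact le_add_left <| by
      rw [add_comm, add_assoc (zz + zz)]
      exact le_add_left (add_le_add_right this _)
  have hcop : ∀ m v : Mon σ, ex m ≤ δ1 → ex v ≤ δ2 → ∀ i, m i = 0 ∨ v i = 0 := fun m v h1 h2 i => by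
    have h1 := ex_le_iff.1 h1 i
    have h2 := ex_le_iff.1 h2 i
    have h3 := hsq i
    simp only [Finsupp.add_apply] at h3
    omega
  refine ⟨S1 ∪ S ∪ U.image (· + va y), ?_, insert (u + va y) D1, ?_, ?_, ?_, ?_, ?_⟩
  · exact Finset.union_subset_union (Finset.union_subset hS1 hS) (Finset.image_subset_image hU)
  · exact Finset.insert_subset (Finset.mem_union_right _ (Finset.mem_image_of_mem _ (hU hu)))
      (hD1.trans Finset.subset_union_left)
  · have key : ∀ d ∈ D1, ¬ NCF d (u + va y) := fun d hd ⟨i, h1, h2⟩ => by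
      by_cases hi : i = y
      · exact h1 (hi ▸ hMy d (hD1 hd))
      · rcases hcop d u (hD1le d hd) (hUle u hu) i with h | h
        · exact h1 h
        · exact h2 (by simp [h, va_of_ne hi])
    have hsymm : ∀ a b : Mon σ, NCF a b → NCF b a := fun a b ⟨i, h1, h2⟩ => ⟨i, h2, h1⟩
    intro a ha b hb hab
    rcases Finset.mem_insert.1 ha with rfl | ha <;> rcases Finset.mem_insert.1 hb with rfl | hb
    · exact absurd rfl hab
    · exact fun h => key b hb (hsymm _ _ h)
    · exact key a ha
    · exact hdisc a ha b hb hab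
  · simp only [Finset.mem_union, Finset.mem_image]
    rintro m ((hm | hm) | ⟨v, hv, rfl⟩)
    · exact (hS1le m hm).trans le_self_add
    · exact (hSle m hm).trans (le_add_left le_add_self)
    · exact hle2 v hv
  · simp only [Finset.mem_insert]
    rintro m (rfl | hm)
    · exact hle2 u hu
    · exact (hD1le m hm).trans le_self_add
  · rw [Finset.card_insert_of_notMem fun h => hUy u (hD1 h), Finset.card_union_of_disjoint,
      Finset.card_union_of_disjoint, Finset.card_image_of_injective _ (add_left_injective _)]
    · simp only [Finsupp.add_apply, sh2_none]
      omega
    · refine Finset.disjoint_left.2 fun m h1 h2 => hM m (hS h2) (funext fun i => ?_)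
      exact (hcop m m (hS1le m h1) (hSle m h2) i).elim id id
    · refine Finset.disjoint_left.2 fun m h1 h2 => ?_
      obtain ⟨v, -, rfl⟩ := Finset.mem_image.1 h2
      exact hUy v (Finset.union_subset hS1 hS h1)

end Denominators

end MonomialRings

namespace MonomialRings

open Finsupp hiding some

section Squarefree

variable (k : Type*) [Field k] {σ : Type*} [Fintype σ]

/-- No monomial in the set is a unit or a variable. -/
def NonLinear (M : Finset (Mon σ)) : Prop := ∀ m ∈ M, m ≠ 0 ∧ ∀ y, ¬ m ≤ va y

/-- `b` is the denominator of the Poincaré series of the ring defined by `M`. -/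
def Denom (M : Finset (Mon σ)) (b : MvPowerSeries (Option σ) ℤ) : Prop :=
  b * pser k (upperSet M) = ∏ i : σ, (1 + MvPowerSeries.X (some i) * MvPowerSeries.X none)

variable {k} {M : Finset (Mon σ)} {y : σ}

omit [Fintype σ] in
lemma NonLinear.mono {N : Finset (Mon σ)} (h : NonLinear M) (hN : N ⊆ M) : NonLinear N :=
  fun m hm => h m (hN hm)

lemma DegBound.mono {N : Finset (Mon σ)} {δ : Dg σ} (h : DegBound M δ) (hN : M ⊆ N) :
    DegBound N δ := by
  obtain ⟨S, hS, D, hD, h⟩ := h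
  exact ⟨S, hS.trans hN, D, hD.trans hN, h⟩

lemma Denom.unique {b c : MvPowerSeries (Option σ) ℤ} (hb : Denom k M b) (hc : Denom k M c) :
    b = c := by
  refine mul_right_cancel₀ (b := pser k (upperSet M)) (fun h0 => ?_) (hb.trans hc.symm)
  have := congrArg MvPowerSeries.constantCoeff hb
  rw [h0, mul_zero, map_zero, map_prod] at this
  simp at this

lemma quo_mult {e : ℕ} (hM : NonLinear M) :
    (Par.gen (M.filter (· y < e)) ((M.filter (· y = e)).image (· - va y))).Mult (va y) := by
  refine Par.gen_mult (fun m hm => (hM m (Finset.filter_subset _ _ hm)).2 y) ?_ ?_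
  · intro v hv h0
    obtain ⟨m, hm, rfl⟩ := Finset.mem_image.1 hv
    exact (hM m (Finset.filter_subset _ _ hm)).2 y (tsub_eq_zero_iff_le.1 h0)
  · intro m hm v hv
    obtain ⟨n, hn, rfl⟩ := Finset.mem_image.1 hv
    have h1 := (Finset.mem_filter.1 hm).2
    have h2 := (Finset.mem_filter.1 hn).2
    rw [Pi.sub_apply, va_self]
    omega

lemma Denom.quo {b : MvPowerSeries (Option σ) ℤ} {V : Finset (Mon σ)} (hb : Denom k M b)
    (h : (Par.gen M V).Mult (va y)) :
    Denom k (M ∪ V.image (· + va y))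
      (b * (1 - MvPowerSeries.monomial (sh2 (va y)) 1 * tser k (Par.gen M V))) := by
  have := h.golod (k := k)
  rw [Par.gen_quo h] at this
  rw [Denom, ← hb, mul_assoc, mul_comm (1 - _), ← this]
  rfl

lemma denom_step {b : MvPowerSeries (Option σ) ℤ} (hM : NonLinear M)
    (hsq : ∀ m ∈ M, ∀ i, m i ≤ 1)
    (hb : Denom k (M.filter (· y < 1)) b)
    (hb1 : ∀ δ, MvPowerSeries.coeff δ b ≠ 0 →
      (∀ i, (∀ m ∈ M.filter (· y < 1), m i = 0) → δ (some i) = 0) ∧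
      DegBound (M.filter (· y < 1)) δ) :
    ∃ c, Denom k M c ∧ ∀ δ, MvPowerSeries.coeff δ c ≠ 0 → δ (some y) ≤ 1 ∧
      (∀ i, i ≠ y → (∀ m ∈ M, m i = 0) → δ (some i) = 0) ∧
      ((∀ i, δ (some i) ≤ 1) → DegBound M δ) := by
  set N := M.filter (· y < 1)
  set V := (M.filter (· y = 1)).image (· - va y)
  have hmul : (Par.gen N V).Mult (va y) := quo_mult hM
  have hsplit : N ∪ V.image (· + va y) = M :=
    split_generators M y 1 one_ne_zero fun m hm => hsq m hm y
  have hc := hb.quo hmul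
  rw [hsplit] at hc
  have hNy : ∀ m ∈ N, m y = 0 := fun m hm => Nat.lt_one_iff.1 (Finset.mem_filter.1 hm).2
  have hVy : ∀ v ∈ V, v y = 0 := fun v hv => by
    obtain ⟨m, hm, rfl⟩ := Finset.mem_image.1 hv
    simp [(Finset.mem_filter.1 hm).2]
  have hNM : N ⊆ M := Finset.filter_subset _ _
  have hVi : ∀ i, (∀ m ∈ M, m i = 0) → ∀ v ∈ V, v i = 0 := fun i h v hv => by
    obtain ⟨m, hm, rfl⟩ := Finset.mem_image.1 hv
    simp [h m (Finset.filter_subset _ _ hm)]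
  have hT : ∀ i, (∀ m ∈ N, m i = 0) → (∀ v ∈ V, v i = 0) → ∀ δ,
      MvPowerSeries.coeff δ (tser k (Par.gen N V)) ≠ 0 → δ (some i) = 0 := fun i h1 h2 δ h => by
    by_contra h0
    exact h (coeff_tser_of_free (Par.gen_free h1 h2) h0)
  refine ⟨_, hc, fun δ hδ => ?_⟩
  rcases coeff_mul_one_sub hδ with h | ⟨δ1, δ2, rfl, h1, h2⟩
  · refine ⟨?_, fun i _ hi => (hb1 δ h).1 i fun m hm => hi m (hNM hm),
      fun _ => (hb1 δ h).2.mono hNM⟩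
    rw [(hb1 δ h).1 y hNy]
    exact Nat.zero_le _
  · refine ⟨?_, fun i hiy hi => ?_, fun hs => ?_⟩
    · simp [(hb1 δ1 h1).1 y hNy, hT y hNy hVy δ2 h2, sh2, zz]
    · simp [(hb1 δ1 h1).1 i fun m hm => hi m (hNM hm),
        hT i (fun m hm => hi m (hNM hm)) (hVi i hi) δ2 h2, sh2, zz, hiy]
    · have hne := not_exact_of_coeff_tser h2
      obtain ⟨U, hU, hUn, S, hS, hUle, hSle, hcard⟩ := md_not_exact k N V δ2
        (fun i => by have := hs i; simp only [Finsupp.add_apply] at this; omega)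
        (fun h => hne (h _ rfl rfl))
      rw [← hsplit]
      exact (hb1 δ1 h1).2.extend (fun m hm => (hM m (hNM hm)).1) hNy hs hU hUn hS hUle hSle hcard

variable (k) in
/-- The denominator for square-free monomials. -/
theorem exists_denom_of_squarefree (M : Finset (Mon σ)) (hM : NonLinear M)
    (hsq : ∀ m ∈ M, ∀ i, m i ≤ 1) :
    ∃ b, Denom k M b ∧ ∀ δ, MvPowerSeries.coeff δ b ≠ 0 →
      (∀ i, (∀ m ∈ M, m i = 0) → δ (some i) = 0) ∧ DegBound M δ := by
  induction M using Finset.strongInduction with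
  | H M ih =>
  have step : ∀ y, (∃ m ∈ M, m y ≠ 0) → ∃ c, Denom k M c ∧ ∀ δ, MvPowerSeries.coeff δ c ≠ 0 →
      δ (some y) ≤ 1 ∧ (∀ i, i ≠ y → (∀ m ∈ M, m i = 0) → δ (some i) = 0) ∧
      ((∀ i, δ (some i) ≤ 1) → DegBound M δ) := fun y ⟨m, hm, hmy⟩ => by
    obtain ⟨b, hb, hb1⟩ := ih (M.filter (· y < 1))
      (Finset.filter_ssubset.2 ⟨m, hm, by omega⟩) (hM.mono (Finset.filter_subset _ _))
      (fun m hm => hsq m (Finset.filter_subset _ _ hm))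
    exact denom_step hM hsq hb hb1
  rcases M.eq_empty_or_nonempty with rfl | ⟨m, hm⟩
  · refine ⟨1, ?_, fun δ hδ => ?_⟩
    · rw [Denom, one_mul, ← pser_empty (k := k)]
      congr 1
      ext β
      simp [upperSet]
    · rw [MvPowerSeries.coeff_one] at hδ
      obtain rfl : δ = 0 := by by_contra h; simp [h] at hδ
      exact ⟨fun _ _ => rfl, ∅, by simp, ∅, by simp, by simp [Discrete], by simp, by simp, by simp⟩
  · obtain ⟨y, hy⟩ := Function.ne_iff.1 (hM m hm).1
    obtain ⟨b, hb, hb1⟩ := step y ⟨m, hm, hy⟩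
    have key : ∀ δ, MvPowerSeries.coeff δ b ≠ 0 → ∀ i, (∃ m ∈ M, m i ≠ 0) → δ (some i) ≤ 1 :=
      fun δ hδ i hi => by
        obtain ⟨c, hc, hc1⟩ := step i hi
        exact (hc1 δ (hb.unique hc ▸ hδ)).1
    have key2 : ∀ δ, MvPowerSeries.coeff δ b ≠ 0 → ∀ i, (∀ m ∈ M, m i = 0) → δ (some i) = 0 :=
      fun δ hδ i hi => (hb1 δ hδ).2.1 i (by rintro rfl; exact hy (hi m hm)) hi
    refine ⟨b, hb, fun δ hδ => ⟨key2 δ hδ, (hb1 δ hδ).2.2 fun i => ?_⟩⟩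
    by_cases hi : ∃ m ∈ M, m i ≠ 0
    · exact key δ hδ i hi
    · push Not at hi
      rw [key2 δ hδ i hi]
      exact Nat.zero_le _

end Squarefree

end MonomialRings

namespace MonomialRings

open Finsupp hiding some

section Polarization

variable (k : Type*) [Field k] {σ : Type*} [Fintype σ]

/-- The specialization identifying all variables other than `z`. -/
def spz (σ : Type*) [Fintype σ] :
    MvPowerSeries (Option σ) ℤ →ₐ[ℤ] MvPowerSeries (Option Unit) ℤ :=
  MvPowerSeries.rename (Option.map fun _ : σ => ())

/-- The number of monomials plus the maximal size of a discrete subset. -/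
def degBd (M : Finset (Mon σ)) : ℕ := M.card + (M.powerset.filter Discrete).sup Finset.card

/-- The common value of the specialized numerator factors. -/
def spNum : MvPowerSeries (Option Unit) ℤ := 1 + MvPowerSeries.X (some ()) * MvPowerSeries.X none

/-- The degree bound for the specialized denominator. -/
def SpecBound (M : Finset (Mon σ)) : Prop :=
  ∀ c : MvPowerSeries (Option Unit) ℤ, c * spz σ (pser k (upperSet M)) = spNum ^ Fintype.card σ →
    ∀ δ, MvPowerSeries.coeff δ c ≠ 0 → δ none ≤ degBd M

variable {k} {M : Finset (Mon σ)}

lemma spz_X (o : Option σ) : spz σ (MvPowerSeries.X o) = MvPowerSeries.X (o.map fun _ => ()) :=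
  MvPowerSeries.rename_X _ _

lemma spz_factor (i : σ) :
    spz σ (1 + MvPowerSeries.X (some i) * MvPowerSeries.X none) = spNum := by
  rw [map_add, map_one, map_mul, spz_X, spz_X]
  rfl

lemma spNum_ne_zero : spNum ≠ 0 := fun h => by
  have := congrArg MvPowerSeries.constantCoeff h
  simp [spNum] at this

lemma exists_of_coeff_spz {b : MvPowerSeries (Option σ) ℤ} {δ : Option Unit →₀ ℕ}
    (h : MvPowerSeries.coeff δ (spz σ b) ≠ 0) :
    ∃ ε, MvPowerSeries.coeff ε b ≠ 0 ∧ ε none = δ none := by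
  rw [spz, MvPowerSeries.coeff_rename] at h
  obtain ⟨ε, hε, hne⟩ := Finset.exists_ne_zero_of_sum_ne_zero h
  refine ⟨ε, hne, ?_⟩
  obtain rfl : Finsupp.mapDomain _ ε = δ := by simpa using hε
  rw [Finsupp.mapDomain, Finsupp.sum_apply, Finsupp.sum, Finset.sum_eq_single none]
  · simp
  · rintro (_ | i) - hi
    · exact absurd rfl hi
    · simp
  · simp

lemma DegBound.le {δ : Dg σ} (h : DegBound M δ) : δ none ≤ degBd M := by
  obtain ⟨S, hS, D, hD, hdisc, -, -, h⟩ := h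
  refine h.trans (add_le_add (Finset.card_le_card hS) ?_)
  exact Finset.le_sup (f := Finset.card) (Finset.mem_filter.2 ⟨Finset.mem_powerset.2 hD, hdisc⟩)

lemma specBound_of_squarefree (hM : NonLinear M) (hsq : ∀ m ∈ M, ∀ i, m i ≤ 1) :
    SpecBound k M := by
  obtain ⟨b, hb, hb1⟩ := exists_denom_of_squarefree k M hM hsq
  intro c hc δ hδ
  have h1 : spz σ b * spz σ (pser k (upperSet M)) = spNum ^ Fintype.card σ := by
    rw [← map_mul, hb, map_prod, Finset.prod_congr rfl fun i _ => spz_factor i, Finset.prod_const,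
      Finset.card_univ]
  have h2 : c = spz σ b := by
    refine mul_right_cancel₀ (fun h0 => ?_) (hc.trans h1.symm)
    rw [h0, mul_zero] at hc
    exact pow_ne_zero _ spNum_ne_zero hc.symm
  obtain ⟨ε, hε, he⟩ := exists_of_coeff_spz (h2 ▸ hδ)
  rw [← he]
  exact (hb1 ε hε).2.le

/-- Partial polarization: in monomials of degree `e` in `x`, replace one factor `x` by the new
variable. -/
def polar (x : σ) (e : ℕ) (m : Mon σ) : Mon (Option σ) :=
  if m x = e then exm m - va (some x) + va none else exm m

variable {x : σ} {e : ℕ} {m n : Mon σ}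

omit [Fintype σ] in
lemma polar_none : polar x e m none = if m x = e then 1 else 0 := by
  rw [polar]
  split_ifs <;> simp [va]

omit [Fintype σ] in
lemma polar_some_self (h : m x = e) : polar x e m (some x) = e - 1 := by
  simp [polar, h, va]

omit [Fintype σ] in
lemma polar_some_of (i : σ) (h : i ≠ x ∨ m x ≠ e) : polar x e m (some i) = m i := by
  rw [polar]
  split_ifs with h1
  · have : i ≠ x := h.resolve_right (not_not.2 h1)
    simp [va, this]
  · rfl

omit [Fintype σ] in
lemma polar_some_add (he : e ≠ 0) (i : σ) :
    polar x e m (some i) + (if i = x then polar x e m none else 0) = m i := by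
  by_cases h : i = x ∧ m x = e
  · obtain ⟨rfl, h⟩ := h
    rw [polar_some_self h, polar_none, if_pos rfl, if_pos h]
    omega
  · rw [polar_some_of i (by tauto), polar_none]
    split_ifs with h1 h2
    · exact absurd ⟨h1, h2⟩ h
    · rfl
    · rfl

omit [Fintype σ] in
lemma polar_injective (he : e ≠ 0) : Function.Injective (polar x e) := fun m n h => funext fun i =>
  (polar_some_add (x := x) he i).symm.trans (by rw [h, polar_some_add he i])

omit [Fintype σ] in
lemma polar_le (i : σ) : polar x e m (some i) ≤ m i := by
  by_cases h : i = x ∧ m x = e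
  · obtain ⟨rfl, h⟩ := h
    rw [polar_some_self h]
    omega
  · rw [polar_some_of i (by tauto)]

omit [Fintype σ] in
lemma polar_ne_zero (he : 2 ≤ e) {i : σ} (h : m i ≠ 0) : polar x e m (some i) ≠ 0 := by
  by_cases h' : i = x ∧ m x = e
  · obtain ⟨rfl, h⟩ := h'
    rw [polar_some_self h]
    omega
  · rwa [polar_some_of i (by tauto)]

omit [Fintype σ] in
lemma NCF.polar (he : 2 ≤ e) (h : NCF m n) : NCF (polar x e m) (polar x e n) := by
  obtain ⟨i, h1, h2⟩ := h
  exact ⟨some i, polar_ne_zero he h1, polar_ne_zero he h2⟩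

lemma NonLinear.exm (hM : NonLinear M) : NonLinear (M.image exm) := by
  intro m' hm'
  obtain ⟨m, hm, rfl⟩ := Finset.mem_image.1 hm'
  refine ⟨fun h => (hM m hm).1 (exm_injective (h.trans (map_zero _).symm)), ?_⟩
  rintro (_ | y) h
  · exact (hM m hm).1 (funext fun i => by simpa [va] using h (some i))
  · refine (hM m hm).2 y fun i => ?_
    by_cases hi : i = y
    · subst hi; simpa [va] using h (some i)
    · simpa [va, hi] using h (some i)

lemma NonLinear.polar (hM : NonLinear M) (he : 2 ≤ e) : NonLinear (M.image (polar x e)) := by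
  have key : ∀ m' ∈ M.image (MonomialRings.polar x e), ∀ y, ¬ m' ≤ va y := by
    intro m' hm' y h
    obtain ⟨m, hm, rfl⟩ := Finset.mem_image.1 hm'
    by_cases hx : m x = e
    · cases y with
      | none =>
        have : e - 1 ≤ 0 := by
          have := h (some x)
          rwa [polar_some_self hx, va_of_ne (by simp)] at this
        omega
      | some y =>
        have : 1 ≤ 0 := by
          have := h none
          rwa [polar_none, if_pos hx, va_of_ne (by simp)] at this
        omega
    · rw [MonomialRings.polar, if_neg hx] at h
      exact (hM.exm _ (Finset.mem_image_of_mem _ hm)).2 y h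
  exact fun m hm => ⟨fun h => key m hm none (h ▸ fun _ => Nat.zero_le _), key m hm⟩

lemma degBd_polar (he : 2 ≤ e) : degBd (M.image (polar x e)) ≤ degBd M := by
  refine add_le_add Finset.card_image_le (Finset.sup_le fun D hD => ?_)
  obtain ⟨hD, hdisc⟩ := Finset.mem_filter.1 hD
  have h1 : (M.filter (polar x e · ∈ D)).image (polar x e) = D := by
    ext d
    simp only [Finset.mem_image, Finset.mem_filter]
    constructor
    · rintro ⟨m, hm, rfl⟩
      exact hm.2
    · intro hd
      obtain ⟨m, hm, rfl⟩ := Finset.mem_image.1 (Finset.mem_powerset.1 hD hd)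
      exact ⟨m, ⟨hm, hd⟩, rfl⟩
  calc D.card ≤ (M.filter (polar x e · ∈ D)).card := by
        conv_lhs => rw [← h1]
        exact Finset.card_image_le
    _ ≤ _ := Finset.le_sup (f := Finset.card) (Finset.mem_filter.2
        ⟨Finset.mem_powerset.2 (Finset.filter_subset _ _), fun a ha b hb hab h => ?_⟩)
  exact hdisc _ (Finset.mem_filter.1 ha).2 _ (Finset.mem_filter.1 hb).2
    ((polar_injective (by omega)).ne hab) (h.polar he)

/-- The distance of a set of monomials from being square-free. -/
def excess (M : Finset (Mon σ)) : ℕ := ∑ m ∈ M, ∑ i, (m i - 1)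

lemma excess_polar (he : 2 ≤ e) (hm : m ∈ M) (hx : m x = e) :
    excess (M.image (polar x e)) < excess M := by
  rw [excess, Finset.sum_image (polar_injective (by omega)).injOn]
  have h0 : ∀ m : Mon σ, polar x e m none - 1 = 0 := fun m => by
    rw [polar_none]
    split_ifs <;> rfl
  refine Finset.sum_lt_sum (fun m _ => ?_) ⟨m, hm, ?_⟩ <;> rw [Fintype.sum_option, h0, zero_add]
  · exact Finset.sum_le_sum fun i _ => Nat.sub_le_sub_right (polar_le i) 1
  · refine Finset.sum_lt_sum (fun i _ => Nat.sub_le_sub_right (polar_le i) 1)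
      ⟨x, Finset.mem_univ _, ?_⟩
    rw [polar_some_self hx, hx]
    omega

lemma spz_pser_exm (hM : NonLinear M) :
    spz (Option σ) (pser k (upperSet (M.image exm))) = spz σ (pser k (upperSet M)) * spNum := by
  have h0 : (0 : Mon σ) ∉ upperSet M := fun ⟨m, hm, h⟩ =>
    (hM m hm).1 (le_antisymm h fun _ => Nat.zero_le _)
  have h1 : upperSet (M.image exm) = {β | (fun i => β (some i)) ∈ upperSet M} := by
    ext β
    constructor
    · rintro ⟨m', hm', h⟩
      obtain ⟨m, hm, rfl⟩ := Finset.mem_image.1 hm'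
      exact ⟨m, hm, fun i => h (some i)⟩
    · rintro ⟨m, hm, h⟩
      refine ⟨exm m, Finset.mem_image_of_mem _ hm, ?_⟩
      rintro (_ | i)
      · exact Nat.zero_le _
      · exact h i
  have h2 : (Option.map fun _ : Option σ => ()) ∘ Option.map (some : σ → Option σ) =
      Option.map fun _ : σ => () := by
    ext (_ | i) <;> rfl
  rw [h1, pser_option (upperSet_up M) h0, map_mul, spz_factor]
  congr 1
  rw [spz, MvPowerSeries.rename_rename, spz]
  congr 2

/-- Partial polarization does not change the specialized Poincaré series, up to the factor
coming from the new variable. -/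
lemma spz_pser_polar (hM : NonLinear M) (he : 2 ≤ e) (hx : ∀ m ∈ M, m x ≤ e) :
    spz (Option σ) (pser k (upperSet (M.image (polar x e)))) =
      spz σ (pser k (upperSet M)) * spNum := by
  set N := (M.image exm).filter (· (some x) < e) with hN
  set V := ((M.image exm).filter (· (some x) = e)).image (· - va (some x)) with hV
  have hMe := hM.exm
  have h1 : (Par.gen N V).Mult (va (some x)) := quo_mult hMe
  have h2 : (Par.gen N V).Mult (va none) := by
    refine Par.gen_mult (fun m hm => (hMe m (Finset.filter_subset _ _ hm)).2 none) ?_ ?_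
    · intro v hv h0
      obtain ⟨m, hm, rfl⟩ := Finset.mem_image.1 hv
      exact (hMe m (Finset.filter_subset _ _ hm)).2 _ (tsub_eq_zero_iff_le.1 h0)
    · intro m hm v hv
      obtain ⟨m, hm', rfl⟩ := Finset.mem_image.1 (Finset.filter_subset _ _ hm)
      exact Nat.zero_le _
  have e1 := Par.gen_quo h1
  have e2 := Par.gen_quo h2
  rw [split_generators (M.image exm) (some x) e (by omega) (by simpa using hx)] at e1
  have e3 : N ∪ V.image (· + va none) = M.image (polar x e) := by
    ext d
    simp only [hN, hV, Finset.mem_union, Finset.mem_image, Finset.mem_filter]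
    constructor
    · rintro (⟨⟨m, hm, rfl⟩, h⟩ | ⟨_, ⟨_, ⟨⟨m, hm, rfl⟩, h⟩, rfl⟩, rfl⟩)
      · exact ⟨m, hm, by rw [polar, if_neg]; exact h.ne⟩
      · exact ⟨m, hm, by rw [polar, if_pos]; exact h⟩
    · rintro ⟨m, hm, rfl⟩
      rw [polar]
      split_ifs with h
      · exact .inr ⟨_, ⟨_, ⟨⟨m, hm, rfl⟩, h⟩, rfl⟩, rfl⟩
      · exact .inl ⟨⟨m, hm, rfl⟩, (hx m hm).lt_of_ne h⟩
  rw [e3] at e2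
  have g1 := congrArg (spz (Option σ)) (h1.golod (k := k))
  have g2 := congrArg (spz (Option σ)) (h2.golod (k := k))
  have hmon : ∀ o : Option σ, spz (Option σ) (MvPowerSeries.monomial (sh2 (va o)) 1) =
      MvPowerSeries.monomial (single none 2 + single (some ()) 1) 1 := fun o => by
    rw [spz, MvPowerSeries.rename_monomial, sh2, zz, ← single_add, mapDomain_add, mapDomain_single,
      ex_va, mapDomain_single]
    rfl
  rw [e1, map_mul, map_sub, map_mul, map_one, hmon] at g1
  rw [e2, map_mul, map_sub, map_mul, map_one, hmon] at g2
  rw [← spz_pser_exm hM]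
  refine mul_right_cancel₀ (fun h0 => ?_) (g2.symm.trans g1)
  have := congrArg MvPowerSeries.constantCoeff h0
  rw [map_sub, map_one, map_mul, ← MvPowerSeries.coeff_zero_eq_constantCoeff_apply,
    MvPowerSeries.coeff_monomial, if_neg, map_zero] at this
  · simp at this
  · intro h
    simpa using DFunLike.congr_fun h none

variable (k) in
/-- The degree bound for the denominator. -/
theorem specBound (σ : Type) [Fintype σ] (M : Finset (Mon σ)) (hM : NonLinear M) :
    SpecBound k M := by
  induction h : excess M using Nat.strong_induction_on generalizing σ with
  | _ n ih =>
  by_cases hsq : ∀ m ∈ M, ∀ i, m i ≤ 1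
  · exact specBound_of_squarefree hM hsq
  push Not at hsq
  obtain ⟨m₀, hm₀, x, hx⟩ := hsq
  obtain ⟨m, hm, hmax⟩ := M.exists_max_image (· x) ⟨m₀, hm₀⟩
  have he : 2 ≤ m x := hx.trans_le (hmax m₀ hm₀)
  intro c hc δ hδ
  refine (ih _ (h ▸ excess_polar he hm rfl) _ _ (hM.polar he) rfl c ?_ δ hδ).trans (degBd_polar he)
  rw [spz_pser_polar hM he hmax, ← mul_assoc, hc, Fintype.card_option, pow_succ]

end Polarization

end MonomialRings

namespace MonomialRings

open Finsupp hiding some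

section Conclusion

variable {k : Type*} [Field k] {t : ℕ}

lemma expSet_eq_upperSet {M : Finset (Mon (Fin t))} {I : Ideal (MvPolynomial (Fin t) k)}
    (h : IsMonomialIdealOf M I) : expSet I = upperSet M := by
  ext β
  have h1 : ((fun m => MvPolynomial.monomial (equivFunOnFinite.symm m) (1 : k)) ''
      (M : Set (Mon (Fin t)))) =
      (fun s => MvPolynomial.monomial s (1 : k)) ''
        (equivFunOnFinite.symm '' (M : Set (Mon (Fin t)))) := by
    rw [Set.image_image]
  change MvPolynomial.monomial _ _ ∈ I ↔ _
  rw [h, h1, MvPolynomial.mem_ideal_span_monomial_image, MvPolynomial.support_monomial,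
    if_neg one_ne_zero]
  simp only [upperSet, Set.mem_ofPred_eq, Finset.mem_singleton, forall_eq, Set.exists_mem_image]
  exact Iff.rfl

lemma nonLinear_of_mdeg {M : Finset (Mon (Fin t))} (h : ∀ m ∈ M, 2 ≤ mdeg m) : NonLinear M := by
  have key : ∀ m ∈ M, ∀ y, ¬ m ≤ va y := fun m hm y hle => by
    have h1 : mdeg m ≤ 1 := (Finset.sum_le_sum fun i _ => hle i).trans (by simp [va])
    have := h m hm
    omega
  refine fun m hm => ⟨?_, key m hm⟩
  rintro rfl
  simpa [mdeg] using h 0 hm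

lemma natDegree_zSpecialize_le {b : MvPolynomial (Option (Fin t)) ℤ} {n : ℕ}
    (h : ∀ δ, MvPowerSeries.coeff δ (spz (Fin t) b) ≠ 0 → δ none ≤ n) :
    (zSpecialize b).natDegree ≤ n := by
  rw [spz, MvPowerSeries.rename_coe] at h
  have h1 : zSpecialize b = MvPolynomial.aeval
      (fun o : Option Unit => Option.elim o Polynomial.X fun _ => 1)
      (MvPolynomial.rename (Option.map fun _ => ()) b) := by
    rw [MvPolynomial.aeval_rename, zSpecialize]
    congr 2
    ext1 o
    cases o <;> rfl
  rw [h1, MvPolynomial.aeval_def, MvPolynomial.eval₂_eq']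
  refine Polynomial.natDegree_sum_le_of_forall_le _ _ fun δ hδ => ?_
  rw [Fintype.prod_option]
  have h2 := h δ (by rwa [MvPolynomial.coeff_coe, ← MvPolynomial.mem_support_iff])
  simp only [Option.elim, one_pow, Finset.prod_const_one, mul_one]
  exact (Polynomial.natDegree_C_mul_X_pow_le _ _).trans h2

end Conclusion

end MonomialRings

/-- **Corollary (degree bound).**
With `R = k[x₁,…,x_t]/I`, `I` minimally generated by the set `M` of `n` monomials of
degree at least 2, the specialization `b_R(z) = b_R(1,…,1,z)` of the denominator of the
Poincaré series satisfies `deg b_R(z) ≤ n + g`, where `g` is the largest size of a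
discrete subset of `M`. -/
theorem degree_bound_of_denominator
    (t : ℕ) (k : Type) [Field k]
    (M : Finset (Mon (Fin t)))
    (I : Ideal (MvPolynomial (Fin t) k))
    (hgen : IsMonomialIdealOf M I)
    (hmin : IsAntichain' M)
    (hdeg : ∀ m ∈ M, 2 ≤ mdeg m)
    (b : MvPolynomial (Option (Fin t)) ℤ)
    (hb : IsDenominator k (expSet I) b) :
    (zSpecialize b).natDegree ≤ M.card + (M.powerset.filter Discrete).sup Finset.card := by
  refine natDegree_zSpecialize_le fun δ hδ => ?_
  refine specBound k (Fin t) M (nonLinear_of_mdeg hdeg) _ ?_ δ hδ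
  have h : (b : MvPowerSeries (Option (Fin t)) ℤ) * pser k (upperSet M) =
      ∏ i : Fin t, (1 + MvPowerSeries.X (some i) * MvPowerSeries.X none) := by
    rw [← expSet_eq_upperSet hgen]
    exact hb
  rw [← map_mul, h, map_prod, Finset.prod_congr rfl fun i _ => spz_factor i, Finset.prod_const,
    Finset.card_univ]
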